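/- arXiv:2202.11293 — 3 statements merged into one kernel-verified Lean document; each statement's English description precedes it below -/
import Mathlib

section
/- If α is a Liouville number, then sinh α is transcendental. -/
namespace LS
open PowerSeries Finset

noncomputable def e (k : ℕ) : ℝ⟦X⟧ := X * PowerSeries.mk (fun t => (k:ℝ)^t)

lemma e_eq (k : ℕ) : e k = X + (k:ℝ) • (X * e k) := by
  ext t
  rcases t with _ | _ | t
  · simp [e]
  · simp [e, coeff_succ_X_mul, coeff_one_X]
  · simp [e, coeff_succ_X_mul, coeff_X, pow_succ']

lemma e_mul (l k : ℕ) : ((l:ℝ) - k) • (e l * e k) = e l - e k := by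
  have h1 := e_eq l
  have h2 := e_eq k
  have hX : (X : ℝ⟦X⟧) ≠ 0 := X_ne_zero
  apply mul_left_cancel₀ hX
  rw [smul_eq_C_mul] at *
  rw [map_sub]
  linear_combination (-e k) * h1 + e l * h2

lemma e_pow_coeff (k p t : ℕ) :
    coeff (t+1) (e k ^ (p+1)) = (t.choose p : ℝ) * (k:ℝ)^(t-p) := by
  have h : e k = X * rescale (k:ℝ) (PowerSeries.mk 1) := by
    unfold e; congr 1; ext t; simp [coeff_rescale]
  rw [h, mul_pow, ← map_pow, mk_one_pow_eq_mk_choose_add, coeff_X_pow_mul']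
  split_ifs with hh
  · rw [coeff_rescale, coeff_mk]
    have : t + 1 - (p+1) = t - p := by omega
    rw [this, Nat.add_sub_cancel' (by omega)]
    ring
  · rw [Nat.choose_eq_zero_of_lt (by omega)]; simp

def IsZ (x : ℝ) : Prop := ∃ z : ℤ, x = z

lemma IsZ.add {x y : ℝ} (hx : IsZ x) (hy : IsZ y) : IsZ (x+y) := by
  obtain ⟨a, rfl⟩ := hx; obtain ⟨b, rfl⟩ := hy; exact ⟨a+b, by push_cast; ring⟩
lemma IsZ.mul {x y : ℝ} (hx : IsZ x) (hy : IsZ y) : IsZ (x*y) := by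
  obtain ⟨a, rfl⟩ := hx; obtain ⟨b, rfl⟩ := hy; exact ⟨a*b, by push_cast; ring⟩
lemma IsZ.neg {x : ℝ} (hx : IsZ x) : IsZ (-x) := by
  obtain ⟨a, rfl⟩ := hx; exact ⟨-a, by push_cast; ring⟩
lemma IsZ.pow {x : ℝ} (hx : IsZ x) (n : ℕ) : IsZ (x^n) := by
  obtain ⟨a, rfl⟩ := hx; exact ⟨a^n, by push_cast; ring⟩
lemma IsZ.nat (n : ℕ) : IsZ (n:ℝ) := ⟨n, by simp⟩
lemma IsZ.zero : IsZ 0 := ⟨0, by simp⟩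
lemma IsZ.sum {ι : Type*} (s : Finset ι) (f : ι → ℝ) (h : ∀ i ∈ s, IsZ (f i)) :
    IsZ (∑ i ∈ s, f i) := Finset.sum_induction f IsZ (fun _ _ => IsZ.add) IsZ.zero h

def HH (m : ℕ) (L : ℕ) (n : ℕ) (B : ℝ) (f : ℝ⟦X⟧) : Prop :=
  ∃ x : ℕ → ℕ → ℝ, (∀ k j, IsZ ((L:ℝ)^(n-j) * x k j)) ∧
    ∑ k ∈ range (m+1), ∑ j ∈ range n, |x k j| ≤ B ∧
    f = ∑ k ∈ range (m+1), ∑ j ∈ range n, x k j • e k ^ (j+1)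

section
variable {m L n : ℕ}

lemma HH.zero : HH m L n 0 0 := ⟨fun _ _ => 0, by simpa using IsZ.zero, by simp, by simp⟩

lemma HH.add {B B' : ℝ} {f g : ℝ⟦X⟧} (hf : HH m L n B f) (hg : HH m L n B' g) :
    HH m L n (B+B') (f+g) := by
  obtain ⟨x, h1, h2, rfl⟩ := hf
  obtain ⟨y, h3, h4, rfl⟩ := hg
  refine ⟨fun k j => x k j + y k j, fun k j => ?_, ?_, ?_⟩
  · rw [mul_add]; exact (h1 k j).add (h3 k j)
  · refine le_trans ?_ (add_le_add h2 h4)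
    rw [← sum_add_distrib]
    refine sum_le_sum fun k _ => ?_
    rw [← sum_add_distrib]
    exact sum_le_sum fun j _ => abs_add_le _ _
  · simp only [add_smul, sum_add_distrib]

lemma HH.mono {B B' : ℝ} {f : ℝ⟦X⟧} (hf : HH m L n B f) (h : B ≤ B') : HH m L n B' f := by
  obtain ⟨x, h1, h2, h3⟩ := hf
  exact ⟨x, h1, h2.trans h, h3⟩

lemma HH.sum {ι : Type*} (s : Finset ι) (B : ι → ℝ) (f : ι → ℝ⟦X⟧)
    (h : ∀ i ∈ s, HH m L n (B i) (f i)) : HH m L n (∑ i ∈ s, B i) (∑ i ∈ s, f i) := by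
  classical
  induction s using Finset.induction_on with
  | empty => simpa using HH.zero
  | insert a s ha ih =>
    rw [sum_insert ha, sum_insert ha]
    exact (h a (by simp)).add (ih fun i hi => h i (by simp [hi]))

lemma HH.single {k j : ℕ} (hk : k ≤ m) (hj : j < n) (y : ℝ) (hy : IsZ ((L:ℝ)^(n-j) * y)) :
    HH m L n |y| (y • e k ^ (j+1)) := by
  refine ⟨fun k' j' => if k' = k then (if j' = j then y else 0) else 0, fun k' j' => ?_, ?_, ?_⟩
  · by_cases h1 : k' = k
    · by_cases h2 : j' = j
      · subst h1 h2; simpa using hy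
      · simpa [h1, h2] using IsZ.zero
    · simpa [h1] using IsZ.zero
  · rw [sum_eq_single k, sum_eq_single j]
    · simp
    · intro b _ hb; simp [hb]
    · intro h; simp at h; omega
    · intro b _ hb; simp [hb]
    · intro h; simp at h; omega
  · rw [sum_eq_single k, sum_eq_single j]
    · simp
    · intro b _ hb; simp [hb]
    · intro h; simp at h; omega
    · intro b _ hb; simp [hb]
    · intro h; simp at h; omega

lemma isZ_div (hL : ∀ a : ℕ, a ≠ 0 → a ≤ m → a ∣ L) {l k : ℕ} (hl : l ≤ m) (hk : k ≤ m)
    (hlk : l ≠ k) : IsZ ((L:ℝ) / ((l:ℝ) - k)) := by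
  rcases lt_or_gt_of_ne hlk with h | h
  · obtain ⟨c, hc⟩ := hL (k - l) (by omega) (by omega)
    refine ⟨-c, ?_⟩
    have : (l:ℝ) - k ≠ 0 := sub_ne_zero.2 (by exact_mod_cast hlk)
    rw [div_eq_iff this, hc]; push_cast [Nat.cast_sub h.le]; ring
  · obtain ⟨c, hc⟩ := hL (l - k) (by omega) (by omega)
    refine ⟨c, ?_⟩
    have : (l:ℝ) - k ≠ 0 := sub_ne_zero.2 (by exact_mod_cast hlk)
    rw [div_eq_iff this, hc]; push_cast [Nat.cast_sub h.le]; ring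

lemma HH.mulE (hL : ∀ a : ℕ, a ≠ 0 → a ≤ m → a ∣ L) {l k : ℕ} (hl : l ≤ m) (hk : k ≤ m)
    (hlk : l ≠ k) (hn : 1 ≤ n) (p : ℕ) : ∀ (y : ℝ), p ≤ n → IsZ ((L:ℝ)^(n-p) * y) →
    HH m L n ((p+1) * |y|) (y • (e l * e k ^ p)) := by
  have hne : (l:ℝ) - k ≠ 0 := sub_ne_zero.2 (by exact_mod_cast hlk)
  have habs : 1 ≤ |(l:ℝ) - k| := by
    have : (1:ℤ) ≤ |(l:ℤ) - k| := Int.one_le_abs (by omega)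
    exact_mod_cast this
  induction p with
  | zero =>
    intro y _ hy
    have := HH.single (m := m) (L := L) hl (j := 0) hn y hy
    simpa using this
  | succ p ih =>
    intro y hp hy
    have hy' : IsZ ((L:ℝ)^(n-p) * (y / ((l:ℝ) - k))) := by
      have : (L:ℝ)^(n-p) * (y / ((l:ℝ) - k)) =
        ((L:ℝ)^(n-(p+1)) * y) * ((L:ℝ) / ((l:ℝ) - k)) := by
        have : n - p = n - (p+1) + 1 := by omega
        rw [this, pow_succ]; field_simp
      rw [this]; exact hy.mul (isZ_div hL hl hk hlk)
    have h1 := ih (y / ((l:ℝ) - k)) (by omega) hy'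
    have h2 := HH.single (m := m) (L := L) (n := n) hk (j := p) (by omega) (-(y / ((l:ℝ) - k)))
      (by rw [mul_neg]; exact hy'.neg)
    have h3 := h1.add h2
    have hle : |y / ((l:ℝ) - k)| ≤ |y| := by
      rw [abs_div]; exact div_le_self (abs_nonneg _) habs
    have heq : y • (e l * e k ^ (p+1)) = (y / ((l:ℝ) - k)) • (e l * e k ^ p) +
        (-(y / ((l:ℝ) - k))) • e k ^ (p+1) := by
      have := e_mul l k
      have h4 : e l * e k ^ (p+1) = ((l:ℝ) - k)⁻¹ • ((e l - e k) * e k ^ p) := by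
        rw [← this, smul_mul_assoc, smul_smul, inv_mul_cancel₀ hne, one_smul]; ring
      rw [h4, smul_smul, neg_smul, ← sub_eq_add_neg, ← smul_sub, div_eq_mul_inv]
      congr 1; ring
    rw [heq]
    refine h3.mono ?_
    rw [abs_neg]; push_cast
    have : (0:ℝ) ≤ p := by positivity
    nlinarith

/-- `m! / ∏ (w - k)` -/
noncomputable def E (m : ℕ) : ℝ⟦X⟧ :=
  ∑ l ∈ range (m+1), ((-1)^(m-l) * (m.choose l : ℝ)) • e l

lemma sum_abs_coef (m : ℕ) :
    ∑ l ∈ range (m+1), |(-1)^(m-l) * (m.choose l : ℝ)| = 2^m := by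
  simp only [abs_mul, abs_pow, abs_neg, abs_one, one_pow, one_mul, Nat.abs_cast]
  exact_mod_cast Nat.sum_range_choose m

lemma isZ_coef (m l : ℕ) : IsZ ((-1)^(m-l) * (m.choose l : ℝ)) :=
  (IsZ.pow (x := -1) ⟨-1, by simp⟩ _).mul (IsZ.nat _)

lemma E_dvd (m : ℕ) : X^(m+1) ∣ E m := by
  rw [X_pow_dvd_iff]
  intro t ht
  unfold E
  rw [map_sum]
  rcases t with _ | t
  · exact sum_eq_zero fun l _ => by simp [e]
  have h := fwdDiff_iter_pow_eq_zero_of_lt (R := ℝ) (j := t) (n := m) (by omega)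
  have h' := congrFun h 0
  rw [fwdDiff_iter_eq_sum_shift] at h'
  simp only [zero_add, Pi.zero_apply] at h'
  rw [← h']
  refine sum_congr rfl fun l _ => ?_
  simp [e, coeff_succ_X_mul]

lemma HH.step (hL : ∀ a : ℕ, a ≠ 0 → a ≤ m → a ∣ L) {B : ℝ} {g : ℝ⟦X⟧} (h : HH m L n B g) :
    HH m L (n+1) (2^m * (n+2) * B) (E m * g) := by
  obtain ⟨x, h1, h2, rfl⟩ := h
  have : E m * ∑ k ∈ range (m+1), ∑ j ∈ range n, x k j • e k ^ (j+1) =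
      ∑ l ∈ range (m+1), ∑ k ∈ range (m+1), ∑ j ∈ range n,
        (((-1)^(m-l) * (m.choose l : ℝ)) * x k j) • (e l * e k ^ (j+1)) := by
    simp only [E, sum_mul]
    refine sum_congr rfl fun l _ => ?_
    simp only [mul_sum, smul_mul_smul_comm]
  rw [this]
  refine (HH.sum _ (fun l => ∑ k ∈ range (m+1), ∑ j ∈ range n,
    (n+2) * |((-1)^(m-l) * (m.choose l : ℝ)) * x k j|) _ fun l hl =>
    HH.sum _ _ _ fun k hk => HH.sum _ _ _ fun j hj => ?_).mono ?_
  · simp only [mem_range] at hl hk hj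
    have hz : IsZ ((L:ℝ)^(n+1-(j+1)) * (((-1)^(m-l) * (m.choose l : ℝ)) * x k j)) := by
      rw [mul_left_comm]
      refine (isZ_coef m l).mul ?_
      rw [Nat.add_sub_add_right]; exact h1 k j
    have hj' : (j:ℝ) + 1 ≤ n := by exact_mod_cast hj
    by_cases hlk : l = k
    · subst hlk
      have := HH.single (m := m) (L := L) (n := n+1) (k := l) (j := j+1) (by omega) (by omega) _ hz
      rw [← pow_succ']
      refine this.mono ?_
      have : (0:ℝ) ≤ n := by positivity
      nlinarith [abs_nonneg ((-1)^(m-l) * (m.choose l : ℝ) * x l j)]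
    · refine (HH.mulE hL (by omega) (by omega) hlk (by omega) (j+1) _ (by omega) hz).mono ?_
      push_cast
      gcongr; linarith
  · have h3 : ∀ l, ∑ k ∈ range (m+1), ∑ j ∈ range n,
        ((n:ℝ)+2) * |((-1)^(m-l) * (m.choose l : ℝ)) * x k j| =
        |(-1)^(m-l) * (m.choose l : ℝ)| *
          ((n+2) * ∑ k ∈ range (m+1), ∑ j ∈ range n, |x k j|) := by
      intro l
      simp only [mul_sum]
      refine sum_congr rfl fun k _ => sum_congr rfl fun j _ => ?_
      rw [abs_mul _ (x k j)]; ring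
    simp only [h3]
    rw [← sum_mul, sum_abs_coef, mul_assoc]
    gcongr

noncomputable def yy (m i : ℕ) : ℝ := (-1)^(m-i) * (m.choose i : ℝ)

lemma e_mul_E_pow (hL : ∀ a : ℕ, a ≠ 0 → a ≤ m → a ∣ L) {i : ℕ} (hi : i ≤ m) (n : ℕ) :
    ∃ g B, e i * E m ^ n = (yy m i)^n • e i ^ (n+1) + g ∧ HH m L n B g ∧
      |yy m i|^n + B ≤ (2^m * (n+1))^n := by
  induction n with
  | zero => exact ⟨0, 0, by simp, HH.zero, by simp⟩
  | succ n ih =>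
    obtain ⟨g, B, h1, h2, h3⟩ := ih
    have hsplit : E m = yy m i • e i + ∑ l ∈ (range (m+1)).erase i, yy m l • e l := by
      rw [E]; exact (add_sum_erase _ (fun l => yy m l • e l) (by simp; omega)).symm
    have hsum : |yy m i| + ∑ l ∈ (range (m+1)).erase i, |yy m l| = 2^m := by
      rw [← sum_abs_coef]; exact (add_sum_erase _ (fun l => |yy m l|) (by simp; omega))
    have hy : IsZ ((yy m i)^n) := (isZ_coef m i).pow n
    have h4 : HH m L (n+1) (∑ l ∈ (range (m+1)).erase i, (((n+1:ℕ):ℝ)+1) * |yy m l * yy m i ^ n|)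
        (∑ l ∈ (range (m+1)).erase i, (yy m l * yy m i ^ n) • (e l * e i ^ (n+1))) := by
      refine HH.sum _ _ _ fun l hl => ?_
      simp only [mem_erase, mem_range] at hl
      refine HH.mulE hL (by omega) hi hl.1 (by omega) (n+1) _ le_rfl ?_
      rw [Nat.sub_self, pow_zero, one_mul]
      exact (isZ_coef m l).mul hy
    refine ⟨_, _, ?_, h4.add (h2.step hL), ?_⟩
    · rw [pow_succ (E m), ← mul_assoc, h1, add_mul, mul_comm g, ← add_assoc]
      refine congrArg₂ (· + ·) ?_ rfl
      nth_rewrite 1 [hsplit]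
      rw [mul_add, smul_mul_smul_comm, mul_sum]
      refine congrArg₂ (· + ·) ?_ ?_
      · rw [pow_succ (yy m i), pow_succ (e i) (n+1)]
      · refine sum_congr rfl fun l _ => ?_
        rw [smul_mul_smul_comm, mul_comm (yy m l), mul_comm (e l)]
    · have hB : 0 ≤ B := by
        obtain ⟨x, _, h5, _⟩ := h2
        exact le_trans (sum_nonneg fun _ _ => sum_nonneg fun _ _ => abs_nonneg _) h5
      have e1 : ∑ l ∈ (range (m+1)).erase i, (((n+1:ℕ):ℝ)+1) * |yy m l * yy m i ^ n| =
          (n+2) * |yy m i|^n * ∑ l ∈ (range (m+1)).erase i, |yy m l| := by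
        rw [mul_sum]; refine sum_congr rfl fun l _ => ?_
        rw [abs_mul, abs_pow]; push_cast; ring
      rw [e1]
      have h6 : (0:ℝ) ≤ |yy m i| ^ n := by positivity
      have h7 := abs_nonneg (yy m i)
      calc |yy m i|^(n+1) + ((n+2) * |yy m i|^n * ∑ l ∈ (range (m+1)).erase i, |yy m l|
              + 2^m * (n+2) * B)
          ≤ (n+2) * |yy m i|^n * |yy m i| + ((n+2) * |yy m i|^n *
              ∑ l ∈ (range (m+1)).erase i, |yy m l| + 2^m * (n+2) * B) := by
            gcongr
            rw [pow_succ]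
            have : (0:ℝ) ≤ n := by positivity
            nlinarith [mul_nonneg h6 h7]
        _ = (2^m * (n+2)) * (|yy m i|^n + B) := by rw [← hsum]; ring
        _ ≤ (2^m * (n+2)) * (2^m * (n+1))^n := by gcongr
        _ ≤ (2^m * (n+2)) * (2^m * (n+2))^n := by gcongr; norm_num
        _ = _ := by push_cast; rw [pow_succ']; ring

lemma key (hL : ∀ a : ℕ, a ≠ 0 → a ≤ m → a ∣ L) {i : ℕ} (hi : i ≤ m) (n : ℕ) :
    ∃ c : ℕ → ℕ → ℝ, (∀ k j, IsZ ((L:ℝ)^n * c k j)) ∧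
      ∑ k ∈ range (m+1), ∑ j ∈ range (n+1), |c k j| ≤ (2^m * (n+1))^n ∧
      (∀ k, k ≠ i → c k n = 0) ∧ c i n ≠ 0 ∧
      ∀ t < n * (m+1), ∑ k ∈ range (m+1), ∑ j ∈ range (n+1),
        c k j * ((t.choose j : ℝ) * (k:ℝ)^(t-j)) = 0 := by
  obtain ⟨g, B, h1, ⟨x, h2, h3, h4⟩, h5⟩ := e_mul_E_pow hL hi n
  have hi' : i ∈ range (m+1) := by simp; omega
  let c : ℕ → ℕ → ℝ := fun k j => if j = n then (if k = i then yy m i ^ n else 0) else x k j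
  have hc1 : ∀ k, c k n = if k = i then yy m i ^ n else 0 := fun k => by simp [c]
  have hc2 : ∀ k, ∀ j ∈ range n, c k j = x k j := fun k j hj => by
    simp only [mem_range] at hj
    simp [c, hj.ne]
  refine ⟨c, ?_, ?_, ?_, ?_, ?_⟩
  · intro k j
    by_cases hj : j = n
    · subst hj
      rw [hc1]
      split_ifs
      · exact ((IsZ.nat L).pow _).mul ((isZ_coef m i).pow _)
      · simpa using IsZ.zero
    · have : c k j = x k j := by simp [c, hj]
      rw [this]
      have h6 : n = j ⊓ n + (n - j) := by omega
      have h7 : (L:ℝ)^n = (L:ℝ)^(j ⊓ n) * (L:ℝ)^(n-j) := by rw [← pow_add, ← h6]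
      rw [h7, mul_assoc]
      exact ((IsZ.nat L).pow _).mul (h2 k j)
  · simp only [sum_range_succ _ n]
    rw [sum_add_distrib]
    have e1 : ∑ k ∈ range (m+1), |c k n| = |yy m i| ^ n := by
      rw [sum_eq_single i]
      · rw [hc1]; simp [abs_pow]
      · intro k _ hk; simp [hc1, hk]
      · simp [hi']
    have e2 : ∑ k ∈ range (m+1), ∑ j ∈ range n, |c k j| ≤ B := by
      refine le_trans (le_of_eq ?_) h3
      refine sum_congr rfl fun k _ => sum_congr rfl fun j hj => ?_
      rw [hc2 k j hj]
    linarith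
  · intro k hk; simp [hc1, hk]
  · rw [hc1]; simp only [if_true]
    have : (m.choose i : ℝ) ≠ 0 := by exact_mod_cast (Nat.choose_pos hi).ne'
    unfold yy; simp [this]
  · intro t ht
    have hd : X^(n*(m+1)+1) ∣ e i * E m ^ n := by
      rw [pow_succ', mul_comm n, pow_mul]
      exact mul_dvd_mul (Dvd.intro _ rfl) (pow_dvd_pow_of_dvd (E_dvd m) n)
    have h7 := X_pow_dvd_iff.1 hd (t+1) (by omega)
    rw [h1, h4, map_add, map_sum, coeff_smul, e_pow_coeff] at h7
    simp only [map_sum, coeff_smul, e_pow_coeff] at h7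
    simp only [sum_range_succ _ n]
    rw [sum_add_distrib, add_comm, ← h7]
    congr 1
    · rw [sum_eq_single i]
      · rw [hc1]; simp
      · intro k _ hk; simp [hc1, hk]
      · simp [hi']
    · refine sum_congr rfl fun k _ => sum_congr rfl fun j hj => ?_
      rw [hc2 k j hj]; simp

end

lemma expo_term (c : ℕ → ℕ → ℝ) (m n t : ℕ) :
    coeff t (∑ k ∈ range (m+1), ((∑ j ∈ range (n+1),
      Polynomial.monomial j (c k j / j.factorial) : Polynomial ℝ) : ℝ⟦X⟧) *
        rescale (k:ℝ) (PowerSeries.exp ℝ)) =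
    (∑ k ∈ range (m+1), ∑ j ∈ range (n+1), c k j * ((t.choose j : ℝ) * (k:ℝ)^(t-j))) /
      t.factorial := by
  rw [map_sum, sum_div]
  refine sum_congr rfl fun k _ => ?_
  have : ((∑ j ∈ range (n+1), Polynomial.monomial j (c k j / j.factorial) : Polynomial ℝ) : ℝ⟦X⟧)
      = ∑ j ∈ range (n+1), (c k j / j.factorial) • X^j := by
    rw [← Polynomial.coeToPowerSeries.ringHom_apply, map_sum]
    refine sum_congr rfl fun j _ => ?_
    rw [Polynomial.coeToPowerSeries.ringHom_apply, Polynomial.coe_monomial, smul_eq_C_mul,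
      X_pow_eq, ← monomial_zero_eq_C_apply, monomial_mul_monomial, zero_add, mul_one]
  rw [this, sum_mul, map_sum, sum_div]
  refine sum_congr rfl fun j _ => ?_
  rw [smul_mul_assoc, coeff_smul, coeff_X_pow_mul']
  split_ifs with h
  · rw [coeff_rescale, coeff_exp]
    have := Nat.choose_mul_factorial_mul_factorial h
    have h2 : ((t.choose j : ℝ)) * j.factorial * (t-j).factorial = t.factorial := by
      exact_mod_cast this
    rw [← h2]
    have h3 : (t.choose j : ℝ) ≠ 0 := by exact_mod_cast (Nat.choose_pos h).ne'
    have h4 : (j.factorial : ℝ) ≠ 0 := by positivity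
    have h5 : ((t-j).factorial : ℝ) ≠ 0 := by positivity
    simp only [smul_eq_mul, eq_ratCast, Rat.cast_div, Rat.cast_one, Rat.cast_natCast]
    field_simp
  · rw [Nat.choose_eq_zero_of_lt (by omega)]; simp

lemma nonvanish {m n : ℕ} (c : ℕ → ℕ → ℕ → ℝ)
    (h1 : ∀ i ≤ m, ∀ k, k ≠ i → c i k n = 0) (h2 : ∀ i ≤ m, c i i n ≠ 0)
    (h3 : ∀ i ≤ m, ∀ t < n * (m+1), ∑ k ∈ range (m+1), ∑ j ∈ range (n+1),
        c i k j * ((t.choose j : ℝ) * (k:ℝ)^(t-j)) = 0)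
    (β : ℝ) (hβ : β ≠ 0) (v : ℕ → ℝ) (hv : v 0 ≠ 0) :
    ∃ i ≤ m, ∑ k ∈ range (m+1), (∑ j ∈ range (n+1), c i k j / j.factorial * β^j) * v k ≠ 0 := by
  let A : ℕ → ℕ → Polynomial ℝ := fun i k =>
    ∑ j ∈ range (n+1), Polynomial.monomial j (c i k j / j.factorial)
  let M : Matrix (Fin (m+1)) (Fin (m+1)) (Polynomial ℝ) := Matrix.of fun i k => A i k
  have hdeg : ∀ i k, (A i k).natDegree ≤ n := by
    intro i k
    refine Polynomial.natDegree_sum_le_of_forall_le _ _ fun j hj => ?_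
    exact (Polynomial.natDegree_monomial_le _).trans (by simp at hj; omega)
  have hcoef : ∀ i k, (A i k).coeff n = c i k n / n.factorial := by
    intro i k
    simp only [A, Polynomial.finsetSum_coeff, Polynomial.coeff_monomial]
    rw [sum_eq_single n] <;> simp
    intro b _ hb hb'; exact absurd hb' hb
  have hdet : M.det.coeff ((m+1)*n) ≠ 0 := by
    have : M.det.coeff ((m+1)*n) =
        (Matrix.of fun i k : Fin (m+1) => (A i k).coeff n).det := by
      rw [Matrix.det_apply, Matrix.det_apply, Polynomial.finsetSum_coeff]
      refine sum_congr rfl fun σ _ => ?_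
      rw [Polynomial.coeff_smul]
      congr 1
      have := Polynomial.coeff_prod_of_natDegree_le (s := univ)
        (fun i : Fin (m+1) => M (σ i) i) n (fun i _ => hdeg _ _)
      rw [card_univ, Fintype.card_fin] at this
      exact this
    rw [this]
    have : (Matrix.of fun i k : Fin (m+1) => (A i k).coeff n) =
        Matrix.diagonal fun i : Fin (m+1) => c i i n / n.factorial := by
      ext i k
      simp only [Matrix.of_apply, hcoef, Matrix.diagonal_apply]
      split_ifs with h
      · rw [h]
      · rw [h1 i (by omega) k (fun h' => h (Fin.ext h'.symm))]; simp
    rw [this, Matrix.det_diagonal, prod_ne_zero_iff]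
    intro i _
    have := h2 i (by omega)
    have h4 : (n.factorial : ℝ) ≠ 0 := by positivity
    positivity
  have hdegdet : M.det.natDegree ≤ (m+1)*n := by
    rw [Matrix.det_apply]
    refine Polynomial.natDegree_sum_le_of_forall_le _ _ fun σ _ => ?_
    refine (Polynomial.natDegree_smul_le _ _).trans ?_
    refine (Polynomial.natDegree_prod_le _ _).trans ?_
    refine (sum_le_sum (fun i _ => hdeg (σ i) i)).trans ?_
    simp
  have hdvd : (X : ℝ⟦X⟧)^((m+1)*n) ∣ (M.det : ℝ⟦X⟧) := by
    let N : Matrix (Fin (m+1)) (Fin (m+1)) ℝ⟦X⟧ := M.map Polynomial.coeToPowerSeries.ringHom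
    have hN : (M.det : ℝ⟦X⟧) = N.det := by
      rw [← Polynomial.coeToPowerSeries.ringHom_apply, RingHom.map_det]; rfl
    have h5 := Matrix.det_updateCol_sum N 0
      (fun k : Fin (m+1) => rescale ((k:ℕ):ℝ) (PowerSeries.exp ℝ))
    have h6 : rescale (((0 : Fin (m+1)):ℕ):ℝ) (PowerSeries.exp ℝ) = 1 := by
      ext t; rcases t with _ | t <;> simp [coeff_one]
    rw [h6, one_smul] at h5
    rw [hN, ← h5, Matrix.det_succ_column _ 0]
    refine dvd_sum fun i _ => ?_
    refine Dvd.dvd.mul_right (Dvd.dvd.mul_left ?_ _) _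
    rw [Matrix.updateCol_self, X_pow_dvd_iff]
    intro t ht
    have := expo_term (c i) m n t
    rw [h3 i (by omega) t (by rw [mul_comm]; exact ht), zero_div, Finset.sum_range] at this
    rw [← this]
    congr 1
    refine sum_congr rfl fun k _ => ?_
    rw [smul_eq_mul, mul_comm]; rfl
  have hform : M.det = Polynomial.monomial ((m+1)*n) (M.det.coeff ((m+1)*n)) := by
    ext t
    rw [Polynomial.coeff_monomial]
    split_ifs with h
    · rw [h]
    · rcases lt_or_gt_of_ne h with h | h
      · exact Polynomial.coeff_eq_zero_of_natDegree_lt (by omega)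
      · have := X_pow_dvd_iff.1 hdvd t h
        simpa using this
  let P : Matrix (Fin (m+1)) (Fin (m+1)) ℝ := M.map (Polynomial.evalRingHom β)
  have hP : P.det ≠ 0 := by
    have : P.det = M.det.eval β := by
      rw [← Polynomial.coe_evalRingHom, RingHom.map_det]; rfl
    rw [this, hform, Polynomial.eval_monomial]
    exact mul_ne_zero hdet (pow_ne_zero _ hβ)
  by_contra hcon
  push Not at hcon
  have h7 : P.mulVec (fun k => v k) = 0 := by
    ext i
    have := hcon i (by omega)
    rw [Finset.sum_range] at this
    rw [Matrix.mulVec, Pi.zero_apply, ← this, dotProduct]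
    refine sum_congr rfl fun k _ => ?_
    congr 1
    simp [P, M, A, Polynomial.eval_finsetSum]
  have := Matrix.eq_zero_of_mulVec_eq_zero hP h7
  exact hv (by simpa using congrFun this 0)

lemma small {m n : ℕ} (hn : 1 ≤ n) (hm : 1 ≤ m) (c : ℕ → ℕ → ℝ) (B α : ℝ)
    (hB : ∑ k ∈ range (m+1), ∑ j ∈ range (n+1), |c k j| ≤ B)
    (h3 : ∀ t < n * (m+1), ∑ k ∈ range (m+1), ∑ j ∈ range (n+1),
        c k j * ((t.choose j : ℝ) * (k:ℝ)^(t-j)) = 0) :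
    |∑ k ∈ range (m+1), (∑ j ∈ range (n+1), c k j / j.factorial * α^j) * Real.exp α ^ k| ≤
      B * (Real.exp (2 * |α|) ^ m * (6 * |α| / n)^(n*(m+1))) := by
  set T := n * (m+1) with hT
  have hB0 : 0 ≤ B := le_trans (sum_nonneg fun _ _ => sum_nonneg fun _ _ => abs_nonneg _) hB
  let r : ℕ → ℝ := fun t => ∑ k ∈ range (m+1), ∑ j ∈ range (n+1),
        c k j * ((t.choose j : ℝ) * (k:ℝ)^(t-j))
  have hterm : ∀ (k j : ℕ), HasSum (fun t : ℕ => α^t / t.factorial *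
      ((t.choose j : ℝ) * (k:ℝ)^(t-j))) (α^j / j.factorial * Real.exp α ^ k) := by
    intro k j
    rw [← hasSum_nat_add_iff' j]
    have : ∑ i ∈ range j, α^i / i.factorial * ((i.choose j : ℝ) * (k:ℝ)^(i-j)) = 0 :=
      sum_eq_zero fun i hi => by
        rw [Nat.choose_eq_zero_of_lt (by simpa using hi)]; simp
    rw [this, sub_zero, ← Real.exp_nat_mul]
    have h := (NormedSpace.expSeries_div_hasSum_exp ((k:ℝ) * α)).mul_left (α^j / j.factorial)
    rw [← Real.exp_eq_exp_ℝ] at h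
    refine (iff_of_eq (congrArg (fun f : ℕ → ℝ => HasSum f _) (funext fun t => ?_))).mpr h
    have h2 : (((t+j).choose j : ℝ)) * j.factorial * t.factorial = (t+j).factorial := by
      have := Nat.choose_mul_factorial_mul_factorial (Nat.le_add_left j t)
      rw [Nat.add_sub_cancel] at this
      exact_mod_cast this
    rw [← h2, Nat.add_sub_cancel]
    have h3 : ((t+j).choose j : ℝ) ≠ 0 := by exact_mod_cast (Nat.choose_pos (Nat.le_add_left j t)).ne'
    field_simp
    ring
  have hsum : HasSum (fun t : ℕ => α^t / t.factorial * r t)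
      (∑ k ∈ range (m+1), (∑ j ∈ range (n+1), c k j / j.factorial * α^j) * Real.exp α ^ k) := by
    have := hasSum_sum (s := range (m+1)) fun k _ => hasSum_sum (s := range (n+1)) fun j _ =>
      (hterm k j).mul_left (c k j)
    have e1 : (∑ k ∈ range (m+1), (∑ j ∈ range (n+1), c k j / j.factorial * α^j) * Real.exp α ^ k)
        = ∑ k ∈ range (m+1), ∑ j ∈ range (n+1), c k j * (α^j / j.factorial * Real.exp α ^ k) := by
      refine sum_congr rfl fun k _ => ?_
      rw [sum_mul]
      exact sum_congr rfl fun j _ => by ring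
    rw [e1]
    refine (iff_of_eq (congrArg (fun f : ℕ → ℝ => HasSum f _) (funext fun t => ?_))).mpr this
    simp only [r, mul_sum]
    refine sum_congr rfl fun k _ => sum_congr rfl fun j _ => by ring
  rw [← hasSum_nat_add_iff' T] at hsum
  have hz : ∑ t ∈ range T, α^t / t.factorial * r t = 0 :=
    sum_eq_zero fun t ht => by
      simp only [r]; rw [h3 t (by simpa using ht), mul_zero]
  rw [hz, sub_zero] at hsum
  have hr : ∀ t, |r t| ≤ B * (2 * m)^t := by
    intro t
    refine le_trans ?_ (mul_le_mul_of_nonneg_right hB (by positivity))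
    simp only [r, sum_mul]
    refine (abs_sum_le_sum_abs _ _).trans (sum_le_sum fun k hk => ?_)
    refine (abs_sum_le_sum_abs _ _).trans (sum_le_sum fun j hj => ?_)
    rw [abs_mul]
    gcongr
    rw [abs_of_nonneg (by positivity), mul_pow]
    have hk' : (k:ℝ) ≤ m := by
      have : k ≤ m := by simp at hk; omega
      exact_mod_cast this
    have hm' : (1:ℝ) ≤ m := by exact_mod_cast hm
    gcongr
    · exact_mod_cast Nat.choose_le_two_pow t j
    · calc (k:ℝ)^(t-j) ≤ (m:ℝ)^(t-j) := by gcongr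
        _ ≤ (m:ℝ)^t := pow_le_pow_right₀ hm' (by omega)
  set y := 2 * m * |α| with hy
  have hy0 : 0 ≤ y := by positivity
  have hdom : HasSum (fun t : ℕ => B * (y^T / T.factorial) * (y^t / t.factorial))
      (B * (y^T / T.factorial) * Real.exp y) := by
    have h := (NormedSpace.expSeries_div_hasSum_exp y).mul_left (B * (y^T / T.factorial))
    rwa [← Real.exp_eq_exp_ℝ] at h
  have hbound := hsum.norm_le_of_bounded hdom (by
    intro t
    rw [Real.norm_eq_abs, abs_mul, abs_div, abs_pow, Nat.abs_cast]
    have hf : ((T.factorial * t.factorial : ℕ):ℝ) ≤ ((t+T).factorial : ℕ) := by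
      rw [mul_comm]
      exact_mod_cast Nat.le_of_dvd (Nat.factorial_pos _) (Nat.factorial_mul_factorial_dvd_factorial_add t T)
    push_cast at hf
    calc |α|^(t+T) / (t+T).factorial * |r (t+T)|
        ≤ |α|^(t+T) / (T.factorial * t.factorial) * (B * (2*m)^(t+T)) := by
          gcongr
          exact hr _
      _ = _ := by rw [hy]; simp only [mul_pow, pow_add]; field_simp)
  rw [Real.norm_eq_abs] at hbound
  refine hbound.trans ?_
  rw [mul_assoc]
  refine mul_le_mul_of_nonneg_left ?_ hB0
  rw [mul_comm]
  have hey : Real.exp y = Real.exp (2 * |α|) ^ m := by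
    rw [← Real.exp_nat_mul]; congr 1; rw [hy]; ring
  rw [hey]
  gcongr
  have hn' : (1:ℝ) ≤ n := by exact_mod_cast hn
  have hT0 : 0 < T := by positivity
  have hT0' : (0:ℝ) < T := by exact_mod_cast hT0
  have hTf : (T:ℝ)^T ≤ 3^T * T.factorial := by
    have h := Real.pow_div_factorial_le_exp (T:ℝ) (by positivity) T
    rw [div_le_iff₀ (by positivity)] at h
    refine h.trans ?_
    gcongr
    have : Real.exp T = Real.exp 1 ^ T := by rw [← Real.exp_nat_mul, mul_one]
    rw [this]
    gcongr
    linarith [Real.exp_one_lt_d9]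
  calc y^T / T.factorial ≤ y^T * (3^T / (T:ℝ)^T) := by
        rw [div_eq_mul_inv]
        gcongr
        rw [le_div_iff₀ (by positivity), inv_mul_le_iff₀ (by positivity)]
        linarith
    _ = (y * 3 / T)^T := by rw [div_pow, mul_pow y, mul_div_assoc]
    _ ≤ _ := by
        refine pow_le_pow_left₀ (by positivity) ?_ T
        rw [div_le_div_iff₀ hT0' (by positivity), hy, hT]
        push_cast
        nlinarith [abs_nonneg α, mul_nonneg (abs_nonneg α) (by positivity : (0:ℝ) ≤ n)]

open IntermediateField

lemma liouv_ineq (γ : ℝ) (hγ : IsAlgebraic ℚ γ) : ∃ (C : ℝ) (d : ℕ), 1 ≤ C ∧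
    ∀ (m : ℕ) (b : ℕ → ℤ) (H : ℝ), 1 ≤ H → ∑ k ∈ range (m+1), |(b k : ℝ)| ≤ H →
      ∑ k ∈ range (m+1), (b k : ℝ) * γ^k ≠ 0 →
      1 ≤ |∑ k ∈ range (m+1), (b k : ℝ) * γ^k| * (C^m * H)^d := by
  classical
  have hint : IsIntegral ℚ γ := hγ.isIntegral
  let K := ℚ⟮γ⟯
  have : FiniteDimensional ℚ K := adjoin.finiteDimensional hint
  let g : K := AdjoinSimple.gen ℚ γ
  have hg : algebraMap K ℝ g = γ := AdjoinSimple.algebraMap_gen ℚ γ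
  have hgalg : IsAlgebraic ℤ g := (IsFractionRing.isAlgebraic_iff ℤ ℚ K).2 (IsAlgebraic.of_finite ℚ g)
  obtain ⟨D, hD0, hD⟩ := hgalg.exists_integral_multiple
  have hD1 : (1:ℝ) ≤ |(D:ℝ)| := by exact_mod_cast Int.one_le_abs hD0
  let C0 : ℝ := 1 + ∑ σ : K →ₐ[ℚ] ℂ, ‖σ g‖
  have hC0 : 1 ≤ C0 := by
    have : 0 ≤ ∑ σ : K →ₐ[ℚ] ℂ, ‖σ g‖ := sum_nonneg fun _ _ => norm_nonneg _
    simp only [C0]; linarith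
  have hσ : ∀ σ : K →ₐ[ℚ] ℂ, ‖σ g‖ ≤ C0 := by
    intro σ
    have := single_le_sum (f := fun σ : K →ₐ[ℚ] ℂ => ‖σ g‖) (fun _ _ => norm_nonneg _)
      (mem_univ σ)
    simp only [C0]; linarith
  refine ⟨|(D:ℝ)| * C0, Fintype.card (K →ₐ[ℚ] ℂ), by nlinarith, ?_⟩
  intro m b H hH hb hne
  let z : K := ∑ k ∈ range (m+1), (b k : K) * g^k
  let x : K := (D:K)^m * z
  have hz : algebraMap K ℝ z = ∑ k ∈ range (m+1), (b k : ℝ) * γ^k := by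
    simp only [z, map_sum, map_mul, map_pow, hg, map_intCast]
  have hx0 : x ≠ 0 := by
    refine mul_ne_zero (pow_ne_zero _ (by exact_mod_cast hD0)) ?_
    intro h0
    rw [h0, map_zero] at hz
    exact hne hz.symm
  have hxint : IsIntegral ℤ x := by
    have : x = ∑ k ∈ range (m+1), ((b k * D^(m-k) : ℤ) : K) * (D • g)^k := by
      simp only [x, z, mul_sum]
      refine sum_congr rfl fun k hk => ?_
      have hk' : m = (m - k) + k := by simp at hk; omega
      rw [zsmul_eq_mul, mul_pow]
      push_cast
      have : (D:K)^m = (D:K)^(m-k) * (D:K)^k := by rw [← pow_add, ← hk']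
      rw [this]; ring
    rw [this]
    refine IsIntegral.sum _ fun k _ => IsIntegral.mul ?_ (hD.pow k)
    exact isIntegral_algebraMap (R := ℤ) (A := K) (x := b k * D^(m-k))
  have hnint : IsIntegral ℤ (Algebra.norm ℚ x) := Algebra.isIntegral_norm ℚ hxint
  obtain ⟨N, hN⟩ := IsIntegrallyClosed.isIntegral_iff.1 hnint
  have hN0 : N ≠ 0 := by
    rintro rfl
    rw [map_zero] at hN
    exact hx0 (Algebra.norm_eq_zero_iff.1 hN.symm)
  have hprod := Algebra.norm_eq_prod_embeddings ℚ ℂ x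
  have h1 : 1 ≤ ∏ σ : K →ₐ[ℚ] ℂ, ‖σ x‖ := by
    rw [← norm_prod, ← hprod, ← hN]
    simp only [eq_intCast, map_intCast, Complex.norm_intCast]
    exact_mod_cast Int.one_le_abs hN0
  let σ0 : K →ₐ[ℚ] ℂ := (IsScalarTower.toAlgHom ℚ ℝ ℂ).comp (IsScalarTower.toAlgHom ℚ K ℝ)
  have hσ0 : ‖σ0 x‖ = |(D:ℝ)|^m * |∑ k ∈ range (m+1), (b k : ℝ) * γ^k| := by
    have : σ0 x = ((algebraMap K ℝ x : ℝ) : ℂ) := rfl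
    rw [this, Complex.norm_real, ← hz]
    simp only [x, map_mul, map_pow, map_intCast, norm_mul, norm_pow, Real.norm_eq_abs]
  have hbd : ∀ σ : K →ₐ[ℚ] ℂ, ‖σ x‖ ≤ (|(D:ℝ)| * C0)^m * H := by
    intro σ
    simp only [x, z, map_mul, map_pow, map_intCast, map_sum, norm_mul, norm_pow,
      Complex.norm_intCast]
    rw [mul_pow, mul_assoc]
    gcongr
    calc ‖∑ k ∈ range (m+1), (b k : ℂ) * σ g ^ k‖ ≤ ∑ k ∈ range (m+1), |(b k:ℝ)| * C0^m := by
          refine norm_sum_le_of_le _ fun k hk => ?_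
          rw [norm_mul, norm_pow, Complex.norm_intCast]
          gcongr
          calc ‖σ g‖^k ≤ C0^k := by gcongr; exact hσ σ
            _ ≤ C0^m := pow_le_pow_right₀ hC0 (by simp at hk; omega)
      _ = C0^m * ∑ k ∈ range (m+1), |(b k:ℝ)| := by rw [← sum_mul, mul_comm]
      _ ≤ C0^m * H := by gcongr
  have hC1 : 1 ≤ C0^m := one_le_pow₀ hC0
  rw [← mul_prod_erase univ _ (mem_univ σ0), hσ0] at h1
  refine h1.trans ?_
  have hcard : Fintype.card (K →ₐ[ℚ] ℂ) = (univ.erase σ0).card + 1 := by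
    rw [card_erase_add_one (mem_univ _)]; rfl
  rw [hcard, pow_succ]
  have h2 : ∏ σ ∈ univ.erase σ0, ‖σ x‖ ≤ ((|(D:ℝ)| * C0)^m * H)^(univ.erase σ0).card := by
    refine (prod_le_prod (fun _ _ => norm_nonneg _) fun σ _ => hbd σ).trans ?_
    rw [prod_const]
  have h3 : |(D:ℝ)|^m ≤ (|(D:ℝ)| * C0)^m * H := by
    rw [mul_pow, mul_assoc]
    exact le_mul_of_one_le_right (by positivity) (one_le_mul_of_one_le_of_one_le hC1 hH)
  set S := |∑ k ∈ range (m+1), (b k : ℝ) * γ^k|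
  have hS : 0 ≤ S := abs_nonneg _
  calc |(D:ℝ)|^m * S * ∏ σ ∈ univ.erase σ0, ‖σ x‖
      ≤ ((|(D:ℝ)| * C0)^m * H) * S * ((|(D:ℝ)| * C0)^m * H)^(univ.erase σ0).card := by
        gcongr
    _ = _ := by ring

lemma lcm_bound : ∃ c : ℝ, 1 ≤ c ∧ ∀ m : ℕ, (Nat.lcmUpto m : ℝ) ≤ c^m := by
  refine ⟨Real.exp (Real.log 4 + 4), Real.one_le_exp (by positivity), fun m => ?_⟩
  have h := Chebyshev.psi_le_const_mul_self (x := (m:ℝ)) (by positivity)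
  rw [Chebyshev.psi_eq_log_lcmUpto, Real.log_le_iff_le_exp
    (by exact_mod_cast Nat.lcmUpto_pos m)] at h
  rw [← Real.exp_nat_mul, mul_comm (m:ℝ)]
  exact h

lemma dvd_lcmUpto {m a : ℕ} (h0 : a ≠ 0) (h : a ≤ m) : a ∣ Nat.lcmUpto m :=
  Finset.dvd_lcm (f := id) (by simp; omega)


lemma main_ineq (α : ℝ) (C : ℝ) (d : ℕ) (hC : 1 ≤ C)
    (hd : ∀ (m : ℕ) (b : ℕ → ℤ) (H : ℝ), 1 ≤ H → ∑ k ∈ range (m+1), |(b k : ℝ)| ≤ H →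
      ∑ k ∈ range (m+1), (b k : ℝ) * (Real.exp α)^k ≠ 0 →
      1 ≤ |∑ k ∈ range (m+1), (b k : ℝ) * (Real.exp α)^k| * (C^m * H)^d)
    {m n : ℕ} (hm : 1 ≤ m) (hn : 1 ≤ n) (p q : ℤ) (hq : 1 ≤ q) (hβ : (p:ℝ)/q ≠ 0)
    (b : ℝ) (hb1 : 1 ≤ b) (hb : |(p:ℝ)/q| ≤ b) (hbα : |α| ≤ b) :
    1 ≤ (C^m * (n.factorial * (Nat.lcmUpto m : ℝ)^n * (q:ℝ)^n * (2^m * (n+1))^n * b^n))^(d+1) *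
      (Real.exp (2 * |α|) ^ m * (6 * |α| / n)^(n*(m+1)) +
        n * b^n * |α - p/q| * Real.exp |α| ^ m) := by
  set L := Nat.lcmUpto m with hLdef
  have hL1 : (1:ℝ) ≤ L := by exact_mod_cast Nat.lcmUpto_pos m
  have hq1 : (1:ℝ) ≤ q := by exact_mod_cast hq
  have hq0 : (q:ℝ) ≠ 0 := by positivity
  have hf1 : (1:ℝ) ≤ n.factorial := by exact_mod_cast Nat.factorial_pos n
  set B : ℝ := (2^m * (n+1))^n with hB
  have hB1 : 1 ≤ B := by
    refine one_le_pow₀ ?_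
    have h1 : (1:ℝ) ≤ 2^m := one_le_pow₀ (by norm_num)
    have h2 : (1:ℝ) ≤ n + 1 := by linarith [(Nat.cast_nonneg n : (0:ℝ) ≤ n)]
    exact one_le_mul_of_one_le_of_one_le h1 h2
  set β : ℝ := (p:ℝ)/q with hβdef
  set F : ℝ := n.factorial * (L:ℝ)^n * (q:ℝ)^n with hF
  have hF1 : 1 ≤ F := one_le_mul_of_one_le_of_one_le
    (one_le_mul_of_one_le_of_one_le hf1 (one_le_pow₀ hL1)) (one_le_pow₀ hq1)
  have hbn : 1 ≤ b^n := one_le_pow₀ hb1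
  have hkey : ∀ i, ∃ c : ℕ → ℕ → ℝ, i ≤ m → ((∀ k j, IsZ ((L:ℝ)^n * c k j)) ∧
      ∑ k ∈ range (m+1), ∑ j ∈ range (n+1), |c k j| ≤ (2^m * (n+1))^n ∧
      (∀ k, k ≠ i → c k n = 0) ∧ c i n ≠ 0 ∧
      ∀ t < n * (m+1), ∑ k ∈ range (m+1), ∑ j ∈ range (n+1),
        c k j * ((t.choose j : ℝ) * (k:ℝ)^(t-j)) = 0) := by
    intro i
    by_cases hi : i ≤ m
    · obtain ⟨c, hc⟩ := key (m := m) (L := L) (fun a h0 h => dvd_lcmUpto h0 h) hi n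
      exact ⟨c, fun _ => hc⟩
    · exact ⟨fun _ _ => 0, fun h => absurd h hi⟩
  choose c hc using hkey
  obtain ⟨i, hi, hne⟩ := nonvanish c (fun i hi => (hc i hi).2.2.1) (fun i hi => (hc i hi).2.2.2.1)
    (fun i hi => (hc i hi).2.2.2.2) β hβ (fun k => Real.exp α ^ k) (by simp)
  obtain ⟨c1, c2, -, -, c5⟩ := hc i hi
  set x := c i with hx
  have hsmall := small hn hm x B α c2 c5
  set Θ := ∑ k ∈ range (m+1), (∑ j ∈ range (n+1), x k j / j.factorial * β^j) * Real.exp α ^ k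
  set R := ∑ k ∈ range (m+1), (∑ j ∈ range (n+1), x k j / j.factorial * α^j) * Real.exp α ^ k
  have hfac : ∀ (k j : ℕ), |x k j / j.factorial| ≤ |x k j| := by
    intro k j
    rw [abs_div, Nat.abs_cast]
    exact div_le_self (abs_nonneg _) (by exact_mod_cast Nat.factorial_pos j)
  -- difference
  have hdiff : |Θ - R| ≤ B * (n * b^n * |α - β| * Real.exp |α| ^ m) := by
    refine le_trans ?_ (mul_le_mul_of_nonneg_right c2 (by positivity))
    simp only [Θ, R]
    rw [← sum_sub_distrib, sum_mul]
    refine (abs_sum_le_sum_abs _ _).trans (sum_le_sum fun k hk => ?_)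
    rw [← sub_mul, ← sum_sub_distrib, abs_mul, abs_pow, abs_of_pos (Real.exp_pos α), ← mul_assoc]
    have hg : Real.exp α ^ k ≤ Real.exp |α| ^ m := by
      calc Real.exp α ^ k ≤ Real.exp |α| ^ k := by gcongr; exact le_abs_self _
        _ ≤ _ := pow_le_pow_right₀ (Real.one_le_exp (abs_nonneg _)) (by simp at hk; omega)
    refine mul_le_mul ?_ hg (by positivity) (by positivity)
    rw [sum_mul]
    refine (abs_sum_le_sum_abs _ _).trans (sum_le_sum fun j hj => ?_)
    rw [← mul_sub, abs_mul]
    refine mul_le_mul (hfac k j) ?_ (abs_nonneg _) (abs_nonneg _)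
    refine (abs_pow_sub_pow_le β α j).trans ?_
    have hj' : j ≤ n := by simp at hj; omega
    rw [abs_sub_comm β α]
    have hmax : max |β| |α| ^ (j-1) ≤ b^n := by
      calc max |β| |α| ^ (j-1) ≤ b^(j-1) :=
            pow_le_pow_left₀ (le_max_of_le_left (abs_nonneg _)) (max_le hb hbα) _
        _ ≤ b^n := pow_le_pow_right₀ hb1 (by omega)
    calc |α - β| * j * max |β| |α| ^ (j-1) ≤ |α - β| * n * b^n := by gcongr
      _ = _ := by ring
  have hΘ : |Θ| ≤ B * (Real.exp (2 * |α|) ^ m * (6 * |α| / n)^(n*(m+1)) +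
        n * b^n * |α - β| * Real.exp |α| ^ m) := by
    have : Θ = R + (Θ - R) := by ring
    rw [this, mul_add]
    exact (abs_add_le _ _).trans (add_le_add hsmall hdiff)
  -- integrality
  have hint : ∀ k, ∃ z : ℤ, F * (∑ j ∈ range (n+1), x k j / j.factorial * β^j) = z := by
    intro k
    change IsZ _
    rw [mul_sum]
    refine IsZ.sum _ _ fun j hj => ?_
    have hj' : j ≤ n := by simp at hj; omega
    obtain ⟨w, hw⟩ := Nat.factorial_dvd_factorial hj'
    have e1 : F * (x k j / j.factorial * β^j) = w * ((L:ℝ)^n * x k j) * ((p:ℝ)^j * (q:ℝ)^(n-j)) := by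
      have e2 : (q:ℝ)^n = (q:ℝ)^(n-j) * (q:ℝ)^j := by rw [← pow_add]; congr 1; omega
      have e3 : (n.factorial : ℝ) = j.factorial * w := by exact_mod_cast hw
      rw [hF, e2, e3, hβdef, div_pow]
      have : (j.factorial : ℝ) ≠ 0 := by positivity
      field_simp
    rw [e1]
    exact ((IsZ.nat w).mul (c1 k j)).mul (IsZ.mul (IsZ.pow ⟨p, rfl⟩ _) (IsZ.pow ⟨q, rfl⟩ _))
  choose z hz using hint
  have hFΘ : ∑ k ∈ range (m+1), (z k : ℝ) * Real.exp α ^ k = F * Θ := by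
    simp only [Θ, mul_sum (range (m+1)), ← hz, mul_assoc]
  have hsumz : ∑ k ∈ range (m+1), |(z k : ℝ)| ≤ F * B * b^n := by
    have : F * (∑ k ∈ range (m+1), ∑ j ∈ range (n+1), |x k j|) * b^n ≤ F * B * b^n := by
      gcongr
    refine le_trans ?_ this
    rw [mul_sum, sum_mul]
    refine sum_le_sum fun k _ => ?_
    rw [← hz, abs_mul, abs_of_pos (by positivity : 0 < F), mul_assoc F _ (b^n)]
    refine mul_le_mul_of_nonneg_left ?_ (by positivity)
    rw [sum_mul]
    refine (abs_sum_le_sum_abs _ _).trans (sum_le_sum fun j hj => ?_)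
    rw [abs_mul, abs_pow]
    refine mul_le_mul (hfac k j) ?_ (by positivity) (abs_nonneg _)
    calc |β|^j ≤ b^j := by gcongr
      _ ≤ b^n := pow_le_pow_right₀ hb1 (by simp at hj; omega)
  have hH1 : 1 ≤ F * B * b^n :=
    one_le_mul_of_one_le_of_one_le (one_le_mul_of_one_le_of_one_le hF1 hB1) hbn
  have hfin := hd m z (F * B * b^n) hH1 hsumz (by
    rw [hFΘ]; exact mul_ne_zero (by positivity) hne)
  rw [hFΘ, abs_mul, abs_of_pos (by positivity : 0 < F)] at hfin
  set S := Real.exp (2 * |α|) ^ m * (6 * |α| / n)^(n*(m+1)) +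
        n * b^n * |α - β| * Real.exp |α| ^ m with hS
  have hS0 : 0 ≤ S := by positivity
  have hCm : 1 ≤ C^m := one_le_pow₀ hC
  refine hfin.trans ?_
  calc F * |Θ| * (C^m * (F * B * b^n))^d ≤ F * (B * S) * (C^m * (F * B * b^n))^d := by gcongr
    _ = (F * B) * (C^m * (F * B * b^n))^d * S := by ring
    _ ≤ (C^m * (F * B * b^n)) * (C^m * (F * B * b^n))^d * S := by
        refine mul_le_mul_of_nonneg_right (mul_le_mul_of_nonneg_right ?_ (by positivity)) hS0
        have h0 : 0 ≤ F * B := by positivity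
        calc F * B ≤ F * B * b^n := le_mul_of_one_le_right h0 hbn
          _ ≤ _ := le_mul_of_one_le_left (by positivity) hCm
    _ = _ := by rw [pow_succ' _ d]

lemma exists_two_pow (x : ℝ) : ∃ k : ℕ, x ≤ 2^k := by
  obtain ⟨k, hk⟩ := pow_unbounded_of_one_lt x (by norm_num : (1:ℝ) < 2)
  exact ⟨k, hk.le⟩

lemma exp_not_algebraic (α : ℝ) (hα : Liouville α) : ¬ IsAlgebraic ℚ (Real.exp α) := by
  intro halg
  obtain ⟨C, d, hC, hd⟩ := liouv_ineq _ halg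
  obtain ⟨c, hc1, hc⟩ := lcm_bound
  have hα0 : α ≠ 0 := by
    rintro rfl
    exact hα.irrational ⟨0, by simp⟩
  set δ := d + 1 with hδ
  set a : ℝ := (2*c)^δ * (6 * |α|) with ha
  set y : ℝ := C^δ * Real.exp (2 * |α|) with hy
  have hy1 : 1 ≤ y := one_le_mul_of_one_le_of_one_le (one_le_pow₀ hC)
    (Real.one_le_exp (by positivity))
  have ha0 : 0 ≤ a := by positivity
  obtain ⟨n0, hn0⟩ := exists_nat_ge (2 * a * y)
  obtain ⟨n, hn, hn2⟩ : ∃ n : ℕ, 1 ≤ n ∧ 2 * a * y ≤ n :=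
    ⟨n0 + 1, by omega, hn0.trans (by push_cast; linarith)⟩
  have hn1 : (1:ℝ) ≤ n := by exact_mod_cast hn
  have hnpos : (0:ℝ) < n := by linarith
  have han : a / n ≤ 1 / (2 * y) := by
    rw [div_le_div_iff₀ hnpos (by positivity)]; linarith
  have h2y : 1 / (2*y) ≤ 1 := by rw [div_le_one (by positivity)]; linarith
  have han1 : a / n ≤ 1 := han.trans h2y
  set u : ℝ := (6 * |α| / n)^n with hu
  have hu0 : 0 ≤ u := by positivity
  have hu1 : u ≤ 1 := by
    refine pow_le_one₀ (by positivity) (le_trans ?_ han1)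
    refine div_le_div_of_nonneg_right ?_ hnpos.le
    rw [ha]
    exact le_mul_of_one_le_left (by positivity) (one_le_pow₀ (by linarith))
  have hU : C^δ * ((2*c)^n)^δ * Real.exp (2*|α|) * u ≤ 1/2 := by
    have e1 : C^δ * ((2*c)^n)^δ * Real.exp (2*|α|) * u = y * (a/n)^n := by
      rw [hy, ha, hu, mul_div_assoc ((2*c)^δ), mul_pow ((2*c)^δ), ← pow_mul, ← pow_mul, mul_comm n δ]
      ring
    rw [e1]
    calc y * (a/n)^n ≤ y * (a/n)^1 := by
          gcongr ?_ * ?_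
          exact pow_le_pow_of_le_one (by positivity) han1 hn
      _ ≤ y * (1/(2*y)) := by rw [pow_one]; gcongr
      _ = 1/2 := by field_simp
  set b : ℝ := |α| + 1 with hb
  have hb1 : 1 ≤ b := by rw [hb]; linarith [abs_nonneg α]
  set K : ℝ := n.factorial * (n+1)^n * b^n with hK
  have hK0 : 0 < K := by positivity
  set V : ℝ := C^δ * ((2*c)^n)^δ * Real.exp |α| with hV
  have hV0 : 0 ≤ V := by positivity
  obtain ⟨w, hw⟩ := exists_two_pow V
  obtain ⟨m0', hm0'⟩ := exists_two_pow (2 * K^δ + 1)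
  obtain ⟨m0, hm0p, hm0⟩ : ∃ m0 : ℕ, 1 ≤ m0 ∧ 2 * K^δ + 1 ≤ 2^m0 :=
    ⟨m0' + 1, by omega, hm0'.trans (pow_le_pow_right₀ (by norm_num) (by omega))⟩
  obtain ⟨e1, he1⟩ := exists_two_pow (K^δ * (2^m0)^w * (n * b^n))
  obtain ⟨f, hf⟩ := exists_two_pow (1 / |α|)
  set EE := n * δ + 2 * (n * δ) * w with hEE
  obtain ⟨p, q, hq, hpne, hpq⟩ := hα (e1 + EE + 1 + f)
  have hq2 : (2:ℝ) ≤ q := by exact_mod_cast hq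
  have hq0 : (0:ℝ) < q := by linarith
  have hq1 : (1:ℝ) ≤ q := by linarith
  have hβ : (p:ℝ)/q ≠ 0 := by
    intro h0
    rw [h0, sub_zero] at hpq
    have h3 : 1 / (q:ℝ)^(e1 + EE + 1 + f) ≤ 1 / 2^f := by
      gcongr
      calc (2:ℝ)^f ≤ (q:ℝ)^f := by gcongr
        _ ≤ _ := pow_le_pow_right₀ hq1 (by omega)
    have h4 : 1 / 2^f ≤ |α| := by
      have : 0 < |α| := abs_pos.2 hα0
      rw [div_le_iff₀ (by positivity)] at hf ⊢
      linarith
    linarith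
  have hlt1 : |α - p/q| ≤ 1 := by
    refine hpq.le.trans ?_
    rw [div_le_one (by positivity)]
    exact one_le_pow₀ hq1
  have hbβ : |(p:ℝ)/q| ≤ b := by
    have : (p:ℝ)/q = α - (α - p/q) := by ring
    rw [this, hb]
    exact (abs_sub _ _).trans (by linarith)
  -- choose s
  obtain ⟨s, hs1, hs2⟩ : ∃ s : ℕ, (q:ℝ) ≤ 2^s ∧ (2:ℝ)^s ≤ (q:ℝ)^2 := by
    obtain ⟨s, h1, h2⟩ := exists_nat_pow_near (x := (q:ℝ)) hq1 (by norm_num : (1:ℝ) < 2)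
    refine ⟨s+1, h2.le, ?_⟩
    rw [pow_succ, pow_two]
    gcongr
  set m := n * δ * s + m0 with hm
  have hineq := main_ineq α C d hC hd (m := m) (n := n) (by omega) hn p q (by omega) hβ b hb1 hbβ
    (by rw [hb]; linarith)
  rw [← hδ] at hineq
  have h2m : (2:ℝ)^m = (2^s)^(n*δ) * 2^m0 := by
    rw [hm, pow_add, ← pow_mul, mul_comm s]
  set W := C^δ * ((2*c)^n)^δ with hW
  have hH : (C^m * (n.factorial * (Nat.lcmUpto m : ℝ)^n * (q:ℝ)^n * (2^m * (n+1))^n * b^n))^δ ≤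
      K^δ * (q:ℝ)^(n*δ) * W^m := by
    calc _ ≤ (C^m * (n.factorial * (c^m)^n * (q:ℝ)^n * (2^m * (n+1))^n * b^n))^δ := by
          gcongr
          exact hc m
      _ = _ := by
          rw [hK, hW]
          simp only [mul_pow, ← pow_mul]
          ring_nf
  have hS0 : (0:ℝ) ≤ Real.exp (2 * |α|) ^ m * (6 * |α| / n)^(n*(m+1)) +
        n * b^n * |α - p/q| * Real.exp |α| ^ m := by positivity
  have h5 := hineq.trans (mul_le_mul_of_nonneg_right hH hS0)
  rw [mul_add] at h5
  have hfirst : K^δ * (q:ℝ)^(n*δ) * W^m * (Real.exp (2 * |α|) ^ m * (6 * |α| / n)^(n*(m+1))) < 1/2 := by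
    have e2 : (6 * |α| / n)^(n*(m+1)) = u^m * u := by rw [pow_mul, ← hu, pow_succ]
    rw [e2]
    calc K^δ * (q:ℝ)^(n*δ) * W^m * (Real.exp (2 * |α|) ^ m * (u^m * u))
        = K^δ * (q:ℝ)^(n*δ) * (W * Real.exp (2 * |α|) * u)^m * u := by
          simp only [mul_pow]; ring
      _ ≤ K^δ * (2^s)^(n*δ) * (1/2)^m * 1 := by gcongr
      _ = K^δ / 2^m0 := by
          rw [div_pow, one_pow, h2m]; field_simp
      _ < 1/2 := by
          rw [div_lt_div_iff₀ (by positivity) (by norm_num)]; linarith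
  have hsecond : K^δ * (q:ℝ)^(n*δ) * W^m * (n * b^n * |α - p/q| * Real.exp |α| ^ m) ≤ 1/2 := by
    calc K^δ * (q:ℝ)^(n*δ) * W^m * (n * b^n * |α - p/q| * Real.exp |α| ^ m)
        = K^δ * (q:ℝ)^(n*δ) * V^m * (n * b^n) * |α - p/q| := by
          rw [hV]; simp only [mul_pow]; ring
      _ ≤ K^δ * (q:ℝ)^(n*δ) * (2^w)^m * (n * b^n) * |α - p/q| := by gcongr
      _ = K^δ * (q:ℝ)^(n*δ) * ((2^s)^(n*δ) * 2^m0)^w * (n * b^n) * |α - p/q| := by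
          rw [← h2m, ← pow_mul, ← pow_mul, mul_comm w]
      _ ≤ K^δ * (q:ℝ)^(n*δ) * (((q:ℝ)^2)^(n*δ) * 2^m0)^w * (n * b^n) * |α - p/q| := by gcongr
      _ = (K^δ * (2^m0)^w * (n * b^n)) * (q:ℝ)^EE * |α - p/q| := by
          rw [hEE, pow_add, mul_pow, ← pow_mul, ← pow_mul]; ring
      _ ≤ (q:ℝ)^e1 * (q:ℝ)^EE * (1 / (q:ℝ)^(e1 + EE + 1)) := by
          gcongr
          · exact he1.trans (by gcongr)
          · refine hpq.le.trans ?_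
            exact one_div_le_one_div_of_le (by positivity) (pow_le_pow_right₀ hq1 (by omega))
      _ = 1 / q := by
          clear_value EE
          rw [pow_succ (q:ℝ) (e1 + EE), pow_add (q:ℝ) e1 EE]; field_simp
      _ ≤ 1/2 := by gcongr
  linarith

end LS

theorem liouville_sinh_transcendental (α : ℝ) (h : Liouville α) :
    Transcendental ℚ (Real.sinh α) := by
  intro hs
  apply LS.exp_not_algebraic α h
  -- `exp α = sinh α + cosh α`, `cosh² = 1 + sinh²`
  have hcosh : IsAlgebraic ℚ (Real.cosh α) := by
    refine IsAlgebraic.of_pow (n := 2) (by norm_num) ?_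
    rw [Real.cosh_sq]
    exact (hs.pow 2).add isAlgebraic_one
  rw [← Real.cosh_add_sinh]
  exact hcosh.add hs
end

section
/- If α is a Liouville number, then cosh α is transcendental. -/
open PowerSeries Finset

/-- the local factor at the node `k` -/
noncomputable def locG (S : Finset ℕ) (μ : ℕ → ℕ) (k : ℕ) : PowerSeries ℝ :=
  ∏ j ∈ S.erase k, ((C ((k : ℝ) - j) + X)⁻¹) ^ μ j

noncomputable def lam (S : Finset ℕ) (μ : ℕ → ℕ) (t : ℕ) : ℝ :=
  ∑ k ∈ S, coeff (μ k) (X * ((C (k : ℝ) + X) ^ t * locG S μ k))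

lemma lin_mul_inv (b : ℝ) (hb : b ≠ 0) : (C b + X : PowerSeries ℝ) * (C b + X)⁻¹ = 1 := by
  apply PowerSeries.mul_inv_cancel
  simpa using hb

lemma lam_rec (S : Finset ℕ) (μ : ℕ → ℕ) (a : ℕ) (haS : a ∈ S) (t : ℕ) :
    lam S (μ + Pi.single a 1) (t + 1) = a * lam S (μ + Pi.single a 1) t + lam S μ t := by
  unfold lam
  rw [Finset.mul_sum, ← Finset.sum_add_distrib]
  refine Finset.sum_congr rfl fun k hk => ?_
  rw [← PowerSeries.coeff_C_mul, ← sub_eq_iff_eq_add', ← map_sub]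
  have e : X * ((C (k : ℝ) + X) ^ (t+1) * locG S (μ + Pi.single a 1) k) -
      C (a : ℝ) * (X * ((C (k : ℝ) + X) ^ t * locG S (μ + Pi.single a 1) k)) =
      X * ((C (k : ℝ) + X) ^ t * ((C ((k : ℝ) - a) + X) * locG S (μ + Pi.single a 1) k)) := by
    rw [map_sub]; ring
  rw [e]
  by_cases hka : k = a
  · subst hka
    have : locG S (μ + Pi.single k 1) k = locG S μ k := by
      unfold locG
      refine Finset.prod_congr rfl fun j hj => ?_
      have : j ≠ k := (Finset.mem_erase.1 hj).1
      simp [this]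
    rw [this]
    simp only [sub_self, map_zero, zero_add, Pi.add_apply, Pi.single_eq_same]
    rw [PowerSeries.coeff_succ_X_mul]
    congr 1
    ring
  · have h1 : (μ + Pi.single a 1 : ℕ → ℕ) k = μ k := by simp [hka]
    rw [h1]
    congr 3
    unfold locG
    have haS' : a ∈ S.erase k := Finset.mem_erase.2 ⟨fun h => hka h.symm, haS⟩
    rw [← Finset.mul_prod_erase _ _ haS', ← Finset.mul_prod_erase _ _ haS', ← mul_assoc]
    congr 1
    · simp only [Pi.add_apply, Pi.single_eq_same]
      rw [pow_succ', ← mul_assoc, lin_mul_inv, one_mul]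
      exact sub_ne_zero.2 (by exact_mod_cast hka)
    · refine Finset.prod_congr rfl fun j hj => ?_
      have : j ≠ a := (Finset.mem_erase.1 hj).1
      simp [this]


lemma exists_split (S : Finset ℕ) (μ : ℕ → ℕ) (a : ℕ) (haS : a ∈ S) (ha : μ a ≠ 0) :
    ∃ ν : ℕ → ℕ, μ = ν + Pi.single a 1 ∧ ∑ k ∈ S, μ k = ∑ k ∈ S, ν k + 1 := by
  have h1 : μ = (μ - Pi.single a 1) + Pi.single a 1 := by
    funext j
    by_cases hj : j = a
    · subst hj; simp; omega
    · simp [hj]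
  refine ⟨μ - Pi.single a 1, h1, ?_⟩
  conv_lhs => rw [h1]
  simp only [Pi.add_apply, Finset.sum_add_distrib]
  congr 1
  rw [Finset.sum_eq_single_of_mem a haS]
  · simp
  · intro b _ hb; simp [hb]

lemma lam_of_sum_zero (S : Finset ℕ) (μ : ℕ → ℕ) (h : ∑ k ∈ S, μ k = 0) (t : ℕ) :
    lam S μ t = 0 := by
  rw [Finset.sum_eq_zero_iff] at h
  refine Finset.sum_eq_zero fun k hk => ?_
  rw [h k hk]
  simp

lemma lam_zero (S : Finset ℕ) (N : ℕ) : ∀ (μ : ℕ → ℕ), ∑ k ∈ S, μ k = N →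
    lam S μ 0 = if N = 1 then 1 else 0 := by
  induction N with
  | zero => intro μ h; rw [lam_of_sum_zero S μ h]; simp
  | succ N ih =>
    intro μ h
    have : ∃ a ∈ S, μ a ≠ 0 := by
      by_contra! hc
      rw [Finset.sum_eq_zero hc] at h
      omega
    obtain ⟨a, haS, ha⟩ := this
    by_cases hb : ∃ b ∈ S, b ≠ a ∧ μ b ≠ 0
    · obtain ⟨b, hbS, hba, hb⟩ := hb
      obtain ⟨ν, hν, hνs⟩ := exists_split S μ a haS ha
      obtain ⟨κ, hκ, hκs⟩ := exists_split S μ b hbS hb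
      have r1 := lam_rec S ν a haS 0
      have r2 := lam_rec S κ b hbS 0
      rw [← hν, ih ν (by omega)] at r1
      rw [← hκ, ih κ (by omega)] at r2
      have h2 : μ a + μ b ≤ N + 1 := by
        rw [← h, ← Finset.add_sum_erase _ _ haS]
        gcongr
        exact Finset.single_le_sum (f := μ) (fun _ _ => Nat.zero_le _)
          (Finset.mem_erase.2 ⟨hba, hbS⟩)
      rw [if_neg (by omega)]
      have h3 : ((b : ℝ) - a) * lam S μ 0 = 0 := by linarith
      rcases mul_eq_zero.1 h3 with h4 | h4
      · exact absurd (by exact_mod_cast sub_eq_zero.1 h4) hba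
      · exact h4
    · push Not at hb
      have hs : μ a = N + 1 := by
        rw [← h, Finset.sum_eq_single_of_mem a haS hb]
      unfold lam
      rw [Finset.sum_eq_single_of_mem a haS]
      · have : locG S μ a = 1 := by
          refine Finset.prod_eq_one fun j hj => ?_
          obtain ⟨h1, h2⟩ := Finset.mem_erase.1 hj
          rw [hb j h2 h1, pow_zero]
        rw [this, hs]
        simp [PowerSeries.coeff_X]
      · intro j hj hja
        rw [hb j hj hja]; simp

lemma lam_main (S : Finset ℕ) (M : ℕ) (hM : ∀ k ∈ S, k ≤ M) (t : ℕ) : ∀ (μ : ℕ → ℕ) (N : ℕ),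
    ∑ k ∈ S, μ k = N + 1 →
    0 ≤ lam S μ t ∧ lam S μ t ≤ (t.choose N : ℝ) * (M : ℝ) ^ (t - N) ∧ (t = N → lam S μ t = 1) := by
  induction t with
  | zero =>
    intro μ N h
    rw [lam_zero S _ μ h]
    rcases N with _ | N
    · simp
    · simp
  | succ t ih =>
    intro μ N h
    have : ∃ a ∈ S, μ a ≠ 0 := by
      by_contra! hc
      rw [Finset.sum_eq_zero hc] at h
      omega
    obtain ⟨a, haS, ha⟩ := this
    obtain ⟨ν, hν, hνs⟩ := exists_split S μ a haS ha
    have r1 := lam_rec S ν a haS t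
    rw [← hν] at r1
    obtain ⟨i1, i2, i3⟩ := ih μ N h
    have haM : (a : ℝ) ≤ M := by exact_mod_cast hM a haS
    rw [r1]
    rcases N with _ | N
    · rw [lam_of_sum_zero S ν (by omega)]
      refine ⟨by positivity, ?_, by omega⟩
      simp only [Nat.choose_zero_right, Nat.cast_one, one_mul, Nat.sub_zero, add_zero] at i2 ⊢
      rw [pow_succ']
      gcongr
    · obtain ⟨j1, j2, j3⟩ := ih ν N (by omega)
      refine ⟨by positivity, ?_, ?_⟩
      · rw [Nat.choose_succ_succ, Nat.cast_add, add_mul, add_comm]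
        rw [show t + 1 - (N + 1) = t - N by omega]
        refine add_le_add j2 ?_
        by_cases htN : N + 1 ≤ t
        · rw [show t - N = (t - (N+1)) + 1 by omega, pow_succ']
          calc (a : ℝ) * lam S μ t ≤ M * ((t.choose (N+1) : ℝ) * (M : ℝ) ^ (t - (N+1))) := by
                gcongr
            _ = _ := by ring
        · rw [Nat.choose_eq_zero_of_lt (by omega)] at i2 ⊢
          have : lam S μ t = 0 := le_antisymm (by simpa using i2) i1
          simp [this]
      · intro e
        rw [Nat.choose_eq_zero_of_lt (by omega)] at i2
        have : lam S μ t = 0 := le_antisymm (by simpa using i2) i1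
        rw [this, j3 (by omega)]; simp

noncomputable def serU (b : ℝ) : PowerSeries ℝ := PowerSeries.mk fun r => (-b⁻¹) ^ r

lemma lin_inv_eq (b : ℝ) (hb : b ≠ 0) : (C b + X : PowerSeries ℝ)⁻¹ = C b⁻¹ * serU b := by
  have h : (C b + X : PowerSeries ℝ) * (C b⁻¹ * serU b) = 1 := by
    ext r
    have : (C b + X : PowerSeries ℝ) * (C b⁻¹ * serU b) =
        C b * (C b⁻¹ * serU b) + X * (C b⁻¹ * serU b) := by ring
    rw [this, map_add, PowerSeries.coeff_C_mul, PowerSeries.coeff_C_mul]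
    rcases r with _ | r
    · simp [serU, hb]
    · rw [PowerSeries.coeff_succ_X_mul, PowerSeries.coeff_C_mul]
      simp [serU, PowerSeries.coeff_one]
      ring_nf
      have h0 := mul_inv_cancel₀ hb
      linear_combination (-(b⁻¹ * b⁻¹ ^ r * (-1) ^ r)) * h0
  calc (C b + X : PowerSeries ℝ)⁻¹ = (C b + X : PowerSeries ℝ)⁻¹ * ((C b + X) * (C b⁻¹ * serU b)) := by
        rw [h, mul_one]
    _ = ((C b + X) * (C b + X : PowerSeries ℝ)⁻¹) * (C b⁻¹ * serU b) := by ring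
    _ = _ := by rw [lin_mul_inv b hb, one_mul]

def IntL (L : ℕ) (P : PowerSeries ℝ) : Prop := ∀ r, ∃ z : ℤ, (L : ℝ) ^ r * coeff r P = z

lemma IntL.mul {L : ℕ} {P Q : PowerSeries ℝ} (hP : IntL L P) (hQ : IntL L Q) : IntL L (P * Q) := by
  choose f hf using hP
  choose g hg using hQ
  intro r
  refine ⟨∑ x ∈ antidiagonal r, f x.1 * g x.2, ?_⟩
  rw [PowerSeries.coeff_mul, Finset.mul_sum]
  push_cast
  refine Finset.sum_congr rfl fun x hx => ?_
  rw [← hf, ← hg, ← Finset.HasAntidiagonal.mem_antidiagonal.1 hx, pow_add]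
  ring

lemma IntL.one {L : ℕ} : IntL L 1 := by
  intro r
  rcases r with _ | r
  · exact ⟨1, by simp⟩
  · exact ⟨0, by simp [PowerSeries.coeff_one]⟩

def Maj (P Q : PowerSeries ℝ) : Prop := ∀ r, |coeff r P| ≤ coeff r Q

lemma Maj.mul {P Q P' Q' : PowerSeries ℝ} (h : Maj P Q) (h' : Maj P' Q') : Maj (P * P') (Q * Q') := by
  intro r
  rw [PowerSeries.coeff_mul, PowerSeries.coeff_mul]
  refine (Finset.abs_sum_le_sum_abs _ _).trans (Finset.sum_le_sum fun x _ => ?_)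
  rw [abs_mul]
  exact mul_le_mul (h _) (h' _) (abs_nonneg _) ((abs_nonneg _).trans (h _))

lemma Maj.one : Maj 1 1 := by
  intro r
  rcases r with _ | r <;> simp [PowerSeries.coeff_one]

lemma Maj.pow {P Q : PowerSeries ℝ} (h : Maj P Q) (n : ℕ) : Maj (P ^ n) (Q ^ n) := by
  induction n with
  | zero => simpa using Maj.one
  | succ n ih => rw [pow_succ, pow_succ]; exact ih.mul h

lemma IntL.pow {L : ℕ} {P : PowerSeries ℝ} (h : IntL L P) (n : ℕ) : IntL L (P ^ n) := by
  induction n with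
  | zero => simpa using IntL.one
  | succ n ih => rw [pow_succ]; exact ih.mul h

lemma Maj.prod {S : Finset ℕ} {f : ℕ → PowerSeries ℝ} {Q : PowerSeries ℝ}
    (h : ∀ i ∈ S, Maj (f i) Q) : Maj (∏ i ∈ S, f i) (Q ^ S.card) := by
  induction S using Finset.induction_on with
  | empty => simpa using Maj.one
  | insert a S ha ih =>
    rw [Finset.prod_insert ha, Finset.card_insert_of_notMem ha, pow_succ']
    exact (h a (by simp)).mul (ih fun i hi => h i (by simp [hi]))

lemma coeff_mk_one_pow (d r : ℕ) : coeff r ((PowerSeries.mk 1 : PowerSeries ℝ) ^ d) ≤ 2 ^ (d + r) := by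
  rcases d with _ | d
  · rcases r with _ | r
    · simp
    · simp [PowerSeries.coeff_one]
  · rw [PowerSeries.mk_one_pow_eq_mk_choose_add, PowerSeries.coeff_mk]
    have h1 : (d + r).choose d ≤ 2 ^ (d + r) := Nat.choose_le_two_pow _ _
    have h2 : ((d + r).choose d : ℝ) ≤ 2 ^ (d + r) := by exact_mod_cast h1
    refine h2.trans ?_
    gcongr <;> norm_num

lemma prod_nodes (m k : ℕ) (hk : k ≤ m) : ∏ j ∈ (range (m + 1)).erase k, ((k : ℝ) - j) =
    (-1) ^ (m - k) * (k.factorial * (m - k).factorial) := by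
  induction m, hk using Nat.le_induction with
  | base =>
    have : (range (k + 1)).erase k = range k := by
      rw [Finset.range_add_one, Finset.erase_insert (by simp)]
    rw [this]
    simp only [Nat.sub_self, pow_zero, Nat.factorial_zero, Nat.cast_one, mul_one, one_mul]
    rw [← Finset.prod_range_reflect, ← Finset.prod_range_add_one_eq_factorial]
    push_cast
    refine Finset.prod_congr rfl fun j hj => ?_
    have : j < k := Finset.mem_range.1 hj
    rw [Nat.cast_sub (by omega), Nat.cast_sub (by omega)]
    push_cast; ring
  | succ m hm ih =>
    rw [Finset.range_add_one, Finset.erase_insert_of_ne (by omega), Finset.prod_insert (by simp), ih,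
      show m + 1 - k = (m - k) + 1 by omega, Nat.factorial_succ, pow_succ]
    push_cast
    rw [Nat.cast_sub hm]
    ring

lemma coef_main (m k s L r : ℕ) (hk : k ≤ m) (hL : ∀ b : ℕ, 1 ≤ b → b ≤ m → b ∣ L) :
    ∃ z : ℤ, ((m.factorial : ℝ) ^ s * (L : ℝ) ^ r) *
      coeff r (locG (range (m + 1)) (fun _ => s) k) = z ∧
      |(z : ℝ)| ≤ (L : ℝ) ^ r * (2 ^ (m * s) * 2 ^ (m * s + r)) := by
  set E := (range (m + 1)).erase k with hE
  have hne : ∀ j ∈ E, ((k : ℝ) - j) ≠ 0 := fun j hj =>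
    sub_ne_zero.2 (by exact_mod_cast (Finset.mem_erase.1 hj).1.symm)
  have hloc : locG (range (m + 1)) (fun _ => s) k =
      C (((∏ j ∈ E, ((k : ℝ) - j))⁻¹) ^ s) * ∏ j ∈ E, (serU ((k : ℝ) - j)) ^ s := by
    unfold locG
    rw [← hE, map_pow, ← Finset.prod_inv_distrib, map_prod, ← Finset.prod_pow, ← Finset.prod_mul_distrib]
    refine Finset.prod_congr rfl fun j hj => ?_
    rw [lin_inv_eq _ (hne j hj), mul_pow]
  have hcard : E.card = m := by
    rw [hE, Finset.card_erase_of_mem (by simp; omega)]; simp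
  have hint : IntL L (∏ j ∈ E, (serU ((k : ℝ) - j)) ^ s) := by
    refine Finset.prod_induction _ (IntL L) (fun _ _ => IntL.mul) IntL.one fun j hj => ?_
    refine IntL.pow (fun r => ?_) s
    have hj1 := Finset.mem_erase.1 hj
    have hj2 := Finset.mem_range.1 hj1.2
    have hd : ((k : ℤ) - j) ∣ (L : ℤ) := by
      rw [← Int.natAbs_dvd, Int.natCast_dvd_natCast]
      apply hL <;> omega
    obtain ⟨c, hc⟩ := hd
    refine ⟨(-c) ^ r, ?_⟩
    have hc' : (L : ℝ) = ((k : ℝ) - j) * c := by exact_mod_cast hc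
    rw [serU, PowerSeries.coeff_mk, ← mul_pow, hc']
    push_cast
    congr 1
    field_simp [hne j hj]
  have hmaj : Maj (∏ j ∈ E, (serU ((k : ℝ) - j)) ^ s) ((PowerSeries.mk 1 : PowerSeries ℝ) ^ (m * s)) := by
    rw [mul_comm, pow_mul, ← hcard]
    refine Maj.prod fun j hj => Maj.pow (fun r => ?_) s
    have hj1 := Finset.mem_erase.1 hj
    rw [serU, PowerSeries.coeff_mk, PowerSeries.coeff_mk, abs_pow, abs_neg, Pi.one_apply]
    apply pow_le_one₀ (abs_nonneg _)
    rw [abs_inv]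
    apply inv_le_one_of_one_le₀
    have : (1 : ℤ) ≤ |(k : ℤ) - j| := Int.one_le_abs (by omega)
    exact_mod_cast this
  obtain ⟨z, hz⟩ := hint r
  have hz2 := (hmaj r).trans (coeff_mk_one_pow _ _)
  have hfac : (m.factorial : ℝ) * (∏ j ∈ E, ((k : ℝ) - j))⁻¹ = (-1) ^ (m - k) * (m.choose k : ℝ) := by
    rw [hE, prod_nodes m k hk, ← Nat.choose_mul_factorial_mul_factorial hk]
    push_cast
    have h1 : (k.factorial : ℝ) ≠ 0 := by positivity
    have h2 : ((m - k).factorial : ℝ) ≠ 0 := by positivity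
    rcases neg_one_pow_eq_or ℝ (m - k) with h | h <;> rw [h] <;> field_simp
  have key : ((m.factorial : ℝ) ^ s * (L : ℝ) ^ r) *
      coeff r (locG (range (m + 1)) (fun _ => s) k) = ((-1) ^ (m - k) * (m.choose k : ℝ)) ^ s *
      ((L : ℝ) ^ r * coeff r (∏ j ∈ E, (serU ((k : ℝ) - j)) ^ s)) := by
    rw [hloc, PowerSeries.coeff_C_mul, ← hfac, mul_pow]
    ring
  refine ⟨((-1) ^ (m - k) * (m.choose k : ℤ)) ^ s * z, ?_, ?_⟩
  · rw [key, hz]; push_cast; ring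
  · have : ((((-1) ^ (m - k) * (m.choose k : ℤ)) ^ s * z : ℤ) : ℝ) =
      ((-1) ^ (m - k) * (m.choose k : ℝ)) ^ s *
      ((L : ℝ) ^ r * coeff r (∏ j ∈ E, (serU ((k : ℝ) - j)) ^ s)) := by
      rw [hz]; push_cast; ring
    rw [this, abs_mul, abs_mul, abs_pow, abs_mul, abs_pow, abs_pow, abs_neg, abs_one, one_pow, one_mul,
      Nat.abs_cast, Nat.abs_cast]
    have h1 : (m.choose k : ℝ) ≤ 2 ^ m := by exact_mod_cast Nat.choose_le_two_pow m k
    calc (m.choose k : ℝ) ^ s * ((L : ℝ) ^ r * |coeff r (∏ j ∈ E, (serU ((k : ℝ) - j)) ^ s)|)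
        ≤ (2 ^ m) ^ s * ((L : ℝ) ^ r * 2 ^ (m * s + r)) := by gcongr
      _ = _ := by rw [pow_mul]; ring

lemma coeff_lin_pow (k : ℝ) (t i : ℕ) :
    coeff i ((C k + X : PowerSeries ℝ) ^ t) = (t.choose i : ℝ) * k ^ (t - i) := by
  have : (C k + X : PowerSeries ℝ) ^ t = (((Polynomial.X + Polynomial.C k) ^ t : Polynomial ℝ) : PowerSeries ℝ) := by
    simp [add_comm]
  rw [this, Polynomial.coeff_coe, Polynomial.coeff_X_add_C_pow, mul_comm]

lemma expsum (i k : ℕ) (z : ℝ) :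
    HasSum (fun t : ℕ => ((t.choose i : ℝ) * (k : ℝ) ^ (t - i)) * (z ^ t / t.factorial))
      (z ^ i / i.factorial * Real.exp z ^ k) := by
  have h1 : HasSum (fun j : ℕ => (k * z) ^ j / (j.factorial : ℝ)) (Real.exp (k * z)) := by
    rw [Real.exp_eq_exp_ℝ]
    exact NormedSpace.expSeries_div_hasSum_exp (k * z)
  have h2 := h1.mul_left (z ^ i / i.factorial)
  rw [← Real.exp_nat_mul]
  rw [← (add_left_injective i).hasSum_iff]
  · convert! h2 using 2 with j
    simp only [Function.comp]
    have h3 := Nat.add_choose_mul_factorial_mul_factorial j i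
    have h4 : ((j + i).choose i : ℝ) * j.factorial * i.factorial = (j + i).factorial := by
      rw [← h3]; push_cast; ring
    rw [← h4, Nat.add_sub_cancel, mul_pow, pow_add]
    have h5 : ((j + i).choose i : ℝ) ≠ 0 := by
      have := Nat.choose_pos (Nat.le_add_left i j)
      positivity
    have h6 : (j.factorial : ℝ) ≠ 0 := by positivity
    have h7 : (i.factorial : ℝ) ≠ 0 := by positivity
    field_simp
  · intro t ht
    have : t < i := by
      by_contra! hc
      exact ht ⟨t - i, by simp; omega⟩
    rw [Nat.choose_eq_zero_of_lt this]; simp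

noncomputable def Rz (m n : ℕ) (z : ℝ) : ℝ :=
  ∑ k ∈ range (m + 1), ∑ i ∈ range (n + 1),
    coeff (n - i) (locG (range (m + 1)) (fun _ => n + 1) k) * (z ^ i / i.factorial * Real.exp z ^ k)

lemma hasSum_Rz (m n : ℕ) (z : ℝ) :
    HasSum (fun t : ℕ => lam (range (m + 1)) (fun _ => n + 1) t * (z ^ t / t.factorial)) (Rz m n z) := by
  have : (fun t : ℕ => lam (range (m + 1)) (fun _ => n + 1) t * (z ^ t / t.factorial)) =
      fun t : ℕ => ∑ k ∈ range (m + 1), ∑ i ∈ range (n + 1),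
        coeff (n - i) (locG (range (m + 1)) (fun _ => n + 1) k) *
        (((t.choose i : ℝ) * (k : ℝ) ^ (t - i)) * (z ^ t / t.factorial)) := by
    funext t
    unfold lam
    rw [Finset.sum_mul]
    refine Finset.sum_congr rfl fun k hk => ?_
    rw [PowerSeries.coeff_succ_X_mul, PowerSeries.coeff_mul,
      Finset.Nat.sum_antidiagonal_eq_sum_range_succ_mk, Finset.sum_mul]
    refine Finset.sum_congr rfl fun i hi => ?_
    simp only
    rw [coeff_lin_pow]
    ring
  rw [this]
  exact hasSum_sum fun k _ => hasSum_sum fun i _ => (expsum i k z).mul_left _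

lemma Rz_bounds (m n : ℕ) (z : ℝ) (hz : 0 ≤ z) :
    z ^ (m * (n + 1) + n) / (m * (n + 1) + n).factorial ≤ Rz m n z ∧
    Rz m n z ≤ z ^ (m * (n + 1) + n) / (m * (n + 1) + n).factorial * Real.exp z ^ m := by
  have hs : ∑ k ∈ range (m + 1), (fun _ : ℕ => n + 1) k = (m * (n + 1) + n) + 1 := by
    simp; ring
  have hM : ∀ k ∈ range (m + 1), k ≤ m := fun k hk => by
    have := Finset.mem_range.1 hk; omega
  have hl := fun t => lam_main (range (m + 1)) m hM t (fun _ => n + 1) _ hs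
  constructor
  · have := le_hasSum (hasSum_Rz m n z) (m * (n + 1) + n)
      (fun t _ => mul_nonneg (hl t).1 (by positivity))
    rwa [(hl _).2.2 rfl, one_mul] at this
  · refine hasSum_le (fun t => ?_) (hasSum_Rz m n z) (expsum _ m z)
    have := (hl t).2.1
    gcongr

lemma exists_poly (m n p q L Q : ℕ) (hq : 0 < q) (hL : ∀ b : ℕ, 1 ≤ b → b ≤ m → b ∣ L)
    (hL0 : 0 < L) (hpQ : p ≤ Q) (hqQ : q ≤ Q) :
    ∃ F : Polynomial ℤ, F.natDegree ≤ m ∧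
      (∀ k, |(F.coeff k : ℝ)| ≤ (n + 1) * (n.factorial * (L : ℝ) ^ n *
        (2 ^ (m * (n + 1)) * 2 ^ (m * (n + 1) + n))) * (Q : ℝ) ^ n) ∧
      Polynomial.aeval (Real.exp ((p : ℝ) / q)) F =
        (q : ℝ) ^ n * ((m.factorial : ℝ) ^ (n + 1) * (L : ℝ) ^ n * n.factorial) * Rz m n ((p : ℝ) / q) := by
  have ha : ∀ k i : ℕ, ∃ a : ℤ, k ≤ m → i ≤ n →
      ((a : ℝ) = ((m.factorial : ℝ) ^ (n + 1) * (L : ℝ) ^ n * n.factorial) *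
        (coeff (n - i) (locG (range (m + 1)) (fun _ => n + 1) k) / i.factorial) ∧
      |(a : ℝ)| ≤ n.factorial * (L : ℝ) ^ n *
        (2 ^ (m * (n + 1)) * 2 ^ (m * (n + 1) + n))) := by
    intro k i
    by_cases hki : k ≤ m ∧ i ≤ n
    · obtain ⟨hk, hi⟩ := hki
      obtain ⟨z, hz1, hz2⟩ := coef_main m k (n + 1) L (n - i) hk hL
      obtain ⟨c, hc⟩ := Nat.factorial_dvd_factorial hi
      have hc' : (n.factorial : ℝ) = i.factorial * c := by exact_mod_cast hc
      have hcn : (c : ℝ) ≤ n.factorial := by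
        have : c ≤ n.factorial := Nat.le_of_dvd (Nat.factorial_pos n) ⟨_, by rw [hc, mul_comm]⟩
        exact_mod_cast this
      have hLp : (L : ℝ) ^ n = L ^ (n - i) * L ^ i := by rw [← pow_add]; congr 1; omega
      have hi0 : (i.factorial : ℝ) ≠ 0 := by positivity
      refine ⟨z * L ^ i * c, fun _ _ => ⟨?_, ?_⟩⟩
      · push_cast
        rw [← hz1, hc', hLp]
        field_simp
      · push_cast
        rw [abs_mul, abs_mul, abs_pow, Nat.abs_cast, Nat.abs_cast]
        calc |(z : ℝ)| * (L : ℝ) ^ i * c ≤ ((L : ℝ) ^ (n - i) * (2 ^ (m * (n + 1)) * 2 ^ (m * (n + 1) + (n - i)))) * (L : ℝ) ^ i * n.factorial := by gcongr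
          _ ≤ ((L : ℝ) ^ (n - i) * (2 ^ (m * (n + 1)) * 2 ^ (m * (n + 1) + n))) * (L : ℝ) ^ i * n.factorial := by
            gcongr
            · norm_num
            · omega
          _ = _ := by rw [hLp]; ring
    · exact ⟨0, fun h1 h2 => absurd ⟨h1, h2⟩ hki⟩
  choose a ha using ha
  set b : ℕ → ℤ := fun k => ∑ i ∈ range (n + 1), a k i * ((p : ℤ) ^ i * (q : ℤ) ^ (n - i)) with hb
  refine ⟨∑ k ∈ range (m + 1), Polynomial.C (b k) * Polynomial.X ^ k, ?_, ?_, ?_⟩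
  · refine Polynomial.natDegree_sum_le_of_forall_le _ _ fun k hk => ?_
    refine (Polynomial.natDegree_C_mul_X_pow_le _ _).trans ?_
    have := Finset.mem_range.1 hk; omega
  · intro k
    rw [Polynomial.finsetSum_coeff]
    simp only [Polynomial.coeff_C_mul_X_pow]
    rw [Finset.sum_ite_eq]
    split_ifs with hk
    · have hkm : k ≤ m := by have := Finset.mem_range.1 hk; omega
      rw [hb]
      push_cast
      refine (Finset.abs_sum_le_sum_abs _ _).trans ?_
      refine (Finset.sum_le_card_nsmul _ _ (n.factorial * (L : ℝ) ^ n *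
        (2 ^ (m * (n + 1)) * 2 ^ (m * (n + 1) + n)) * (Q : ℝ) ^ n) fun i hi => ?_).trans ?_
      · have hin : i ≤ n := by have := Finset.mem_range.1 hi; omega
        rw [abs_mul]
        refine mul_le_mul (ha k i hkm hin).2 ?_ (abs_nonneg _) (by positivity)
        rw [abs_of_nonneg (by positivity)]
        calc (p : ℝ) ^ i * (q : ℝ) ^ (n - i) ≤ (Q : ℝ) ^ i * (Q : ℝ) ^ (n - i) := by gcongr
          _ = _ := by rw [← pow_add]; congr 1; omega
      · rw [Finset.card_range, nsmul_eq_mul]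
        push_cast
        exact le_of_eq (by ring)
    · simp only [Int.cast_zero, abs_zero]; positivity
  · rw [map_sum, Rz, Finset.mul_sum]
    refine Finset.sum_congr rfl fun k hk => ?_
    have hkm : k ≤ m := by have := Finset.mem_range.1 hk; omega
    rw [map_mul, Polynomial.aeval_C, map_pow, Polynomial.aeval_X, hb]
    simp only [map_sum, algebraMap_int_eq, eq_intCast]
    rw [Finset.sum_mul, Finset.mul_sum]
    refine Finset.sum_congr rfl fun i hi => ?_
    have hin : i ≤ n := by have := Finset.mem_range.1 hi; omega
    push_cast
    rw [(ha k i hkm hin).1]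
    have hqn : (q : ℝ) ^ n = q ^ (n - i) * q ^ i := by rw [← pow_add]; congr 1; omega
    rw [hqn, div_pow]
    have : (q : ℝ) ≠ 0 := by positivity
    field_simp

/-- Liouville type lower bound for integer polynomials at an algebraic number. -/
lemma liouville_ineq (β : ℝ) (hβ : IsAlgebraic ℚ β) :
    ∃ (d : ℕ) (c : ℝ), 1 ≤ c ∧ ∀ (m : ℕ) (F : Polynomial ℤ) (B : ℝ), 1 ≤ B → F.natDegree ≤ m →
      (∀ k, |(F.coeff k : ℝ)| ≤ B) → Polynomial.aeval β F ≠ 0 →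
      1 ≤ |Polynomial.aeval β F| * (c ^ (m + 1) * B) ^ d := by
  classical
  let K := IntermediateField.adjoin ℚ {β}
  have hfin : FiniteDimensional ℚ K := IntermediateField.adjoin.finiteDimensional hβ.isIntegral
  have : NumberField K := ⟨⟩
  let b : K := IntermediateField.AdjoinSimple.gen ℚ β
  have hbβ : algebraMap K ℝ b = β := IntermediateField.AdjoinSimple.algebraMap_gen ℚ β
  have hbalg : IsAlgebraic ℤ b := by
    rw [IsFractionRing.isAlgebraic_iff ℤ ℚ K]
    exact Algebra.IsAlgebraic.isAlgebraic b
  obtain ⟨y, hy0, hy⟩ := hbalg.exists_integral_multiple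
  let H : ℝ := max 1 (NumberField.house b)
  let A : ℝ := |(y : ℝ)|
  have hA : 1 ≤ A := by
    have : (1 : ℤ) ≤ |y| := Int.one_le_abs hy0
    show 1 ≤ |(y : ℝ)|
    exact_mod_cast this
  have hH : 1 ≤ H := le_max_left _ _
  refine ⟨Module.finrank ℚ K - 1 + 1, 2 * A * H, by nlinarith, ?_⟩
  intro m F B hB hdeg hcoef hne
  let g : K := Polynomial.aeval b F
  let x : K := (y : K) ^ m * g
  have hgβ : algebraMap K ℝ g = Polynomial.aeval β F := by
    rw [← hbβ, Polynomial.aeval_algebraMap_apply]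
  have hg0 : g ≠ 0 := by
    intro h; apply hne; rw [← hgβ, h, map_zero]
  have hx0 : x ≠ 0 := mul_ne_zero (pow_ne_zero _ (by exact_mod_cast hy0)) hg0
  have hxint : IsIntegral ℤ x := by
    have : x = ∑ k ∈ Finset.range (m + 1), (F.coeff k : K) * ((y : K) ^ (m - k) * (y • b) ^ k) := by
      show (y : K) ^ m * Polynomial.aeval b F = _
      rw [Polynomial.aeval_eq_sum_range' (Nat.lt_succ_of_le hdeg), Finset.mul_sum]
      refine Finset.sum_congr rfl fun k hk => ?_
      have hk' : k ≤ m := by have := Finset.mem_range.1 hk; omega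
      have : (y : K) ^ m = (y : K) ^ (m - k) * (y : K) ^ k := by
        rw [← pow_add]; congr 1; omega
      rw [this, zsmul_eq_mul, zsmul_eq_mul, mul_pow]
      ring
    rw [this]
    refine IsIntegral.sum _ fun k _ => ?_
    have hi : ∀ w : ℤ, IsIntegral ℤ (w : K) := fun w => by
      simpa using (isIntegral_algebraMap (R := ℤ) (A := K) (x := w))
    exact (hi _).mul (((hi _).pow _).mul (hy.pow _))
  -- bound for all embeddings
  have hhouse : NumberField.house x ≤ (2 * A * H) ^ (m + 1) * B := by
    have hg : NumberField.house g ≤ (m + 1) * (B * H ^ m) := by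
      have : g = ∑ k ∈ Finset.range (m + 1), (F.coeff k : K) * b ^ k := by
        show Polynomial.aeval b F = _
        rw [Polynomial.aeval_eq_sum_range' (Nat.lt_succ_of_le hdeg)]
        refine Finset.sum_congr rfl fun k hk => ?_
        rw [zsmul_eq_mul]
      rw [this]
      refine (NumberField.house_sum_le_sum_house _ _).trans ?_
      refine (Finset.sum_le_card_nsmul _ _ (B * H ^ m) fun k hk => ?_).trans ?_
      · have hk' : k ≤ m := by have := Finset.mem_range.1 hk; omega
        refine (NumberField.house_mul_le _ _).trans ?_
        rw [NumberField.house_intCast]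
        have h1 : NumberField.house (b ^ k) ≤ H ^ m :=
          calc NumberField.house (b ^ k) ≤ NumberField.house b ^ k := NumberField.house_pow_le _ _
            _ ≤ H ^ k := pow_le_pow_left₀ (NumberField.house_nonneg b) (le_max_right _ _) _
            _ ≤ H ^ m := pow_le_pow_right₀ hH hk'
        refine mul_le_mul ?_ h1 (NumberField.house_nonneg _) (by positivity)
        have := hcoef k
        push_cast
        exact this
      · rw [Finset.card_range, nsmul_eq_mul]
        push_cast
        exact le_rfl
    have hyh : NumberField.house ((y : K) ^ m) ≤ A ^ m := by
      refine (NumberField.house_pow_le _ _).trans ?_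
      rw [NumberField.house_intCast]
      push_cast
      exact le_rfl
    have h2m : ((m : ℝ) + 1) ≤ 2 ^ (m + 1) := by
      have : m + 1 ≤ 2 ^ (m + 1) := Nat.lt_two_pow_self.le
      exact_mod_cast this
    have hAH : 1 ≤ A * H := by nlinarith
    calc NumberField.house x ≤ NumberField.house ((y : K) ^ m) * NumberField.house g :=
          NumberField.house_mul_le _ _
      _ ≤ A ^ m * ((m + 1) * (B * H ^ m)) :=
          mul_le_mul hyh hg (NumberField.house_nonneg _) (by positivity)
      _ = (m + 1) * ((A * H) ^ m) * B := by rw [mul_pow]; ring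
      _ ≤ 2 ^ (m + 1) * (A * H) ^ (m + 1) * B := by
          gcongr
          omega
      _ = _ := by rw [← mul_pow]; ring
  have hnorm : (1 : ℝ) ≤ ‖Algebra.norm ℚ x‖ := by
    have h1 : IsIntegral ℤ (Algebra.norm ℚ x) := Algebra.isIntegral_norm ℚ hxint
    obtain ⟨w, hw⟩ := IsIntegrallyClosed.isIntegral_iff.1 h1
    have hw0 : w ≠ 0 := by
      rintro rfl
      rw [map_zero] at hw
      exact hx0 (Algebra.norm_eq_zero_iff.1 hw.symm)
    rw [← hw]
    have : (1 : ℤ) ≤ |w| := Int.one_le_abs hw0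
    simp only [algebraMap_int_eq, eq_intCast, Int.norm_cast_rat, Int.norm_eq_abs]
    exact_mod_cast this
  let σ : K →+* ℂ := (algebraMap ℝ ℂ).comp (algebraMap K ℝ)
  have hσ : ‖σ x‖ = A ^ m * |Polynomial.aeval β F| := by
    show ‖((algebraMap K ℝ ((y : K) ^ m * g) : ℝ) : ℂ)‖ = _
    rw [Complex.norm_real, map_mul, hgβ, map_pow, map_intCast, Real.norm_eq_abs, abs_mul, abs_pow]
  have h1 := hnorm.trans (NumberField.norm_norm_le_norm_mul_house_pow x σ)
  rw [hσ] at h1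
  set T := (2 * A * H) ^ (m + 1) * B with hT
  have hAT : A ^ m ≤ T := by
    have h2 : A ≤ 2 * A * H := by nlinarith
    calc A ^ m ≤ (2 * A * H) ^ m := by gcongr
      _ ≤ (2 * A * H) ^ (m + 1) := pow_le_pow_right₀ (by nlinarith) (by omega)
      _ ≤ T := le_mul_of_one_le_right (by positivity) hB
  calc 1 ≤ A ^ m * |Polynomial.aeval β F| * NumberField.house x ^ (Module.finrank ℚ K - 1) := h1
    _ ≤ T * |Polynomial.aeval β F| * T ^ (Module.finrank ℚ K - 1) := by
      gcongr
      · exact pow_nonneg (NumberField.house_nonneg x) _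
      · exact NumberField.house_nonneg x
    _ = _ := by rw [pow_succ]; ring

lemma lcm_bound (m : ℕ) : (Nat.lcmUpto m : ℝ) ≤ Real.exp (Real.log 4 + 4) ^ m := by
  have h := Chebyshev.psi_le_const_mul_self (x := (m : ℝ)) (by positivity)
  rw [Chebyshev.psi_eq_log_lcmUpto] at h
  have hp : (0 : ℝ) < Nat.lcmUpto m := by exact_mod_cast Nat.lcmUpto_pos m
  rw [← Real.exp_nat_mul, mul_comm]
  exact (Real.log_le_iff_le_exp hp).1 h

lemma dvd_lcmUpto (m b : ℕ) (h1 : 1 ≤ b) (h2 : b ≤ m) : b ∣ Nat.lcmUpto m := by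
  unfold Nat.lcmUpto
  exact Finset.dvd_lcm (f := id) (Finset.mem_Icc.2 ⟨h1, h2⟩)

lemma fact_up (m s n : ℕ) (hs : 0 < s) :
    (m.factorial : ℝ) ^ s / (m * s + n).factorial ≤ (Real.exp 1 / s) ^ (m * s) := by
  have h1 : ((m * s : ℕ) : ℝ) ^ (m * s) / (m * s).factorial ≤ Real.exp ((m * s : ℕ) : ℝ) :=
    Real.pow_div_factorial_le_exp _ (by positivity) _
  have h2 : (m.factorial : ℝ) ≤ (m : ℝ) ^ m := by exact_mod_cast Nat.factorial_le_pow m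
  have h3 : ((m * s).factorial : ℝ) ≤ (m * s + n).factorial := by
    exact_mod_cast Nat.factorial_le (Nat.le_add_right _ _)
  have h4 : Real.exp ((m * s : ℕ) : ℝ) = Real.exp 1 ^ (m * s) := by
    rw [← Real.exp_nat_mul, mul_one]
  rw [h4] at h1
  calc (m.factorial : ℝ) ^ s / (m * s + n).factorial ≤ ((m : ℝ) ^ m) ^ s / (m * s).factorial := by
        gcongr
    _ = (((m * s : ℕ) : ℝ) ^ (m * s) / (m * s).factorial) / (s : ℝ) ^ (m * s) := by
        push_cast
        rw [mul_pow, ← pow_mul]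
        field_simp
    _ ≤ Real.exp 1 ^ (m * s) / (s : ℝ) ^ (m * s) := by gcongr
    _ = _ := by rw [div_pow]

lemma fact_low0 (m s : ℕ) : (m * s).factorial ≤ s ^ (m * s) * m.factorial ^ s := by
  induction m with
  | zero => simp
  | succ m ih =>
    have h : ((m + 1) * s).factorial ≤ (m * s).factorial * ((m + 1) * s) ^ s := by
      rw [add_mul, one_mul]
      rw [← Nat.factorial_mul_ascFactorial]
      exact Nat.mul_le_mul_left _ (Nat.ascFactorial_le_pow_add _ _)
    calc ((m + 1) * s).factorial ≤ (m * s).factorial * ((m + 1) * s) ^ s := h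
      _ ≤ (s ^ (m * s) * m.factorial ^ s) * ((m + 1) * s) ^ s := by gcongr
      _ = _ := by rw [Nat.factorial_succ, mul_pow, mul_pow, add_mul m 1 s, pow_add, one_mul]; ring

lemma fact_low (m n : ℕ) : ((m * (n + 1) + n).factorial : ℝ) ≤
    (2 * (n + 1 : ℝ)) ^ (m * (n + 1) + (n + 1)) * (m.factorial : ℝ) ^ (n + 1) := by
  have h : (m * (n + 1) + n).factorial ≤
    (2 * (n + 1)) ^ (m * (n + 1) + (n + 1)) * m.factorial ^ (n + 1) := by
    calc (m * (n + 1) + n).factorial ≤ ((m + 1) * (n + 1)).factorial :=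
          Nat.factorial_le (by ring_nf; omega)
      _ ≤ (n + 1) ^ ((m + 1) * (n + 1)) * (m + 1).factorial ^ (n + 1) := fact_low0 _ _
      _ = (n + 1) ^ ((m + 1) * (n + 1)) * ((m + 1) ^ (n + 1) * m.factorial ^ (n + 1)) := by
          rw [Nat.factorial_succ, mul_pow]
      _ ≤ (n + 1) ^ ((m + 1) * (n + 1)) * ((2 ^ (m + 1)) ^ (n + 1) * m.factorial ^ (n + 1)) := by
          gcongr
          exact Nat.lt_two_pow_self.le
      _ = _ := by rw [← pow_mul, mul_pow, add_mul, one_mul]; ring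
  exact_mod_cast h

lemma poly_diff (m : ℕ) (F : Polynomial ℤ) (B G x y : ℝ) (hG : 1 ≤ G) (hdeg : F.natDegree ≤ m)
    (hcoef : ∀ k, |(F.coeff k : ℝ)| ≤ B) (hx : |x| ≤ G) (hy : |y| ≤ G) :
    |Polynomial.aeval x F - Polynomial.aeval y F| ≤ B * (4 * G) ^ m * |x - y| := by
  have hB : 0 ≤ B := (abs_nonneg _).trans (hcoef 0)
  rw [Polynomial.aeval_eq_sum_range' (Nat.lt_succ_of_le hdeg),
    Polynomial.aeval_eq_sum_range' (Nat.lt_succ_of_le hdeg), ← Finset.sum_sub_distrib]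
  refine (Finset.abs_sum_le_sum_abs _ _).trans ?_
  refine (Finset.sum_le_card_nsmul _ _ (B * (|x - y| * 2 ^ m * G ^ m)) fun k hk => ?_).trans ?_
  · have hk' : k ≤ m := by have := Finset.mem_range.1 hk; omega
    rw [zsmul_eq_mul, zsmul_eq_mul, ← mul_sub, abs_mul]
    have h2 : (k : ℝ) ≤ 2 ^ m := by
      have : k ≤ 2 ^ m := hk'.trans Nat.lt_two_pow_self.le
      exact_mod_cast this
    have h3 : max |x| |y| ^ (k - 1) ≤ G ^ m :=
      (pow_le_pow_left₀ (by positivity) (max_le hx hy) _).trans (pow_le_pow_right₀ hG (by omega))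
    have h4 : |x ^ k - y ^ k| ≤ |x - y| * 2 ^ m * G ^ m :=
      (abs_pow_sub_pow_le x y k).trans (by gcongr)
    exact mul_le_mul (hcoef k) h4 (abs_nonneg _) hB
  · rw [Finset.card_range, nsmul_eq_mul]
    have h2 : ((m + 1 : ℕ) : ℝ) ≤ 2 ^ m := by
      have : m + 1 ≤ 2 ^ m := Nat.lt_two_pow_self
      exact_mod_cast this
    calc ((m + 1 : ℕ) : ℝ) * (B * (|x - y| * 2 ^ m * G ^ m)) ≤ 2 ^ m * (B * (|x - y| * 2 ^ m * G ^ m)) := by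
          gcongr
      _ = B * (2 ^ m * 2 ^ m * G ^ m) * |x - y| := by ring
      _ = _ := by rw [← mul_pow, ← mul_pow]; norm_num

lemma exists_poly' (A m n p q : ℕ) (a K : ℝ) (hK : K = Real.exp (Real.log 4 + 4)) (hA : 1 ≤ A)
    (ha : 0 < a) (ha1 : a ≤ 1) (hq : 0 < q) (h1 : a ≤ (p : ℝ) / q) (h2 : (p : ℝ) / q ≤ A) :
    ∃ F : Polynomial ℤ, F.natDegree ≤ m ∧
      (∀ k, |(F.coeff k : ℝ)| ≤ ((n + 1) * n.factorial * 2 ^ n * (A : ℝ) ^ n) * (q : ℝ) ^ n *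
        (4 * K) ^ (m * (n + 1))) ∧
      Polynomial.aeval (Real.exp ((p : ℝ) / q)) F ≤ (n.factorial * (A : ℝ) ^ n) * (q : ℝ) ^ n *
        (K * A * Real.exp 1 * Real.exp A / (n + 1)) ^ (m * (n + 1)) ∧
      (a / (2 * (n + 1))) ^ (m * (n + 1) + (n + 1)) ≤ Polynomial.aeval (Real.exp ((p : ℝ) / q)) F := by
  have hK1 : 1 ≤ K := by
    rw [hK]; apply Real.one_le_exp
    have : 0 ≤ Real.log 4 := Real.log_nonneg (by norm_num)
    linarith
  have hq' : (0 : ℝ) < q := by exact_mod_cast hq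
  have hpQ : p ≤ A * q := by
    rw [div_le_iff₀ hq'] at h2
    exact_mod_cast h2
  have hqQ : q ≤ A * q := Nat.le_mul_of_pos_left _ hA
  set L := Nat.lcmUpto m with hLdef
  have hL0 : 0 < L := Nat.lcmUpto_pos m
  have hLK : (L : ℝ) ≤ K ^ m := by rw [hK]; exact lcm_bound m
  have hLn : (L : ℝ) ^ n ≤ K ^ (m * (n + 1)) := by
    calc (L : ℝ) ^ n ≤ (K ^ m) ^ n := by gcongr
      _ = K ^ (m * n) := by rw [pow_mul]
      _ ≤ _ := pow_le_pow_right₀ hK1 (by gcongr; omega)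
  have hL1 : (1 : ℝ) ≤ L := by exact_mod_cast hL0
  obtain ⟨F, hF1, hF2, hF3⟩ := exists_poly m n p q L (A * q) hq (dvd_lcmUpto m) hL0 hpQ hqQ
  set z := (p : ℝ) / q with hz
  have hz0 : 0 ≤ z := by positivity
  obtain ⟨hR1, hR2⟩ := Rz_bounds m n z hz0
  set X := m * (n + 1) with hX
  refine ⟨F, hF1, fun k => (hF2 k).trans ?_, ?_, ?_⟩
  · calc (n + 1) * (n.factorial * (L : ℝ) ^ n * (2 ^ X * 2 ^ (X + n))) * ((A * q : ℕ) : ℝ) ^ n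
        ≤ (n + 1) * (n.factorial * K ^ X * (2 ^ X * 2 ^ (X + n))) * ((A * q : ℕ) : ℝ) ^ n := by gcongr
      _ = ((n + 1) * n.factorial * 2 ^ n * (A : ℝ) ^ n) * (q : ℝ) ^ n * ((2 * 2 * K) ^ X) := by
        push_cast
        rw [mul_pow, mul_pow, mul_pow, pow_add]; ring
      _ = _ := by norm_num
  · rw [hF3]
    have hfu := fact_up m (n + 1) n (by omega)
    rw [← hX] at hfu
    push_cast at hfu
    have hexp : Real.exp z ^ m ≤ Real.exp A ^ X :=
      calc Real.exp z ^ m ≤ Real.exp A ^ m := by gcongr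
        _ ≤ _ := pow_le_pow_right₀ (Real.one_le_exp (by positivity)) (Nat.le_mul_of_pos_right _ (by omega))
    calc (q : ℝ) ^ n * ((m.factorial : ℝ) ^ (n + 1) * (L : ℝ) ^ n * n.factorial) * Rz m n z
        ≤ (q : ℝ) ^ n * ((m.factorial : ℝ) ^ (n + 1) * (L : ℝ) ^ n * n.factorial) *
          (z ^ (X + n) / (X + n).factorial * Real.exp z ^ m) := by gcongr
      _ = (q : ℝ) ^ n * n.factorial * (L : ℝ) ^ n * ((m.factorial : ℝ) ^ (n + 1) / (X + n).factorial) *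
          z ^ (X + n) * Real.exp z ^ m := by ring
      _ ≤ (q : ℝ) ^ n * n.factorial * K ^ X * (Real.exp 1 / (n + 1)) ^ X *
          (A : ℝ) ^ (X + n) * Real.exp A ^ X := by gcongr
      _ = _ := by
        rw [pow_add]
        simp only [div_pow, mul_pow]
        ring
  · rw [hF3]
    have hfl := fact_low m n
    rw [← hX] at hfl
    have hq1 : (1 : ℝ) ≤ (q : ℝ) ^ n := one_le_pow₀ (by exact_mod_cast hq)
    have hn1 : (1 : ℝ) ≤ n.factorial := by exact_mod_cast n.factorial_pos
    have hLn1 : (1 : ℝ) ≤ (L : ℝ) ^ n := one_le_pow₀ hL1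
    have hRp : 0 ≤ Rz m n z := le_trans (by positivity) hR1
    calc (a / (2 * (n + 1))) ^ (X + (n + 1)) = a ^ (X + (n + 1)) / (2 * (n + 1 : ℝ)) ^ (X + (n + 1)) := by
          rw [div_pow]
      _ ≤ a ^ (X + n) / (2 * (n + 1 : ℝ)) ^ (X + (n + 1)) := by
          gcongr 1
          exact pow_le_pow_of_le_one ha.le ha1 (by omega)
      _ ≤ z ^ (X + n) / (2 * (n + 1 : ℝ)) ^ (X + (n + 1)) := by gcongr
      _ ≤ (m.factorial : ℝ) ^ (n + 1) * (z ^ (X + n) / (X + n).factorial) := by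
          rw [← mul_div_assoc, div_le_div_iff₀ (by positivity) (by positivity)]
          calc z ^ (X + n) * ((X + n).factorial : ℝ) ≤ z ^ (X + n) * ((2 * (n + 1 : ℝ)) ^ (X + (n + 1)) * (m.factorial : ℝ) ^ (n + 1)) := by gcongr
            _ = _ := by ring
      _ ≤ (m.factorial : ℝ) ^ (n + 1) * Rz m n z := by gcongr
      _ = 1 * ((m.factorial : ℝ) ^ (n + 1) * 1 * 1) * Rz m n z := by ring
      _ ≤ _ := by gcongr

lemma exp_diff (A G x y : ℝ) (hG : G = Real.exp A) (hx : x ≤ A) (hy : y ≤ A) :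
    |Real.exp x - Real.exp y| ≤ G * |x - y| := by
  have key : ∀ x y : ℝ, x ≤ A → Real.exp x - Real.exp y ≤ G * |x - y| := by
    intro x y hx
    have h1 := Real.add_one_le_exp (y - x)
    have h2 : Real.exp y = Real.exp x * Real.exp (y - x) := by
      rw [← Real.exp_add]; congr 1; ring
    calc Real.exp x - Real.exp y = Real.exp x * (1 - Real.exp (y - x)) := by rw [h2]; ring
      _ ≤ Real.exp x * |x - y| := by
        have := le_abs_self (x - y)
        gcongr
        linarith
      _ ≤ G * |x - y| := by
        rw [hG]
        gcongr
  rw [abs_le]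
  have h1 := key x y hx
  have h2 := key y x hy
  rw [abs_sub_comm y x] at h2
  exact ⟨by linarith, h1⟩

lemma core (α : ℝ) (hα : 0 < α) (halg : IsAlgebraic ℚ (Real.exp α)) :
    ∃ (W T ε Q₀ : ℝ), 0 < W ∧ 1 ≤ T ∧ 0 < ε ∧ ∀ (q p u : ℕ), 0 < q → Q₀ ≤ q → q ≤ 2 ^ u →
      |α - (p : ℝ) / q| ≤ ε → 1 ≤ W * T ^ u * |α - (p : ℝ) / q| := by
  obtain ⟨d, c, hc1, hd⟩ := liouville_ineq _ halg
  obtain ⟨A, hA⟩ := exists_nat_ge (α + 1)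
  have hA1 : 1 ≤ A := by
    have : (1 : ℝ) ≤ A := by linarith
    exact_mod_cast this
  have hA1' : (1 : ℝ) ≤ A := by exact_mod_cast hA1
  obtain ⟨K, hK⟩ : ∃ K : ℝ, K = Real.exp (Real.log 4 + 4) := ⟨_, rfl⟩
  have hK1 : 1 ≤ K := by
    rw [hK]; apply Real.one_le_exp
    have : 0 ≤ Real.log 4 := Real.log_nonneg (by norm_num)
    linarith
  obtain ⟨a, ha0, ha1, haα⟩ : ∃ a : ℝ, 0 < a ∧ a ≤ 1 ∧ a ≤ α / 2 :=
    ⟨min 1 (α / 2), by positivity, min_le_left _ _, min_le_right _ _⟩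
  obtain ⟨C1, hC1⟩ : ∃ C1 : ℝ, C1 = K * A * Real.exp 1 * Real.exp A := ⟨_, rfl⟩
  obtain ⟨C3, hC3⟩ : ∃ C3 : ℝ, C3 = (4 * K * c) ^ d := ⟨_, rfl⟩
  have hC10 : 0 < C1 := by rw [hC1]; positivity
  have hC31 : 1 ≤ C3 := by rw [hC3]; exact one_le_pow₀ (by nlinarith)
  obtain ⟨n, hn⟩ := exists_nat_ge (4 * (C1 * C3))
  obtain ⟨c1, hc1'⟩ : ∃ c1 : ℝ, c1 = n.factorial * (A : ℝ) ^ n := ⟨_, rfl⟩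
  obtain ⟨c2, hc2'⟩ : ∃ c2 : ℝ, c2 = (n + 1) * n.factorial * 2 ^ n * (A : ℝ) ^ n := ⟨_, rfl⟩
  have hn1 : (1 : ℝ) ≤ n.factorial := by exact_mod_cast n.factorial_pos
  have hAn1 : (1 : ℝ) ≤ (A : ℝ) ^ n := one_le_pow₀ hA1'
  have hc11 : 0 < c1 := by rw [hc1']; positivity
  have hc21 : 1 ≤ c2 := by
    rw [hc2']
    have h2n : (1 : ℝ) ≤ 2 ^ n := one_le_pow₀ (by norm_num)
    have hnn : (1 : ℝ) ≤ n + 1 := by linarith [(Nat.cast_nonneg n : (0 : ℝ) ≤ n)]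
    exact one_le_mul_of_one_le_of_one_le (one_le_mul_of_one_le_of_one_le
      (one_le_mul_of_one_le_of_one_le hnn hn1) h2n) hAn1
  obtain ⟨c3, hc3'⟩ : ∃ c3 : ℝ, c3 = (c * c2) ^ d := ⟨_, rfl⟩
  have hc30 : 0 < c3 := by rw [hc3']; positivity
  obtain ⟨G, hG⟩ : ∃ G : ℝ, G = Real.exp A := ⟨_, rfl⟩
  have hG1 : 1 ≤ G := by rw [hG]; exact Real.one_le_exp (by positivity)
  obtain ⟨c4, hc4'⟩ : ∃ c4 : ℝ, c4 = c2 * G := ⟨_, rfl⟩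
  obtain ⟨C4, hC4⟩ : ∃ C4 : ℝ, C4 = 4 * K * (4 * G) := ⟨_, rfl⟩
  have hc40 : 0 < c4 := by rw [hc4']; positivity
  have hC41 : 1 ≤ C4 := by rw [hC4]; nlinarith
  obtain ⟨b, hb⟩ : ∃ b : ℝ, b = 2 * (n + 1) / a := ⟨_, rfl⟩
  have hb1 : 1 ≤ b := by
    rw [hb, le_div_iff₀ ha0]
    linarith [(Nat.cast_nonneg n : (0 : ℝ) ≤ n)]
  obtain ⟨T0, hT0⟩ : ∃ T0 : ℝ, T0 = 2 * C3 * C4 * b := ⟨_, rfl⟩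
  have hT01 : 1 ≤ T0 := by
    rw [hT0]
    exact one_le_mul_of_one_le_of_one_le (one_le_mul_of_one_le_of_one_le (by linarith) hC41) hb1
  obtain ⟨W, hW⟩ : ∃ W : ℝ, W = 2 * (c3 * c4) + c4 * b ^ (n + 1) := ⟨_, rfl⟩
  refine ⟨W, T0 ^ ((d + 1) * (n + 1)), a, 2 * (c1 * c3), by rw [hW]; positivity,
    one_le_pow₀ hT01, ha0, ?_⟩
  intro q p u hq hQ0 hqu hclose
  set δ := |α - (p : ℝ) / q| with hδ
  have hδ0 : 0 ≤ δ := abs_nonneg _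
  set z := (p : ℝ) / q with hz
  have hzlo : a ≤ z := by
    have := (abs_le.1 hclose).2
    linarith
  have hzhi : z ≤ A := by
    have := (abs_le.1 hclose).1
    linarith
  set m := (d + 1) * u with hm
  obtain ⟨F, hF1, hF2, hF3, hF4⟩ := exists_poly' A m n p q a K hK hA1 ha0 ha1 hq hzlo hzhi
  rw [← hz, ← hC1, ← hc1'] at hF3
  rw [← hz] at hF4
  rw [← hc2'] at hF2
  set X := m * (n + 1) with hX
  have hqR : (1 : ℝ) ≤ q := by exact_mod_cast hq
  have hquR : (q : ℝ) ≤ 2 ^ u := by exact_mod_cast hqu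
  have hmX : m ≤ X := Nat.le_mul_of_pos_right _ (by omega)
  have huX : u ≤ X := (Nat.le_mul_of_pos_left _ (by omega)).trans hmX
  have hqX : (q : ℝ) ^ (n * (d + 1)) ≤ 2 ^ X :=
    calc (q : ℝ) ^ (n * (d + 1)) ≤ (2 ^ u) ^ (n * (d + 1)) := by gcongr
      _ = 2 ^ (m * n) := by rw [← pow_mul, hm]; congr 1; ring
      _ ≤ 2 ^ X := pow_le_pow_right₀ (by norm_num) (by rw [hX]; gcongr; omega)
  have hqnX : (q : ℝ) ^ n ≤ 2 ^ X :=
    (pow_le_pow_right₀ hqR (Nat.le_mul_of_pos_right _ (by omega))).trans hqX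
  have hTX : (T0 ^ ((d + 1) * (n + 1))) ^ u = T0 ^ X := by
    rw [← pow_mul, hX, hm]; congr 1; ring
  rw [hTX]
  -- the difference
  have hx : |Real.exp z| ≤ G := by
    rw [abs_of_pos (Real.exp_pos _), hG]; exact Real.exp_le_exp.2 hzhi
  have hy : |Real.exp α| ≤ G := by
    rw [abs_of_pos (Real.exp_pos _), hG]; exact Real.exp_le_exp.2 (by linarith)
  have hexp : |Real.exp α - Real.exp z| ≤ G * δ := by
    exact exp_diff A G α z hG (by linarith) hzhi
  have hdiff := poly_diff m F _ G (Real.exp α) (Real.exp z) hG1 hF1 hF2 hy hx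
  have hdiff' : |Polynomial.aeval (Real.exp α) F - Polynomial.aeval (Real.exp z) F| ≤
      c4 * (q : ℝ) ^ n * C4 ^ X * δ := by
    refine hdiff.trans ?_
    have h4G : (4 * G) ^ m ≤ (4 * G) ^ X := pow_le_pow_right₀ (by linarith) hmX
    calc c2 * (q : ℝ) ^ n * (4 * K) ^ X * (4 * G) ^ m * |Real.exp α - Real.exp z|
        ≤ c2 * (q : ℝ) ^ n * (4 * K) ^ X * (4 * G) ^ X * (G * δ) := by gcongr
      _ = _ := by rw [hc4', hC4, mul_pow (4 * K)]; ring
  have hFx0 : 0 ≤ Polynomial.aeval (Real.exp z) F := le_trans (by positivity) hF4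
  by_cases hzero : Polynomial.aeval (Real.exp α) F = 0
  · rw [hzero, zero_sub, abs_neg, abs_of_nonneg hFx0] at hdiff'
    have h1 := hF4.trans hdiff'
    have hab : (a / (2 * (n + 1 : ℝ))) * b = 1 := by rw [hb]; field_simp
    calc (1 : ℝ) = (a / (2 * (n + 1 : ℝ))) ^ (X + (n + 1)) * b ^ (X + (n + 1)) := by
          rw [← mul_pow, hab, one_pow]
      _ ≤ (c4 * (q : ℝ) ^ n * C4 ^ X * δ) * b ^ (X + (n + 1)) := by gcongr
      _ ≤ (c4 * 2 ^ X * C4 ^ X * δ) * b ^ (X + (n + 1)) := by gcongr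
      _ = c4 * b ^ (n + 1) * (2 * 1 * C4 * b) ^ X * δ := by
          rw [pow_add, mul_pow, mul_pow, mul_pow]; ring
      _ ≤ W * T0 ^ X * δ := by
          rw [hW, hT0]
          gcongr
          have : 0 < c3 * c4 := by positivity
          linarith
  · have h1 := hd m F (c2 * (q : ℝ) ^ n * (4 * K) ^ X) ?_ hF1 hF2 hzero
    · have hP : (c ^ (m + 1) * (c2 * (q : ℝ) ^ n * (4 * K) ^ X)) ^ d ≤ c3 * (q : ℝ) ^ (n * d) * C3 ^ X := by
        have : c ^ (m + 1) ≤ c ^ X * c := by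
          rw [← pow_succ]; exact pow_le_pow_right₀ hc1 (by omega)
        calc (c ^ (m + 1) * (c2 * (q : ℝ) ^ n * (4 * K) ^ X)) ^ d
            ≤ (c ^ X * c * (c2 * (q : ℝ) ^ n * (4 * K) ^ X)) ^ d := by gcongr
          _ = ((c * c2) * (q : ℝ) ^ n * (4 * K * c) ^ X) ^ d := by
            rw [mul_pow (4 * K)]; ring
          _ = _ := by
            rw [mul_pow, mul_pow, hc3', hC3, ← pow_mul, ← pow_mul, ← pow_mul, mul_comm X d]
      have hFb : |Polynomial.aeval (Real.exp α) F| ≤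
          c1 * (q : ℝ) ^ n * (C1 / (n + 1)) ^ X + c4 * (q : ℝ) ^ n * C4 ^ X * δ := by
        have h5 := abs_sub_abs_le_abs_sub (Polynomial.aeval (Real.exp α) F) (Polynomial.aeval (Real.exp z) F)
        rw [abs_of_nonneg hFx0] at h5
        linarith
      have h2 : (1 : ℝ) ≤ (c1 * (q : ℝ) ^ n * (C1 / (n + 1)) ^ X + c4 * (q : ℝ) ^ n * C4 ^ X * δ) *
          (c3 * (q : ℝ) ^ (n * d) * C3 ^ X) :=
        h1.trans (mul_le_mul hFb hP (by positivity) (by positivity))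
      have e1 : (c1 * (q : ℝ) ^ n * (C1 / (n + 1)) ^ X) * (c3 * (q : ℝ) ^ (n * d) * C3 ^ X) ≤ 1 / 2 := by
        have hs : C1 * C3 / (n + 1) ≤ 1 / 4 := by
          rw [div_le_iff₀ (by positivity)]; linarith
        have h2X : 2 * (c1 * c3) ≤ 2 ^ X :=
          calc 2 * (c1 * c3) ≤ q := hQ0
            _ ≤ 2 ^ u := hquR
            _ ≤ 2 ^ X := pow_le_pow_right₀ (by norm_num) huX
        calc (c1 * (q : ℝ) ^ n * (C1 / (n + 1)) ^ X) * (c3 * (q : ℝ) ^ (n * d) * C3 ^ X)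
            = (c1 * c3) * (q : ℝ) ^ (n * (d + 1)) * (C1 * C3 / (n + 1)) ^ X := by
              rw [mul_add, pow_add, mul_one, div_pow, div_pow, mul_pow]; ring
          _ ≤ (2 ^ X / 2) * 2 ^ X * (1 / 4) ^ X := by
              gcongr
              linarith
          _ = (1 / 2) * (2 * 2 * (1 / 4)) ^ X := by
              rw [mul_pow, mul_pow]; ring
          _ = 1 / 2 := by norm_num
      have e2 : (c4 * (q : ℝ) ^ n * C4 ^ X * δ) * (c3 * (q : ℝ) ^ (n * d) * C3 ^ X) ≤
          (c3 * c4) * (2 * C3 * C4 * 1) ^ X * δ := by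
        calc (c4 * (q : ℝ) ^ n * C4 ^ X * δ) * (c3 * (q : ℝ) ^ (n * d) * C3 ^ X)
            = (c3 * c4) * ((q : ℝ) ^ (n * (d + 1)) * C3 ^ X * C4 ^ X) * δ := by
              rw [mul_add, pow_add, mul_one]; ring
          _ ≤ (c3 * c4) * (2 ^ X * C3 ^ X * C4 ^ X) * δ := by gcongr
          _ = _ := by rw [mul_one, mul_pow, mul_pow]
      calc (1 : ℝ) ≤ (2 * (c3 * c4)) * (2 * C3 * C4 * 1) ^ X * δ := by linarith
        _ ≤ W * T0 ^ X * δ := by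
          rw [hW, hT0]
          gcongr
          have : 0 < c4 * b ^ (n + 1) := by positivity
          linarith
    · exact one_le_mul_of_one_le_of_one_le (one_le_mul_of_one_le_of_one_le hc21 (one_le_pow₀ hqR))
        (one_le_pow₀ (by linarith))

lemma exp_pos_transc (α : ℝ) (hα : 0 < α) (hL : Liouville α) : ¬ IsAlgebraic ℚ (Real.exp α) := by
  intro halg
  obtain ⟨W, T, ε, Q₀, hW, hT, hε, h⟩ := core α hα halg
  obtain ⟨M, hM⟩ := pow_unbounded_of_one_lt T (by norm_num : (1 : ℝ) < 2)
  obtain ⟨N1, hN1⟩ := exists_nat_ge (max (max Q₀ (1 / ε)) (max (W * 2 ^ M) (1 / α)))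
  have hf := (hL.frequently_exists_num (M + 1)).and_eventually (Filter.eventually_ge_atTop (N1 + 2))
  obtain ⟨q, ⟨p', _, hp'⟩, hq⟩ := hf.exists
  have hq2 : (2 : ℝ) ≤ q := by exact_mod_cast (by omega : 2 ≤ q)
  have hqN : max (max Q₀ (1 / ε)) (max (W * 2 ^ M) (1 / α)) ≤ q :=
    hN1.trans (by exact_mod_cast (by omega : N1 ≤ q))
  simp only [max_le_iff] at hqN
  obtain ⟨⟨hqQ, hqε⟩, hqW, hqα⟩ := hqN
  have hq0 : (0 : ℝ) < q := by linarith
  have hpow : 1 / (q : ℝ) ^ (M + 1) ≤ 1 / q := by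
    apply one_div_le_one_div_of_le hq0
    exact le_self_pow₀ (by linarith) (by omega)
  have hle : |α - p' / q| < 1 / q := hp'.trans_le hpow
  have hqε' : 1 / (q : ℝ) ≤ ε := by
    rw [div_le_iff₀ hε] at hqε
    rw [div_le_iff₀ hq0]; linarith
  have hqα' : 1 / (q : ℝ) ≤ α := by
    rw [div_le_iff₀ hα] at hqα
    rw [div_le_iff₀ hq0]; linarith
  have hp0 : 0 ≤ p' := by
    have h1 := (abs_lt.1 hle).2
    have h2 : (0 : ℝ) < p' / q := by linarith
    have h3 : (0 : ℝ) < p' := by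
      rwa [lt_div_iff₀ hq0, zero_mul] at h2
    exact_mod_cast h3.le
  obtain ⟨p, rfl⟩ := Int.eq_ofNat_of_zero_le hp0
  simp only [Int.cast_natCast] at hp' hle
  have h1 := h q p (Nat.clog 2 q) (by omega) hqQ (Nat.le_pow_clog (by norm_num) q) (hle.le.trans hqε')
  have hu : ((2 : ℝ) ^ (Nat.clog 2 q)) ≤ 2 * q := by
    have h2 := Nat.pow_pred_clog_lt_self (b := 2) (by norm_num) (by omega : 1 < q)
    have h3 : 0 < Nat.clog 2 q := Nat.clog_pos (by norm_num) (by omega)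
    have h4 : 2 ^ (Nat.clog 2 q) ≤ 2 * q := by
      obtain ⟨v, hv⟩ : ∃ v, Nat.clog 2 q = v + 1 := ⟨_, (Nat.succ_pred_eq_of_pos h3).symm⟩
      rw [hv] at h2 ⊢
      rw [Nat.pred_succ] at h2
      rw [pow_succ]; omega
    exact_mod_cast h4
  have hTu : T ^ (Nat.clog 2 q) ≤ 2 ^ M * (q : ℝ) ^ M :=
    calc T ^ (Nat.clog 2 q) ≤ ((2 : ℝ) ^ M) ^ (Nat.clog 2 q) := by gcongr
      _ = ((2 : ℝ) ^ (Nat.clog 2 q)) ^ M := by rw [← pow_mul, ← pow_mul, mul_comm]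
      _ ≤ (2 * q) ^ M := by gcongr
      _ = _ := by rw [mul_pow]
  have : (1 : ℝ) < 1 :=
    calc 1 ≤ W * T ^ (Nat.clog 2 q) * |α - (p : ℝ) / q| := h1
      _ < W * T ^ (Nat.clog 2 q) * (1 / (q : ℝ) ^ (M + 1)) := by
        have : 0 < T := by linarith
        gcongr
      _ ≤ W * (2 ^ M * (q : ℝ) ^ M) * (1 / (q : ℝ) ^ (M + 1)) := by gcongr
      _ = W * 2 ^ M / q := by rw [pow_succ]; field_simp
      _ ≤ 1 := by rw [div_le_one hq0]; exact hqW
  exact lt_irrefl _ this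

lemma exp_alg_of_cosh (α : ℝ) (h : IsAlgebraic ℚ (Real.cosh α)) : IsAlgebraic ℚ (Real.exp α) := by
  have h2 : IsIntegral ℚ (Real.cosh α ^ 2 - 1) := (h.isIntegral.pow 2).sub isIntegral_one
  have h3 : IsIntegral ℚ (Real.sinh α) := by
    apply IsIntegral.of_pow (n := 2) (by norm_num)
    rwa [Real.sinh_sq]
  rw [← Real.cosh_add_sinh]
  exact (h.isIntegral.add h3).isAlgebraic

theorem liouville_cosh_transcendental (α : ℝ) (h : Liouville α) :
    Transcendental ℚ (Real.cosh α) := by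
  intro halg
  rcases lt_trichotomy α 0 with h0 | h0 | h0
  · have hneg : Liouville (-α) := by
      intro n
      obtain ⟨a, b, hb, hne, hlt⟩ := h n
      refine ⟨-a, b, hb, ?_, ?_⟩
      · intro e; apply hne; push_cast at e; rw [neg_div] at e; linarith
      · push_cast
        rw [neg_div, neg_sub_neg, abs_sub_comm]; exact hlt
    rw [← Real.cosh_neg] at halg
    exact exp_pos_transc (-α) (by linarith) hneg (exp_alg_of_cosh _ halg)
  · subst h0
    exact h.irrational ⟨0, by simp⟩
  · exact exp_pos_transc α h0 h (exp_alg_of_cosh _ halg)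
end

section
/- If α is a Liouville number, then tanh α is transcendental. -/
namespace LT
open Finset PowerSeries

/-- The inverse of `b + X`. -/
noncomputable def invX (b : ℚ) : ℚ⟦X⟧ := PowerSeries.mk fun i => (-1) ^ i / b ^ (i + 1)

lemma invX_mul {b : ℚ} (hb : b ≠ 0) : (C b + X) * invX b = 1 := by
  ext n
  rw [add_mul, map_add, coeff_C_mul]
  cases n with
  | zero => simp [invX, hb]
  | succ n =>
    rw [coeff_succ_X_mul]
    simp only [invX, coeff_mk, coeff_one]
    simp
    field_simp
    ring

variable {ι : Type} [Fintype ι] [DecidableEq ι]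

noncomputable def G (a : ι → ℚ) (ν : ι → ℕ) (k : ι) : ℚ⟦X⟧ :=
  ∏ j ∈ univ.erase k, invX (a k - a j) ^ ν j

noncomputable def term (a : ι → ℚ) (ν : ι → ℕ) (k : ι) (f : ℚ⟦X⟧) : ℚ :=
  coeff (ν k) (X * f * G a ν k)

lemma term_step (a : ι → ℚ) (ha : Function.Injective a) (ν : ι → ℕ) (j k : ι) (f : ℚ⟦X⟧) :
    term a (ν + Pi.single j 1) k (f * (C (a k - a j) + X)) = term a ν k f := by
  unfold term
  by_cases hk : k = j
  · subst hk
    have : G a (ν + Pi.single k 1) k = G a ν k := by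
      unfold G
      apply prod_congr rfl
      intro i hi
      have : i ≠ k := (mem_erase.1 hi).1
      simp [this]
    rw [this]
    simp only [Pi.add_apply, Pi.single_eq_same, sub_self, map_zero, zero_add]
    rw [show X * (f * X) * G a ν k = X * (X * f * G a ν k) by ring, coeff_succ_X_mul]
  · have h1 : G a (ν + Pi.single j 1) k = invX (a k - a j) * G a ν k := by
      unfold G
      have hj : j ∈ univ.erase k := by simp [Ne.symm hk]
      rw [← mul_prod_erase _ _ hj, ← mul_prod_erase (univ.erase k) (fun j => invX (a k - a j) ^ ν j) hj]
      rw [← mul_assoc, ← pow_succ']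
      congr 1
      · simp
      · apply prod_congr rfl
        intro i hi
        have : i ≠ j := (mem_erase.1 hi).1
        simp [this]
    have h2 := invX_mul (b := a k - a j) (sub_ne_zero.2 (fun h => hk (ha h)))
    rw [h1, show X * (f * (C (a k - a j) + X)) * (invX (a k - a j) * G a ν k)
      = X * f * G a ν k * ((C (a k - a j) + X) * invX (a k - a j)) by ring, h2]
    simp [hk]

lemma term_add (a : ι → ℚ) (ν : ι → ℕ) (k : ι) (f g : ℚ⟦X⟧) :
    term a ν k (f + g) = term a ν k f + term a ν k g := by
  simp [term, mul_add, add_mul]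

lemma term_C_mul (a : ι → ℚ) (ν : ι → ℕ) (k : ι) (c : ℚ) (f : ℚ⟦X⟧) :
    term a ν k (C c * f) = c * term a ν k f := by
  unfold term
  rw [show X * (C c * f) * G a ν k = C c * (X * f * G a ν k) by ring, coeff_C_mul]

noncomputable def rho (a : ι → ℚ) (ν : ι → ℕ) (t : ℕ) : ℚ :=
  ∑ k, term a ν k ((C (a k) + X) ^ t)

lemma rho_succ (a : ι → ℚ) (ha : Function.Injective a) (ν : ι → ℕ) (j : ι) (t : ℕ) :
    rho a (ν + Pi.single j 1) (t + 1) = rho a ν t + a j * rho a (ν + Pi.single j 1) t := by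
  unfold rho
  rw [mul_sum, ← sum_add_distrib]
  apply sum_congr rfl
  intro k _
  rw [← term_C_mul, ← term_step a ha ν j k, ← term_add]
  congr 1
  rw [pow_succ, map_sub]
  ring

lemma rho_zero_diff (a : ι → ℚ) (ha : Function.Injective a) (ν : ι → ℕ) (i j : ι) :
    (a j - a i) * rho a (ν + Pi.single i 1 + Pi.single j 1) 0 =
      rho a (ν + Pi.single j 1) 0 - rho a (ν + Pi.single i 1) 0 := by
  have h1 := rho_succ a ha (ν + Pi.single i 1) j 0
  have h2 := rho_succ a ha (ν + Pi.single j 1) i 0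
  rw [add_right_comm] at h2
  rw [h1] at h2
  linarith

lemma exists_add_single (ν : ι → ℕ) (i : ι) (h : ν i ≠ 0) : ∃ ν' : ι → ℕ, ν = ν' + Pi.single i 1 := by
  refine ⟨Function.update ν i (ν i - 1), ?_⟩
  ext k
  by_cases hk : k = i
  · subst hk; simp; omega
  · simp [hk]

lemma sum_add_single (ν : ι → ℕ) (i : ι) : ∑ k, (ν + Pi.single i 1 : ι → ℕ) k = ∑ k, ν k + 1 := by
  simp [sum_add_distrib]

lemma rho_zero (a : ι → ℚ) (ha : Function.Injective a) (N : ℕ) : ∀ ν : ι → ℕ, ∑ k, ν k = N →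
    rho a ν 0 = if N = 1 then 1 else 0 := by
  induction N with
  | zero =>
    intro ν h
    have h0 : ∀ k, ν k = 0 := by simpa using h
    simp [rho, term, h0]
  | succ N ih =>
    intro ν h
    by_cases hk : ∃ i j, i ≠ j ∧ ν i ≠ 0 ∧ ν j ≠ 0
    · obtain ⟨i, j, hij, hi, hj⟩ := hk
      obtain ⟨ν1, rfl⟩ := exists_add_single ν j hj
      have hi' : ν1 i ≠ 0 := by simpa [hij] using hi
      obtain ⟨ν2, rfl⟩ := exists_add_single ν1 i hi'
      have h1 := rho_zero_diff a ha ν2 i j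
      rw [sum_add_single, sum_add_single] at h
      rw [ih (ν2 + Pi.single j 1) (by rw [sum_add_single]; omega),
        ih (ν2 + Pi.single i 1) (by rw [sum_add_single]; omega), sub_self] at h1
      have h3 : a j - a i ≠ 0 := sub_ne_zero.2 (fun h => hij (ha h).symm)
      rw [if_neg (by omega)]
      simpa [h3] using h1
    · push Not at hk
      have : ∃ i, ν i ≠ 0 := by
        by_contra! h0
        simp [h0] at h
      obtain ⟨i, hi⟩ := this
      have h0 : ∀ j, j ≠ i → ν j = 0 := fun j hj => hk i j hj.symm hi
      have hs : ν i = N + 1 := by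
        rw [← h]; symm; apply sum_eq_single i (fun j _ hj => h0 j hj) (by simp)
      unfold rho
      rw [sum_eq_single i (fun j _ hj => by simp [term, h0 j hj]) (by simp)]
      have : G a ν i = 1 := by
        unfold G
        apply prod_eq_one
        intro j hj
        rw [h0 j (mem_erase.1 hj).1, pow_zero]
      rw [term, this, hs]
      simp [coeff_X]

lemma rho_of_sum_zero (a : ι → ℚ) (ν : ι → ℕ) (h : ∑ k, ν k = 0) (t : ℕ) : rho a ν t = 0 := by
  have h0 : ∀ k, ν k = 0 := by simpa using h
  simp [rho, term, h0, mul_assoc]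

lemma rho_bound (a : ι → ℚ) (ha : Function.Injective a) (M : ℚ) (hM : 0 < M)
    (ham : ∀ i, |a i| ≤ M) (t : ℕ) : ∀ (N : ℕ) (ν : ι → ℕ), ∑ k, ν k = N + 1 →
    |rho a ν t| * M ^ N ≤ (t.choose N) * M ^ t := by
  induction t with
  | zero =>
    intro N ν h
    rw [rho_zero a ha _ ν h]
    cases N <;> simp
  | succ t ih =>
    intro N ν h
    have : ∃ i, ν i ≠ 0 := by
      by_contra! h0
      simp [h0] at h
    obtain ⟨i, hi⟩ := this
    have h2 := ih N ν h
    obtain ⟨ν, rfl⟩ := exists_add_single ν i hi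
    rw [rho_succ a ha]
    rw [sum_add_single] at h
    have h3 : |rho a ν t + a i * rho a (ν + Pi.single i 1) t| ≤
        |rho a ν t| + M * |rho a (ν + Pi.single i 1) t| := by
      refine (abs_add_le _ _).trans ?_
      rw [abs_mul]
      gcongr
      exact ham i
    have h4 : |rho a ν t| * M ^ N + M * ((t.choose N) * M ^ t) ≤ ((t+1).choose N) * M ^ (t + 1) := by
      cases N with
      | zero =>
        rw [rho_of_sum_zero a ν (by omega)]
        simp [pow_succ, mul_comm]
      | succ N =>
        have := ih N ν (by omega)
        rw [Nat.choose_succ_succ]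
        push_cast
        rw [pow_succ, pow_succ]
        nlinarith
    calc _ ≤ (|rho a ν t| + M * |rho a (ν + Pi.single i 1) t|) * M ^ N := by gcongr
      _ = |rho a ν t| * M ^ N + M * (|rho a (ν + Pi.single i 1) t| * M ^ N) := by ring
      _ ≤ |rho a ν t| * M ^ N + M * ((t.choose N) * M ^ t) := by gcongr
      _ ≤ _ := h4

noncomputable def A (a : ι → ℚ) (ν : ι → ℕ) (k : ι) : Polynomial ℚ :=
  ∑ i ∈ range (ν k), Polynomial.monomial i (coeff (ν k) (X ^ (i + 1) * G a ν k) / i.factorial)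

lemma A_coeff (a : ι → ℚ) (ν : ι → ℕ) (k : ι) (i : ℕ) :
    (A a ν k).coeff i = coeff (ν k) (X ^ (i + 1) * G a ν k) / i.factorial := by
  simp only [A, Polynomial.finsetSum_coeff, Polynomial.coeff_monomial]
  rw [sum_ite_eq' (range (ν k)) i]
  split_ifs with h
  · rfl
  · rw [coeff_X_pow_mul', if_neg (by simp at h; omega)]; simp

lemma A_natDegree (a : ι → ℚ) (ν : ι → ℕ) (k : ι) (n : ℕ) (h : ν k ≤ n + 1) :
    (A a ν k).natDegree ≤ n := by
  rw [Polynomial.natDegree_le_iff_coeff_eq_zero]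
  intro i hi
  rw [A_coeff, coeff_X_pow_mul', if_neg (by omega)]; simp

lemma coeff_R (a : ι → ℚ) (ν : ι → ℕ) (t : ℕ) :
    coeff t (∑ k, (A a ν k : ℚ⟦X⟧) * rescale (a k) (PowerSeries.exp ℚ)) = rho a ν t / t.factorial := by
  rw [map_sum, rho, sum_div]
  apply sum_congr rfl
  intro k _
  rw [term, add_comm (C (a k)), add_pow, mul_sum, sum_mul, map_sum, coeff_mul,
    Nat.sum_antidiagonal_eq_sum_range_succ_mk, sum_div]
  apply sum_congr rfl
  intro i hi
  have hi : i ≤ t := by simpa [Nat.lt_succ_iff] using hi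
  have e : X * (X ^ i * C (a k) ^ (t - i) * ((t.choose i : ℕ) : ℚ⟦X⟧)) * G a ν k
    = C (a k ^ (t - i) * (t.choose i : ℚ)) * (X ^ (i + 1) * G a ν k) := by
    simp only [map_mul, map_pow, map_natCast]
    ring
  rw [e, coeff_C_mul]
  simp only [Polynomial.coeff_coe, A_coeff, coeff_rescale, coeff_exp]
  have := Nat.choose_mul_factorial_mul_factorial hi
  have h2 : ((t.choose i : ℕ) : ℚ) * i.factorial * (t - i).factorial = t.factorial := by exact_mod_cast this
  have h3 : (i.factorial : ℚ) ≠ 0 := by positivity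
  have h4 : ((t-i).factorial : ℚ) ≠ 0 := by positivity
  rw [← h2]
  have h5 : ((t.choose i : ℕ) : ℚ) ≠ 0 := by
    have := Nat.choose_pos hi
    positivity
  simp
  field_simp

lemma X_pow_dvd_R (a : ι → ℚ) (ha : Function.Injective a) (ν : ι → ℕ) (T : ℕ)
    (h : ∑ k, ν k = T + 1) :
    X ^ T ∣ (∑ k, (A a ν k : ℚ⟦X⟧) * rescale (a k) (PowerSeries.exp ℚ)) := by
  rw [X_pow_dvd_iff]
  intro t ht
  rw [coeff_R]
  obtain ⟨M, hM⟩ := (Set.finite_range (fun i => |a i|)).bddAbove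
  have h1 := rho_bound a ha (max M 1) (by positivity)
    (fun i => (hM ⟨i, rfl⟩).trans (le_max_left _ _)) t T ν h
  rw [Nat.choose_eq_zero_of_lt ht] at h1
  simp only [Nat.cast_zero, zero_mul] at h1
  have h2 : 0 < (max M 1) ^ T := by positivity
  have h3 : |rho a ν t| ≤ 0 := by
    by_contra! h
    have := mul_pos h h2
    linarith
  rw [abs_nonpos_iff.1 h3]; simp

def nu (s : ℕ) (h : ι) : ι → ℕ := (fun _ => s) + Pi.single h 1

lemma sum_nu (s : ℕ) (h : ι) : ∑ k, nu s h k = Fintype.card ι * s + 1 := by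
  rw [nu, sum_add_single]; simp

noncomputable def Mat (a : ι → ℚ) (s : ℕ) : Matrix ι ι (Polynomial ℚ) :=
  Matrix.of fun h k => A a (nu s h) k

lemma nu_le (s : ℕ) (h k : ι) : nu s h k ≤ s + 1 := by
  unfold nu
  by_cases hk : k = h <;> simp [hk]

lemma G_constCoeff (a : ι → ℚ) (ha : Function.Injective a) (ν : ι → ℕ) (k : ι) :
    coeff 0 (G a ν k) ≠ 0 := by
  rw [coeff_zero_eq_constantCoeff_apply, G, map_prod, prod_ne_zero_iff]
  intro j hj
  have : a k - a j ≠ 0 := sub_ne_zero.2 (fun h => (mem_erase.1 hj).1 (ha h).symm)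
  rw [map_pow]
  apply pow_ne_zero
  rw [← coeff_zero_eq_constantCoeff_apply]
  simp [invX, this]

lemma coeff_det (a : ι → ℚ) (ha : Function.Injective a) (s : ℕ) :
    (Mat a s).det.coeff (Fintype.card ι * s) ≠ 0 := by
  have h1 : (Mat a s).det.coeff (Fintype.card ι * s) =
      (Matrix.of fun h k => (Mat a s h k).coeff s).det := by
    rw [Matrix.det_apply, Matrix.det_apply, Polynomial.finsetSum_coeff]
    apply sum_congr rfl
    intro σ _
    rw [Polynomial.coeff_smul]
    congr 1
    have := Polynomial.coeff_prod_of_natDegree_le (s := (univ : Finset ι)) (fun i => Mat a s (σ i) i) s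
      (fun i _ => A_natDegree _ _ _ _ (nu_le _ _ _))
    simpa using this
  rw [h1]
  have h2 : (Matrix.of fun h k => (Mat a s h k).coeff s) =
      Matrix.diagonal (fun h => (Mat a s h h).coeff s) := by
    ext h k
    by_cases hk : h = k
    · subst hk; simp
    · have hk' : k ≠ h := fun h => hk h.symm
      rw [Matrix.diagonal_apply_ne _ hk]
      simp only [Matrix.of_apply, Mat, A_coeff]
      rw [coeff_X_pow_mul', if_neg (by simp [nu, hk'])]; simp
  rw [h2, Matrix.det_diagonal, prod_ne_zero_iff]
  intro h _
  simp only [Mat, Matrix.of_apply, A_coeff]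
  rw [show nu s h h = 0 + (s+1) by simp [nu], coeff_X_pow_mul]
  have := G_constCoeff a ha (nu s h) h
  positivity

lemma det_eq (a : ι → ℚ) (ha : Function.Injective a) (s : ℕ) :
    ∃ c : ℚ, c ≠ 0 ∧ (Mat a s).det = Polynomial.monomial (Fintype.card ι * s) c := by
  refine ⟨_, coeff_det a ha s, ?_⟩
  rcases isEmpty_or_nonempty ι with he | ⟨⟨k0⟩⟩
  · simp
  set T := Fintype.card ι * s with hT
  have hdeg : (Mat a s).det.natDegree ≤ T := by
    rw [Matrix.det_apply]
    apply Polynomial.natDegree_sum_le_of_forall_le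
    intro σ _
    refine (Polynomial.natDegree_smul_le _ _).trans ?_
    refine (Polynomial.natDegree_prod_le _ _).trans ?_
    refine (sum_le_card_nsmul _ _ s (fun i _ => A_natDegree _ _ _ _ (nu_le _ _ _))).trans ?_
    simp [hT]
  have hdvd : (X : ℚ⟦X⟧) ^ T ∣ ((Mat a s).det : ℚ⟦X⟧) := by
    let B : Matrix ι ι ℚ⟦X⟧ := (Mat a s).map Polynomial.coeToPowerSeries.ringHom
    let v : ι → ℚ⟦X⟧ := fun k => rescale (a k) (PowerSeries.exp ℚ)
    have hB : B.det = ((Mat a s).det : ℚ⟦X⟧) := by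
      have := RingHom.map_det Polynomial.coeToPowerSeries.ringHom (Mat a s)
      rw [Polynomial.coeToPowerSeries.ringHom_apply] at this
      rw [this]; rfl
    have h1 : ∀ h, (X : ℚ⟦X⟧) ^ T ∣ (B.mulVec v) h := by
      intro h
      exact X_pow_dvd_R a ha (nu s h) T (sum_nu s h)
    have h2 : B.adjugate.mulVec (B.mulVec v) = B.det • v := by
      rw [Matrix.mulVec_mulVec, Matrix.adjugate_mul, Matrix.smul_mulVec, Matrix.one_mulVec]
    have h3 : (X : ℚ⟦X⟧) ^ T ∣ B.det * v k0 := by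
      have := congrFun h2 k0
      rw [Pi.smul_apply, smul_eq_mul] at this
      rw [← this]
      apply dvd_sum
      intro i _
      exact Dvd.dvd.mul_left (h1 i) _
    have hu : IsUnit (v k0) := by
      rw [isUnit_iff_constantCoeff]
      simp only [v]
      rw [← coeff_zero_eq_constantCoeff_apply, coeff_rescale]
      simp
    rw [← hB]
    exact (hu.dvd_mul_right).1 h3
  rw [X_pow_dvd_iff] at hdvd
  ext i
  rw [Polynomial.coeff_monomial]
  split_ifs with hi
  · rw [hi]
  · rcases lt_or_gt_of_ne hi with h | h
    · exact Polynomial.coeff_eq_zero_of_natDegree_lt (hdeg.trans_lt h)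
    · simpa using hdvd i h

lemma exists_ne (a : ι → ℚ) (ha : Function.Injective a) (s : ℕ) (x : ℚ) (hx : x ≠ 0)
    (w : ι → ℝ) (hw : w ≠ 0) :
    ∃ h, ∑ k, (((A a (nu s h) k).eval x : ℚ) : ℝ) * w k ≠ 0 := by
  by_contra! H
  obtain ⟨c, hc, hdet⟩ := det_eq a ha s
  let f : Polynomial ℚ →+* ℝ := (Rat.castHom ℝ).comp (Polynomial.evalRingHom x)
  have h1 : ((Mat a s).map f).det = f (Mat a s).det := by
    rw [RingHom.map_det]; rfl
  have h2 : ((Mat a s).map f).det ≠ 0 := by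
    rw [h1, hdet]
    simp [f, hc, hx]
  apply hw
  apply Matrix.eq_zero_of_mulVec_eq_zero h2
  ext h
  exact H h

end LT

namespace LT
open Finset PowerSeries
variable {ι : Type} [Fintype ι] [DecidableEq ι]

lemma hasSum_poly_mul (P : Polynomial ℚ) (f : ℚ⟦X⟧) (z F : ℝ)
    (hf : HasSum (fun t => ((coeff t f : ℚ) : ℝ) * z ^ t) F) :
    HasSum (fun t => ((coeff t ((P : ℚ⟦X⟧) * f) : ℚ) : ℝ) * z ^ t) (Polynomial.aeval z P * F) := by
  induction P using Polynomial.induction_on with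
  | C a =>
    simp only [Polynomial.coe_C, coeff_C_mul, Polynomial.aeval_C]
    have := hf.mul_left (a : ℝ)
    simpa [mul_assoc] using this
  | add p q hp hq =>
    have := hp.add hq
    simpa [add_mul] using this
  | monomial n a ih =>
    have e : ((Polynomial.C a * Polynomial.X ^ (n + 1) : Polynomial ℚ) : ℚ⟦X⟧) * f =
      X * (((Polynomial.C a * Polynomial.X ^ n : Polynomial ℚ) : ℚ⟦X⟧) * f) := by
      simp only [Polynomial.coe_mul, Polynomial.coe_pow, Polynomial.coe_X]
      ring
    rw [e]
    have h1 := ih.mul_left z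
    have e2 : (fun i => z * (((coeff i (((Polynomial.C a * Polynomial.X ^ n : Polynomial ℚ) : ℚ⟦X⟧)
        * f) : ℚ) : ℝ) * z ^ i)) = fun i => ((coeff (i + 1) (X * (((Polynomial.C a *
        Polynomial.X ^ n : Polynomial ℚ) : ℚ⟦X⟧) * f)) : ℚ) : ℝ) * z ^ (i + 1) := by
      funext t
      rw [coeff_succ_X_mul]
      ring
    rw [e2] at h1
    have h2 := (hasSum_nat_add_iff (f := fun i => ((coeff i (X * (((Polynomial.C a *
        Polynomial.X ^ n : Polynomial ℚ) : ℚ⟦X⟧) * f)) : ℚ) : ℝ) * z ^ i) 1).1 h1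
    have e3 : (Polynomial.aeval z) (Polynomial.C a * Polynomial.X ^ (n + 1)) * F =
        z * ((Polynomial.aeval z) (Polynomial.C a * Polynomial.X ^ n) * F) +
        ∑ i ∈ range 1, ((coeff i (X * (((Polynomial.C a *
        Polynomial.X ^ n : Polynomial ℚ) : ℚ⟦X⟧) * f)) : ℚ) : ℝ) * z ^ i := by
      rw [sum_range_one, coeff_zero_X_mul, pow_succ', mul_left_comm, map_mul, Polynomial.aeval_X]
      push_cast
      ring
    rw [e3]
    exact h2

lemma R_bound (a : ι → ℚ) (ha : Function.Injective a) (M : ℚ) (hM : 0 < M)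
    (ham : ∀ i, |a i| ≤ M) (T : ℕ) (ν : ι → ℕ) (hν : ∑ k, ν k = T + 1) (z : ℝ) :
    |∑ k, Polynomial.aeval z (A a ν k) * Real.exp ((a k : ℝ) * z)| ≤
      |z| ^ T / T.factorial * Real.exp ((M : ℝ) * |z|) := by
  have hexp : ∀ x : ℝ, HasSum (fun n : ℕ => x ^ n / n.factorial) (Real.exp x) := by
    intro x
    rw [Real.exp_eq_exp_ℝ]
    exact NormedSpace.expSeries_div_hasSum_exp x
  have h1 : HasSum (fun t : ℕ => ((rho a ν t / t.factorial : ℚ) : ℝ) * z ^ t)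
      (∑ k, Polynomial.aeval z (A a ν k) * Real.exp ((a k : ℝ) * z)) := by
    have : ∀ k ∈ (univ : Finset ι), HasSum (fun t => ((coeff t ((A a ν k : ℚ⟦X⟧) *
        rescale (a k) (PowerSeries.exp ℚ)) : ℚ) : ℝ) * z ^ t)
        (Polynomial.aeval z (A a ν k) * Real.exp ((a k : ℝ) * z)) := by
      intro k _
      apply hasSum_poly_mul
      convert hexp ((a k : ℝ) * z) using 1
      ext t
      simp [coeff_rescale, coeff_exp, mul_pow]
      ring
    have := hasSum_sum this
    convert this using 1
    ext t
    rw [← coeff_R, map_sum, ← sum_mul]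
    push_cast
    rfl
  have hMr : (0 : ℝ) < M := by exact_mod_cast hM
  let g : ℕ → ℝ := fun t => (t.choose T : ℝ) * M ^ t / M ^ T / t.factorial * |z| ^ t
  have h2 : HasSum g (|z| ^ T / T.factorial * Real.exp ((M : ℝ) * |z|)) := by
    have h3 := (hexp (M * |z|)).mul_left (|z| ^ T / T.factorial)
    have hinj : Function.Injective (fun t : ℕ => t + T) := add_left_injective T
    rw [← hinj.hasSum_iff]
    · have e0 : g ∘ (fun t : ℕ => t + T) = fun t : ℕ => |z| ^ T / T.factorial * ((M * |z|) ^ t / t.factorial) := by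
        funext t
        simp only [g, Function.comp]
        have h5 := Nat.add_choose_mul_factorial_mul_factorial t T
        have h4 : ((t + T).choose T : ℝ) * t.factorial * T.factorial = (t + T).factorial := by
          rw [← h5]; push_cast; ring_nf
        have h6 : ((t + T).choose T : ℝ) ≠ 0 := by
          have := Nat.choose_pos (Nat.le_add_left T t)
          positivity
        rw [← h4]
        rw [pow_add, pow_add, mul_pow]
        field_simp
      rw [e0]
      exact h3
    · intro t ht
      have : t < T := by
        by_contra! hh
        exact ht ⟨t - T, by simp; omega⟩
      simp [g, Nat.choose_eq_zero_of_lt this]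
  rw [← h1.tsum_eq]
  rw [← Real.norm_eq_abs]
  refine tsum_of_norm_bounded h2 ?_
  intro t
  have h3 := rho_bound a ha M hM ham t T ν hν
  have h4 : |(rho a ν t : ℝ)| * M ^ T ≤ (t.choose T) * M ^ t := by exact_mod_cast h3
  rw [Real.norm_eq_abs, abs_mul, abs_pow]
  simp only [g]
  gcongr
  push_cast
  rw [abs_div, Nat.abs_cast]
  gcongr
  rw [le_div_iff₀ (by positivity)]
  exact h4

def Nice (L b : ℤ) (M : ℕ) (g : ℚ⟦X⟧) : Prop :=
  ∀ i, (∃ z : ℤ, (b : ℚ) * L ^ i * coeff i g = z) ∧ |(b : ℚ) * coeff i g| ≤ 2 ^ (i + M)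

lemma nice_one (L : ℤ) : Nice L 1 0 1 := by
  intro i
  rw [coeff_one]
  constructor
  · by_cases hi : i = 0
    · exact ⟨1, by simp [hi]⟩
    · exact ⟨0, by simp [hi]⟩
  · have : (1 : ℚ) ≤ 2 ^ (i + 0) := one_le_pow₀ (by norm_num)
    rw [add_zero] at this ⊢
    split_ifs <;> simp [this]

lemma Nice.mul_invX {L b : ℤ} {M : ℕ} {g : ℚ⟦X⟧} (h : Nice L b M g) {c : ℤ} (hc : c ≠ 0)
    (hcL : c ∣ L) : Nice L (b * c) (M + 1) (g * invX c) := by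
  obtain ⟨d, rfl⟩ := hcL
  have hc' : (c : ℚ) ≠ 0 := by exact_mod_cast hc
  intro i
  rw [coeff_mul, Nat.sum_antidiagonal_eq_sum_range_succ_mk, mul_sum, mul_sum]
  constructor
  · choose z hz using fun i => (h i).1
    refine ⟨∑ l ∈ range (i + 1), z l * ((-1) ^ (i - l) * d ^ (i - l)), ?_⟩
    push_cast
    apply sum_congr rfl
    intro l hl
    have hl : l ≤ i := by simpa [Nat.lt_succ_iff] using hl
    rw [← hz l]
    simp only [invX, coeff_mk]
    push_cast
    obtain ⟨e, rfl⟩ := Nat.exists_eq_add_of_le hl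
    rw [Nat.add_sub_cancel_left]
    field_simp
    ring
  · refine (abs_sum_le_sum_abs _ _).trans ?_
    have : ∀ l ∈ range (i + 1), |((b * c : ℤ) : ℚ) * (coeff l g * coeff (i - l) (invX c))| ≤
        2 ^ M * 2 ^ l := by
      intro l _
      have h1 := (h l).2
      rw [← pow_add, add_comm M]
      refine le_trans ?_ h1
      simp only [invX, coeff_mk]
      have e : ((b * c : ℤ) : ℚ) * (coeff l g * ((-1) ^ (i - l) / (c : ℚ) ^ (i - l + 1))) =
          ((b : ℚ) * coeff l g) * ((-1) ^ (i - l) / (c : ℚ) ^ (i - l)) := by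
        push_cast
        rw [pow_succ]
        field_simp
      rw [e, abs_mul]
      apply mul_le_of_le_one_right (abs_nonneg _)
      rw [abs_div, abs_pow, abs_pow]
      simp only [abs_neg, abs_one, one_pow]
      apply div_le_one_of_le₀ _ (by positivity)
      apply one_le_pow₀
      have : (1 : ℤ) ≤ |c| := Int.one_le_abs hc
      exact_mod_cast this
    refine (sum_le_sum this).trans ?_
    rw [← mul_sum, geom_sum_eq (by norm_num)]
    have h0 : (0:ℚ) < 2 ^ M := by positivity
    rw [show i + (M + 1) = M + (i + 1) by ring, pow_add 2 M]
    gcongr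
    norm_num

lemma Nice.mul_invX_pow {L b : ℤ} {M : ℕ} {g : ℚ⟦X⟧} (h : Nice L b M g) {c : ℤ} (hc : c ≠ 0)
    (hcL : c ∣ L) (n : ℕ) : Nice L (b * c ^ n) (M + n) (g * invX c ^ n) := by
  induction n with
  | zero => simpa using h
  | succ n ih =>
    have := ih.mul_invX hc hcL
    rw [pow_succ, pow_succ, ← mul_assoc, ← mul_assoc, ← add_assoc]
    exact this

lemma nice_prod (L : ℤ) (S : Finset ι) (c : ι → ℤ) (ν : ι → ℕ) (hc : ∀ j ∈ S, c j ≠ 0)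
    (hcL : ∀ j ∈ S, c j ∣ L) :
    Nice L (∏ j ∈ S, c j ^ ν j) (∑ j ∈ S, ν j) (∏ j ∈ S, invX (c j) ^ ν j) := by
  induction S using Finset.induction_on with
  | empty => simpa using nice_one L
  | insert i S hi ih =>
    rw [prod_insert hi, prod_insert hi, sum_insert hi, mul_comm, add_comm, mul_comm (invX _ ^ _)]
    exact (ih (fun j hj => hc j (mem_insert_of_mem hj)) (fun j hj => hcL j (mem_insert_of_mem hj))
      ).mul_invX_pow (hc i (mem_insert_self _ _)) (hcL i (mem_insert_self _ _)) _

lemma prod_abs (m : ℕ) (k : Fin (m + 1)) :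
    |∏ j ∈ univ.erase k, (((k : ℕ) : ℤ) - ((j : ℕ) : ℤ))| = (k : ℕ).factorial * (m - k).factorial := by
  rw [abs_prod]
  have hk : (k : ℕ) ≤ m := Nat.lt_succ_iff.1 k.2
  have h1 : ∏ j ∈ univ.erase k, |((k : ℕ) : ℤ) - ((j : ℕ) : ℤ)| =
      ∏ j ∈ (range (m + 1)).erase k, |((k : ℕ) : ℤ) - (j : ℤ)| := by
    apply prod_bij (fun (j : Fin (m + 1)) _ => (j : ℕ))
    · intro j hj
      have := (mem_erase.1 hj).1
      simp [Fin.val_inj, this]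
      omega
    · intro i _ j _ h; exact Fin.ext h
    · intro j hj
      simp at hj
      exact ⟨⟨j, by omega⟩, by simp [Fin.ext_iff, hj.1], rfl⟩
    · intro j _; rfl
  have h2 : (range (m + 1)).erase (k : ℕ) = range k ∪ Ico ((k : ℕ) + 1) (m + 1) := by
    ext j; simp; omega
  have h3 : Disjoint (range (k : ℕ)) (Ico ((k : ℕ) + 1) (m + 1)) := by
    rw [disjoint_left]; intro j; simp; omega
  rw [h1, h2, prod_union h3]
  congr 1
  · rw [← prod_range_reflect, ← prod_range_add_one_eq_factorial]
    push_cast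
    apply prod_congr rfl
    intro j hj
    have := mem_range.1 hj
    rw [abs_of_nonneg (by omega)]
    omega
  · rw [prod_Ico_eq_prod_range, ← prod_range_add_one_eq_factorial]
    push_cast
    apply prod_congr rfl
    intro j hj
    rw [abs_of_nonpos (by push_cast; omega)]
    push_cast; omega

abbrev pt (m : ℕ) : Fin (m + 1) → ℚ := fun k => ((k : ℕ) : ℚ)

lemma pt_inj (m : ℕ) : Function.Injective (pt m) := by
  intro i j h
  exact Fin.ext (by exact_mod_cast h)

lemma dvd_lcm (m : ℕ) (k j : Fin (m + 1)) (h : j ≠ k) :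
    ((k : ℕ) : ℤ) - ((j : ℕ) : ℤ) ∣ (Nat.lcmUpto m : ℤ) := by
  rw [← Int.natAbs_dvd_natAbs, Int.natAbs_natCast]
  unfold Nat.lcmUpto
  have h' : (j : ℕ) ≠ k := fun e => h (Fin.ext e)
  have h3 : (((k : ℕ) : ℤ) - ((j : ℕ) : ℤ)).natAbs ∈ Icc 1 m := by
    rw [mem_Icc]
    constructor <;> omega
  exact Finset.dvd_lcm (f := id) h3

lemma exists_w (m s : ℕ) (h k : Fin (m + 1)) : ∃ w : ℤ,
    (∏ j ∈ univ.erase k, (((k : ℕ) : ℤ) - ((j : ℕ) : ℤ)) ^ nu s h j) * w =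
      (m.factorial : ℤ) ^ s * Nat.lcmUpto m ∧
    |w| ≤ (2 : ℤ) ^ (m * s) * Nat.lcmUpto m := by
  set L := Nat.lcmUpto m
  have hLpos : 0 < L := Nat.lcmUpto_pos m
  have hk : (k : ℕ) ≤ m := Nat.lt_succ_iff.1 k.2
  set B := ∏ j ∈ univ.erase k, (((k : ℕ) : ℤ) - ((j : ℕ) : ℤ)) with hB
  have hBabs : |B| = (k : ℕ).factorial * (m - k).factorial := prod_abs m k
  have h0 : ∃ w0 : ℤ, B * w0 = m.factorial ∧ |w0| ≤ 2 ^ m := by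
    have h1 : |B| * m.choose k = m.factorial := by
      rw [hBabs]
      have := Nat.choose_mul_factorial_mul_factorial hk
      rw [← this]; push_cast; ring
    have h2 : (m.choose k : ℤ) ≤ 2 ^ m := by exact_mod_cast Nat.choose_le_two_pow m k
    rcases abs_choice B with h | h
    · exact ⟨m.choose k, by rw [← h, h1], by simpa using h2⟩
    · exact ⟨-m.choose k, by rw [← h1, h]; ring, by simpa using h2⟩
  obtain ⟨w0, hw0, hw0'⟩ := h0
  have hc : ∃ c : ℤ, (∏ j ∈ univ.erase k, (((k : ℕ) : ℤ) - ((j : ℕ) : ℤ)) ^ nu s h j) = B ^ s * c ∧ c ∣ L := by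
    refine ⟨∏ j ∈ univ.erase k, (((k : ℕ) : ℤ) - ((j : ℕ) : ℤ)) ^ (Pi.single h 1 : Fin (m + 1) → ℕ) j, ?_, ?_⟩
    · rw [hB, ← prod_pow, ← prod_mul_distrib]
      apply prod_congr rfl
      intro j _
      rw [← pow_add]; rfl
    · by_cases hh : h = k
      · rw [prod_eq_one]
        · simp
        · intro j hj
          have := (mem_erase.1 hj).1
          rw [← hh] at this
          simp [this]
      · rw [prod_eq_single_of_mem h (by simp [hh])]
        · simpa using dvd_lcm m k h hh
        · intro j _ hj
          simp [hj]
  obtain ⟨c, hc, d, hd⟩ := hc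
  refine ⟨w0 ^ s * d, ?_, ?_⟩
  · rw [hc, hd, ← hw0]; ring
  · rw [abs_mul, abs_pow, pow_mul]
    have hd' : |d| ≤ L := by
      have : d ∣ L := ⟨c, by rw [hd]; ring⟩
      rw [← abs_dvd] at this
      exact Int.le_of_dvd (by exact_mod_cast hLpos) this
    gcongr

lemma main_coeff (m s : ℕ) (h k : Fin (m + 1)) (i : ℕ) : ∃ z : ℤ,
    (m.factorial : ℚ) ^ s * (Nat.lcmUpto m : ℚ) ^ (s + 1) * s.factorial *
      (A (pt m) (nu s h) k).coeff i = z ∧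
    |(z : ℚ)| ≤ s.factorial * (Nat.lcmUpto m : ℚ) ^ (s + 1) * 2 ^ (m * s + (s + ((m + 1) * s + 1))) := by
  by_cases hi : nu s h k ≤ i
  · refine ⟨0, ?_, ?_⟩
    · rw [A_coeff, coeff_X_pow_mul', if_neg (by omega)]
      simp
    · simp; positivity
  push Not at hi
  obtain ⟨e, he⟩ := Nat.exists_eq_add_of_lt hi
  have hnu := nu_le s h k
  have hes : e ≤ s := by omega
  have his : i ≤ s := by omega
  obtain ⟨w, hw, hw'⟩ := exists_w m s h k
  set L := Nat.lcmUpto m with hL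
  have hLpos : 0 < L := Nat.lcmUpto_pos m
  set b := ∏ j ∈ univ.erase k, (((k : ℕ) : ℤ) - ((j : ℕ) : ℤ)) ^ nu s h j
  have hn : Nice L b (∑ j ∈ univ.erase k, nu s h j) (G (pt m) (nu s h) k) := by
    have := nice_prod (L : ℤ) (univ.erase k) (fun j => ((k : ℕ) : ℤ) - ((j : ℕ) : ℤ)) (nu s h)
      (fun j hj => by
        have h1 := (mem_erase.1 hj).1
        have h' : (j : ℕ) ≠ k := fun e => h1 (Fin.ext e)
        omega)
      (fun j hj => dvd_lcm m k j (mem_erase.1 hj).1)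
    convert this using 1
    simp [G]
  obtain ⟨⟨z, hz⟩, hb⟩ := hn e
  have hM : ∑ j ∈ univ.erase k, nu s h j ≤ (m + 1) * s + 1 := by
    have h1 := sum_nu s h
    rw [Fintype.card_fin] at h1
    rw [← h1]
    exact sum_le_sum_of_subset (erase_subset _ _)
  obtain ⟨F, hfac⟩ : ∃ F : ℕ, (s.factorial : ℚ) / i.factorial = (F : ℚ) := by
    refine ⟨s.factorial / i.factorial, ?_⟩
    rw [Nat.cast_div (Nat.factorial_dvd_factorial his) (by positivity)]
  have hfac2 : (s.factorial : ℚ) / i.factorial ≤ s.factorial :=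
    div_le_self (by positivity) (by exact_mod_cast Nat.factorial_pos i)
  have hwq : (b : ℚ) * w = (m.factorial : ℚ) ^ s * L := by exact_mod_cast hw
  have hwq' : |(w : ℚ)| ≤ 2 ^ (m * s) * L := by exact_mod_cast hw'
  have hcoef : coeff (nu s h k) (X ^ (i + 1) * G (pt m) (nu s h) k) = coeff e (G (pt m) (nu s h) k) := by
    rw [show nu s h k = e + (i + 1) by omega, coeff_X_pow_mul]
  set g := coeff e (G (pt m) (nu s h) k)
  have key : (m.factorial : ℚ) ^ s * (L : ℚ) ^ (s + 1) * s.factorial * (A (pt m) (nu s h) k).coeff i =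
      w * (L : ℚ) ^ s * (b * g) * ((s.factorial : ℚ) / i.factorial) := by
    rw [A_coeff, hcoef]
    calc _ = ((m.factorial : ℚ) ^ s * L) * (L : ℚ) ^ s * g * ((s.factorial : ℚ) / i.factorial) := by ring
      _ = _ := by rw [← hwq]; ring
  have hZ : (m.factorial : ℚ) ^ s * (L : ℚ) ^ (s + 1) * s.factorial * (A (pt m) (nu s h) k).coeff i =
      ((w * L ^ (s - e) * z * F : ℤ) : ℚ) := by
    rw [key, hfac]
    push_cast
    rw [← hz]
    push_cast
    rw [show (L : ℚ) ^ s = L ^ (s - e) * L ^ e by rw [← pow_add]; congr 1; omega]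
    ring
  refine ⟨_, hZ, ?_⟩
  rw [← hZ, key, abs_mul, abs_mul, abs_mul]
  have hLq : (0 : ℚ) < L := by exact_mod_cast hLpos
  rw [abs_of_nonneg (show (0:ℚ) ≤ (s.factorial : ℚ) / i.factorial by positivity),
    abs_of_nonneg (show (0:ℚ) ≤ (L : ℚ) ^ s by positivity)]
  calc _ ≤ (2 ^ (m * s) * L) * (L : ℚ) ^ s * 2 ^ (s + ((m + 1) * s + 1)) * s.factorial := by
        gcongr
        refine hb.trans ?_
        apply pow_le_pow_right₀ (by norm_num)
        omega
    _ = _ := by rw [pow_add 2 (m * s)]; ring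

lemma lcm_le (m : ℕ) : (Nat.lcmUpto m : ℝ) ≤ 512 ^ m := by
  have h1 := Chebyshev.psi_le_const_mul_self (x := (m : ℝ)) (by positivity)
  rw [Chebyshev.psi_eq_log_lcmUpto] at h1
  have hpos : (0 : ℝ) < Nat.lcmUpto m := by exact_mod_cast Nat.lcmUpto_pos m
  rw [Real.log_le_iff_le_exp hpos] at h1
  refine h1.trans ?_
  rw [mul_comm, Real.exp_nat_mul]
  gcongr
  rw [Real.exp_add, Real.exp_log (by norm_num)]
  have h2 : Real.exp 4 = Real.exp 1 ^ 4 := by rw [← Real.exp_nat_mul]; norm_num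
  have h3 := Real.exp_one_lt_d9
  have h4 : Real.exp 1 ^ 4 ≤ (2.72 : ℝ) ^ 4 := by
    gcongr
    linarith
  rw [h2]
  norm_num at h4 ⊢
  linarith

end LT

namespace LT
open Finset

lemma norm_lower (β : ℝ) (hβ : IsAlgebraic ℚ β) : ∃ (C : ℝ) (d : ℕ), 1 ≤ C ∧
    ∀ (m : ℕ) (c : Fin (m + 1) → ℤ) (H : ℝ), 1 ≤ H → (∀ k, |(c k : ℝ)| ≤ H) →
      ∑ k, (c k : ℝ) * β ^ (k : ℕ) ≠ 0 →
      1 ≤ (C ^ (m + 1) * H) ^ d * |∑ k, (c k : ℝ) * β ^ (k : ℕ)| := by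
  classical
  let K := IntermediateField.adjoin ℚ {β}
  have hint : IsIntegral ℚ β := hβ.isIntegral
  have : FiniteDimensional ℚ K := IntermediateField.adjoin.finiteDimensional hint
  let γ : K := IntermediateField.AdjoinSimple.gen ℚ β
  have hγ : algebraMap K ℝ γ = β := IntermediateField.AdjoinSimple.algebraMap_gen ℚ β
  have hγalg : IsAlgebraic ℤ γ := by
    have h1 : IsAlgebraic ℚ γ := Algebra.IsAlgebraic.isAlgebraic γ
    exact (IsFractionRing.isAlgebraic_iff ℤ ℚ K).2 h1
  obtain ⟨g, hg0, hgint⟩ := hγalg.exists_integral_multiple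
  let B : ℝ := 1 + ∑ σ : K →ₐ[ℚ] ℂ, ‖σ γ‖
  have hB1 : 1 ≤ B := by
    have : 0 ≤ ∑ σ : K →ₐ[ℚ] ℂ, ‖σ γ‖ := sum_nonneg (fun _ _ => norm_nonneg _)
    simp only [B]; linarith
  have hB : ∀ σ : K →ₐ[ℚ] ℂ, ‖σ γ‖ ≤ B := by
    intro σ
    have := single_le_sum (f := fun σ : K →ₐ[ℚ] ℂ => ‖σ γ‖) (fun _ _ => norm_nonneg _) (mem_univ σ)
    simp only [B]; linarith
  have hg1 : (1 : ℝ) ≤ |(g : ℝ)| := by exact_mod_cast Int.one_le_abs hg0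
  refine ⟨2 * |(g : ℝ)| * B, Fintype.card (K →ₐ[ℚ] ℂ), by nlinarith, ?_⟩
  intro m c H hH hc hne
  let x : K := ∑ k : Fin (m + 1), (c k : K) * (g : K) ^ m * γ ^ (k : ℕ)
  have hxint : IsIntegral ℤ x := by
    apply IsIntegral.sum
    intro k _
    have hk : (k : ℕ) ≤ m := Nat.lt_succ_iff.1 k.2
    have e : (c k : K) * (g : K) ^ m * γ ^ (k : ℕ) =
        ((c k * g ^ (m - k) : ℤ) : K) * (g • γ) ^ (k : ℕ) := by
      push_cast
      rw [zsmul_eq_mul, mul_pow]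
      rw [show (g : K) ^ m = (g : K) ^ (m - (k : ℕ)) * (g : K) ^ (k : ℕ) by
        rw [← pow_add]; congr 1; omega]
      ring
    rw [e]
    exact (isIntegral_algebraMap (R := ℤ) (A := K) (x := c k * g ^ (m - k))).mul (hgint.pow _)
  set S := ∑ k, (c k : ℝ) * β ^ (k : ℕ) with hS
  have hxS : algebraMap K ℝ x = (g : ℝ) ^ m * S := by
    simp only [x, map_sum, map_mul, map_pow, map_intCast, hγ, hS, mul_sum]
    apply sum_congr rfl
    intro k _
    ring
  have hx0 : x ≠ 0 := by
    intro h
    rw [h, map_zero] at hxS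
    have : (g : ℝ) ≠ 0 := by exact_mod_cast hg0
    exact (mul_ne_zero (pow_ne_zero m this) hne) hxS.symm
  have hnorm : (1 : ℝ) ≤ ∏ σ : K →ₐ[ℚ] ℂ, ‖σ x‖ := by
    have h1 := Algebra.norm_eq_prod_embeddings ℚ ℂ x
    have h2 : IsIntegral ℤ (Algebra.norm ℚ x) := Algebra.isIntegral_norm ℚ hxint
    obtain ⟨n, hn⟩ := IsIntegrallyClosed.isIntegral_iff.1 h2
    have h3 : Algebra.norm ℚ x ≠ 0 := Algebra.norm_ne_zero_iff.2 hx0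
    have hn0 : n ≠ 0 := by
      rintro rfl
      rw [map_zero] at hn
      exact h3 hn.symm
    rw [← norm_prod, ← h1, ← hn]
    simp
    exact_mod_cast Int.one_le_abs hn0
  set Y := (2 * |(g : ℝ)| * B) ^ (m + 1) * H with hY
  have hgm : |(g : ℝ)| ^ m ≤ Y := by
    calc |(g : ℝ)| ^ m ≤ |(g : ℝ)| ^ (m + 1) * 1 := by
          rw [mul_one]; exact pow_le_pow_right₀ hg1 (by omega)
      _ ≤ _ := by
          rw [hY]
          gcongr
          nlinarith
  have hbd : ∀ σ : K →ₐ[ℚ] ℂ, ‖σ x‖ ≤ Y := by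
    intro σ
    simp only [x, map_sum, map_mul, map_pow, map_intCast]
    refine (norm_sum_le _ _).trans ?_
    have : ∀ k ∈ (univ : Finset (Fin (m + 1))), ‖(c k : ℂ) * (g : ℂ) ^ m * (σ γ) ^ (k : ℕ)‖ ≤
        H * |(g : ℝ)| ^ m * B ^ m := by
      intro k _
      have hk : (k : ℕ) ≤ m := Nat.lt_succ_iff.1 k.2
      rw [norm_mul, norm_mul, norm_pow, norm_pow, Complex.norm_intCast, Complex.norm_intCast]
      have h1 : ‖σ γ‖ ^ (k : ℕ) ≤ B ^ m :=
        (pow_le_pow_left₀ (norm_nonneg _) (hB σ) _).trans (pow_le_pow_right₀ hB1 hk)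
      gcongr
      exact hc k
    refine (sum_le_sum this).trans ?_
    rw [sum_const, card_univ, Fintype.card_fin, nsmul_eq_mul, hY]
    have h2 : ((m + 1 : ℕ) : ℝ) ≤ 2 ^ (m + 1) := by exact_mod_cast (Nat.lt_two_pow_self).le
    have h3 : |(g : ℝ)| ^ m ≤ |(g : ℝ)| ^ (m + 1) := pow_le_pow_right₀ hg1 (by omega)
    have h4 : B ^ m ≤ B ^ (m + 1) := pow_le_pow_right₀ hB1 (by omega)
    calc _ ≤ (2 : ℝ) ^ (m + 1) * (H * |(g : ℝ)| ^ (m + 1) * B ^ (m + 1)) := by gcongr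
      _ = _ := by rw [mul_pow, mul_pow]; ring
  let τ : K →ₐ[ℚ] ℂ := (IsScalarTower.toAlgHom ℚ ℝ ℂ).comp (IsScalarTower.toAlgHom ℚ K ℝ)
  have hτ : ‖τ x‖ = |(g : ℝ)| ^ m * |S| := by
    have : τ x = ((algebraMap K ℝ x : ℝ) : ℂ) := rfl
    rw [this, hxS, Complex.norm_real, Real.norm_eq_abs, abs_mul, abs_pow]
  rw [← mul_prod_erase univ _ (mem_univ τ), hτ] at hnorm
  have h5 : ∏ σ ∈ univ.erase τ, ‖σ x‖ ≤ Y ^ (Fintype.card (K →ₐ[ℚ] ℂ) - 1) := by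
    refine (prod_le_prod (fun σ _ => norm_nonneg _) (fun σ _ => hbd σ)).trans ?_
    rw [prod_const, card_erase_of_mem (mem_univ _), card_univ]
  have hYpos : 0 ≤ Y := by positivity
  have hcard : 0 < Fintype.card (K →ₐ[ℚ] ℂ) := Fintype.card_pos_iff.2 ⟨τ⟩
  calc 1 ≤ _ := hnorm
    _ ≤ Y * |S| * Y ^ (Fintype.card (K →ₐ[ℚ] ℂ) - 1) := by
        gcongr
    _ = Y ^ (Fintype.card (K →ₐ[ℚ] ℂ) - 1 + 1) * |S| := by ring
    _ = _ := by rw [Nat.sub_add_cancel hcard]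

end LT

namespace LT
open Finset

lemma pow_sub_pow_bound (x y K : ℝ) (hK : 1 ≤ K) (hx : |x| ≤ K) (hy : |y| ≤ K) (s i : ℕ) (hi : i ≤ s) :
    |x ^ i - y ^ i| ≤ s * K ^ s * |x - y| := by
  rw [← (Commute.all x y).geom_sum₂_mul, abs_mul]
  gcongr
  refine (abs_sum_le_sum_abs _ _).trans ?_
  have : ∀ j ∈ range i, |x ^ j * y ^ (i - 1 - j)| ≤ K ^ s := by
    intro j hj
    have := mem_range.1 hj
    rw [abs_mul, abs_pow, abs_pow]
    calc _ ≤ K ^ j * K ^ (i - 1 - j) := by gcongr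
      _ = K ^ (j + (i - 1 - j)) := by rw [pow_add]
      _ ≤ _ := pow_le_pow_right₀ hK (by omega)
  refine (sum_le_sum this).trans ?_
  rw [sum_const, card_range, nsmul_eq_mul]
  gcongr

lemma fact_bound (m s : ℕ) (hm : 1 ≤ m) (hs : 1 ≤ s) :
    (m.factorial : ℝ) ^ s / (((m + 1) * s).factorial : ℝ) ≤ 4 ^ (m * s) / (s : ℝ) ^ (m * s) := by
  have h1 : ((m * s).factorial : ℝ) ≤ (((m + 1) * s).factorial : ℝ) := by
    exact_mod_cast Nat.factorial_le (by nlinarith)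
  have h2 : (m.factorial : ℝ) ≤ (m : ℝ) ^ m := by exact_mod_cast Nat.factorial_le_pow m
  have h3 := Real.pow_div_factorial_le_exp (x := ((m * s : ℕ) : ℝ)) (by positivity) (m * s)
  have h4 : Real.exp ((m * s : ℕ) : ℝ) ≤ 4 ^ (m * s) := by
    have e : Real.exp ((m * s : ℕ) : ℝ) = Real.exp 1 ^ (m * s) := by
      rw [← Real.exp_nat_mul, mul_one]
    rw [e]
    gcongr
    have := Real.exp_one_lt_d9
    linarith
  have hs' : (0 : ℝ) < s := by exact_mod_cast hs
  rw [le_div_iff₀ (by positivity)]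
  calc _ ≤ ((m : ℝ) ^ m) ^ s / ((m * s).factorial : ℝ) * (s : ℝ) ^ (m * s) := by gcongr
    _ = ((m * s : ℕ) : ℝ) ^ (m * s) / ((m * s).factorial : ℝ) := by
      push_cast; rw [mul_pow, ← pow_mul]; ring
    _ ≤ _ := h3.trans h4

lemma pade (α : ℝ) (κ m s q : ℕ) (p : ℤ) (hκ : 1 ≤ κ) (hm : 1 ≤ m) (hs : 1 ≤ s) (hq : 1 ≤ q)
    (hp : p ≠ 0) (hα : |α| ≤ 2 ^ κ) (hx : |(p : ℝ) / q| ≤ 2 ^ κ) (he : Real.exp |α| ≤ 2 ^ κ) :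
    ∃ c : Fin (m + 1) → ℤ, ∑ k, (c k : ℝ) * Real.exp α ^ (k : ℕ) ≠ 0 ∧
      (∀ k, |(c k : ℝ)| ≤ (s + 1).factorial * 2 ^ (23 * m * s) * 2 ^ (κ * s) * (q : ℝ) ^ s) ∧
      |∑ k, (c k : ℝ) * Real.exp α ^ (k : ℕ)| ≤
        (q : ℝ) ^ s * s.factorial * 2 ^ (23 * κ * m * s) / (s : ℝ) ^ (m * s) +
        (s + 1) * s * s.factorial * (q : ℝ) ^ s * 2 ^ (26 * κ * m * s) * |α - (p : ℝ) / q| := by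
  have hq0 : (0 : ℝ) < q := by exact_mod_cast hq
  set xq : ℚ := (p : ℚ) / q with hxq
  have hxq0 : xq ≠ 0 := by
    have : (q : ℚ) ≠ 0 := by positivity
    have : (p : ℚ) ≠ 0 := by exact_mod_cast hp
    positivity
  set x : ℝ := (p : ℝ) / q with hxdef
  have hxx : (xq : ℝ) = x := by simp [hxq, hxdef]
  set β := Real.exp α with hβ
  have hβpos : 0 < β := Real.exp_pos α
  have hβle : β ≤ 2 ^ κ := (Real.exp_le_exp.2 (le_abs_self α)).trans he
  obtain ⟨h, hne⟩ := exists_ne (pt m) (pt_inj m) s xq hxq0 (fun k => β ^ (k : ℕ))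
    (fun h0 => by
      have := congrFun h0 0
      simp at this)
  choose z hz hzb using main_coeff m s h
  set L := Nat.lcmUpto m with hL
  have hLpos : (0 : ℝ) < L := by exact_mod_cast Nat.lcmUpto_pos m
  set D : ℝ := (m.factorial : ℝ) ^ s * (L : ℝ) ^ (s + 1) * s.factorial with hD
  have hDpos : 0 < D := by positivity
  have hLle : (L : ℝ) ^ (s + 1) ≤ 2 ^ (18 * m * s) := by
    calc (L : ℝ) ^ (s + 1) ≤ (512 ^ m) ^ (s + 1) := by gcongr; exact lcm_le m
      _ = 2 ^ (9 * m * (s + 1)) := by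
        rw [show (512 : ℝ) = 2 ^ 9 by norm_num, ← pow_mul, ← pow_mul, mul_assoc]
      _ ≤ _ := pow_le_pow_right₀ (by norm_num) (by nlinarith)
  have hms : 1 ≤ m * s := Nat.mul_pos hm hs
  have hmms : m ≤ m * s := Nat.le_mul_of_pos_right m hs
  have hsms : s ≤ m * s := Nat.le_mul_of_pos_left s hm
  have hzr : ∀ k i, |(z k i : ℝ)| ≤ s.factorial * 2 ^ (23 * m * s) := by
    intro k i
    have h1 : |(z k i : ℝ)| ≤ s.factorial * (L : ℝ) ^ (s + 1) * 2 ^ (m * s + (s + ((m + 1) * s + 1))) := by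
      exact_mod_cast hzb k i
    refine h1.trans ?_
    calc _ ≤ s.factorial * (2 : ℝ) ^ (18 * m * s) * 2 ^ (5 * m * s) := by
          gcongr
          · norm_num
          · nlinarith
      _ = _ := by rw [mul_assoc, ← pow_add]; congr 2; ring
  have hev : ∀ k (y : ℝ), D * Polynomial.aeval y (A (pt m) (nu s h) k) =
      ∑ i ∈ range (s + 1), (z k i : ℝ) * y ^ i := by
    intro k y
    rw [Polynomial.aeval_eq_sum_range' (n := s + 1)
      (Nat.lt_succ_iff.2 (A_natDegree _ _ _ _ (nu_le _ _ _))), mul_sum]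
    apply sum_congr rfl
    intro i _
    have h1 : D * ((A (pt m) (nu s h) k).coeff i : ℝ) = (z k i : ℝ) := by
      rw [hD]
      exact_mod_cast congrArg (fun r : ℚ => (r : ℝ)) (hz k i)
    rw [← h1, Algebra.smul_def]
    simp [mul_assoc]
  let c : Fin (m + 1) → ℤ := fun k => ∑ i ∈ range (s + 1), z k i * p ^ i * q ^ (s - i)
  have hc : ∀ k, (c k : ℝ) = (q : ℝ) ^ s * ∑ i ∈ range (s + 1), (z k i : ℝ) * x ^ i := by
    intro k
    simp only [c]
    push_cast
    rw [mul_sum]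
    apply sum_congr rfl
    intro i hi
    have hi : i ≤ s := by simpa [Nat.lt_succ_iff] using hi
    rw [hxdef, div_pow, show (q : ℝ) ^ s = q ^ (s - i) * q ^ i by rw [← pow_add]; congr 1; omega]
    field_simp
  have h2κ : (1 : ℝ) ≤ 2 ^ κ := one_le_pow₀ (by norm_num)
  refine ⟨c, ?_, ?_, ?_⟩
  · have e : ∑ k, (c k : ℝ) * β ^ (k : ℕ) = (q : ℝ) ^ s * D *
        ∑ k, (((A (pt m) (nu s h) k).eval xq : ℚ) : ℝ) * β ^ (k : ℕ) := by
      rw [mul_sum]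
      apply sum_congr rfl
      intro k _
      rw [hc k, ← hev k x, ← hxx]
      have : (((A (pt m) (nu s h) k).eval xq : ℚ) : ℝ) =
          Polynomial.aeval (xq : ℝ) (A (pt m) (nu s h) k) := by
        have := Polynomial.aeval_algebraMap_apply ℝ xq (A (pt m) (nu s h) k)
        simpa using this.symm
      rw [this]
      ring
    rw [e]
    exact mul_ne_zero (by positivity) hne
  · intro k
    rw [hc k, abs_mul, abs_of_pos (by positivity : (0:ℝ) < (q:ℝ) ^ s), mul_comm]
    gcongr
    refine (abs_sum_le_sum_abs _ _).trans ?_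
    have : ∀ i ∈ range (s + 1), |(z k i : ℝ) * x ^ i| ≤
        s.factorial * 2 ^ (23 * m * s) * 2 ^ (κ * s) := by
      intro i hi
      have hi : i ≤ s := by simpa [Nat.lt_succ_iff] using hi
      rw [abs_mul, abs_pow]
      have h1 : |x| ^ i ≤ 2 ^ (κ * s) := by
        calc |x| ^ i ≤ (2 ^ κ) ^ i := by gcongr
          _ ≤ (2 ^ κ) ^ s := pow_le_pow_right₀ h2κ hi
          _ = _ := by rw [pow_mul]
      have := hzr k i
      gcongr
    refine (sum_le_sum this).trans ?_
    rw [sum_const, card_range, nsmul_eq_mul, Nat.factorial_succ]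
    push_cast
    apply le_of_eq
    ring
  · have e : ∑ k, (c k : ℝ) * β ^ (k : ℕ) =
        (q : ℝ) ^ s * D * (∑ k, Polynomial.aeval α (A (pt m) (nu s h) k) * Real.exp (((pt m k : ℚ) : ℝ) * α))
        - ∑ k, ∑ i ∈ range (s + 1), (q : ℝ) ^ s * (z k i : ℝ) * (α ^ i - x ^ i) * β ^ (k : ℕ) := by
      rw [mul_sum, ← sum_sub_distrib]
      apply sum_congr rfl
      intro k _
      have e1 : Real.exp (((pt m k : ℚ) : ℝ) * α) = β ^ (k : ℕ) := by
        rw [hβ, ← Real.exp_nat_mul]; simp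
      rw [e1, hc k]
      rw [show (q : ℝ) ^ s * D * (Polynomial.aeval α (A (pt m) (nu s h) k) * β ^ (k : ℕ)) =
        (q : ℝ) ^ s * (D * Polynomial.aeval α (A (pt m) (nu s h) k)) * β ^ (k : ℕ) by ring, hev,
        mul_sum, mul_sum, sum_mul, sum_mul, ← sum_sub_distrib]
      apply sum_congr rfl
      intro i _
      ring
    rw [e]
    refine (abs_sub _ _).trans ?_
    apply add_le_add
    · have hR := R_bound (pt m) (pt_inj m) (m : ℚ) (by exact_mod_cast hm)
        (fun i => by
          have hi : (i : ℕ) ≤ m := Nat.lt_succ_iff.1 i.2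
          simp only [pt]
          rw [Nat.abs_cast]
          exact_mod_cast hi) ((m + 1) * s) (nu s h) (by rw [sum_nu, Fintype.card_fin]) α
      rw [abs_mul, abs_of_pos (by positivity : 0 < (q : ℝ) ^ s * D)]
      have h1 : Real.exp (((m : ℚ) : ℝ) * |α|) ≤ 2 ^ (κ * m) := by
        rw [Rat.cast_natCast, Real.exp_nat_mul, pow_mul]
        gcongr
      have h2 : |α| ^ ((m + 1) * s) ≤ 2 ^ (2 * κ * m * s) := by
        calc |α| ^ ((m + 1) * s) ≤ (2 ^ κ) ^ ((m + 1) * s) := by gcongr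
          _ = 2 ^ (κ * ((m + 1) * s)) := by rw [← pow_mul]
          _ ≤ _ := pow_le_pow_right₀ (by norm_num) (by nlinarith)
      have h3 := fact_bound m s hm hs
      calc _ ≤ (q : ℝ) ^ s * D * (|α| ^ ((m + 1) * s) / ((m + 1) * s).factorial * Real.exp (((m : ℚ) : ℝ) * |α|)) := by
            gcongr
        _ ≤ (q : ℝ) ^ s * D * (2 ^ (2 * κ * m * s) / ((m + 1) * s).factorial * 2 ^ (κ * m)) := by
            gcongr
        _ = (q : ℝ) ^ s * s.factorial * ((L : ℝ) ^ (s + 1) * 2 ^ (2 * κ * m * s) * 2 ^ (κ * m)) *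
            ((m.factorial : ℝ) ^ s / ((m + 1) * s).factorial) := by
            rw [hD]; ring
        _ ≤ (q : ℝ) ^ s * s.factorial * (2 ^ (18 * m * s) * 2 ^ (2 * κ * m * s) * 2 ^ (κ * m)) *
            (4 ^ (m * s) / (s : ℝ) ^ (m * s)) := by
            gcongr
        _ = (q : ℝ) ^ s * s.factorial * 2 ^ (18 * m * s + 2 * κ * m * s + κ * m + 2 * (m * s))
              / (s : ℝ) ^ (m * s) := by
            rw [show (4 : ℝ) = 2 ^ 2 by norm_num, ← pow_mul, pow_add, pow_add, pow_add]; ring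
        _ ≤ _ := by
            gcongr
            · norm_num
            · have : m * s ≤ κ * (m * s) := Nat.le_mul_of_pos_left _ hκ
              have : κ * m ≤ κ * (m * s) := Nat.mul_le_mul_left _ hmms
              nlinarith
    · refine (abs_sum_le_sum_abs _ _).trans ?_
      have hterm : ∀ k ∈ (univ : Finset (Fin (m + 1))),
          |∑ i ∈ range (s + 1), (q : ℝ) ^ s * (z k i : ℝ) * (α ^ i - x ^ i) * β ^ (k : ℕ)| ≤
          (s + 1) * ((q : ℝ) ^ s * (s.factorial * 2 ^ (23 * m * s)) * (s * (2 ^ κ) ^ s * |α - x|) * 2 ^ (κ * m)) := by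
        intro k _
        have hk : (k : ℕ) ≤ m := Nat.lt_succ_iff.1 k.2
        refine (abs_sum_le_sum_abs _ _).trans ?_
        have : ∀ i ∈ range (s + 1), |(q : ℝ) ^ s * (z k i : ℝ) * (α ^ i - x ^ i) * β ^ (k : ℕ)| ≤
            (q : ℝ) ^ s * (s.factorial * 2 ^ (23 * m * s)) * (s * (2 ^ κ) ^ s * |α - x|) * 2 ^ (κ * m) := by
          intro i hi
          have hi : i ≤ s := by simpa [Nat.lt_succ_iff] using hi
          rw [abs_mul, abs_mul, abs_mul, abs_of_pos (by positivity : 0 < (q : ℝ) ^ s),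
            abs_of_pos (by positivity : 0 < β ^ (k : ℕ))]
          have h1 := hzr k i
          have h2 := pow_sub_pow_bound α x (2 ^ κ) h2κ hα hx s i hi
          have h3 : β ^ (k : ℕ) ≤ 2 ^ (κ * m) := by
            calc β ^ (k : ℕ) ≤ (2 ^ κ) ^ (k : ℕ) := by gcongr
              _ ≤ (2 ^ κ) ^ m := pow_le_pow_right₀ h2κ hk
              _ = _ := by rw [pow_mul]
          gcongr
        refine (sum_le_sum this).trans ?_
        rw [sum_const, card_range, nsmul_eq_mul]
        push_cast
        exact le_rfl
      refine (sum_le_sum hterm).trans ?_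
      rw [sum_const, card_univ, Fintype.card_fin, nsmul_eq_mul]
      have hm2 : ((m + 1 : ℕ) : ℝ) ≤ 2 ^ m := by exact_mod_cast Nat.lt_two_pow_self (n := m)
      calc _ ≤ (2 : ℝ) ^ m * ((s + 1) * ((q : ℝ) ^ s * (s.factorial * 2 ^ (23 * m * s)) * (s * (2 ^ κ) ^ s * |α - x|) * 2 ^ (κ * m))) := by
            gcongr
        _ = (s + 1) * s * s.factorial * (q : ℝ) ^ s * 2 ^ (m + 23 * m * s + κ * s + κ * m) * |α - x| := by
            rw [← pow_mul, pow_add, pow_add, pow_add]; ring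
        _ ≤ _ := by
            gcongr
            · norm_num
            · have h1 : m * s ≤ κ * (m * s) := Nat.le_mul_of_pos_left _ hκ
              have h2 : κ * m ≤ κ * (m * s) := Nat.mul_le_mul_left _ hmms
              have h3 : κ * s ≤ κ * (m * s) := Nat.mul_le_mul_left _ hsms
              nlinarith

end LT

namespace LT
open Finset

theorem exp_not_alg (α : ℝ) (h : Liouville α) : ¬ IsAlgebraic ℚ (Real.exp α) := by
  intro halg
  obtain ⟨C, d, hC, hnorm⟩ := norm_lower _ halg
  obtain ⟨κ, hκ1, hκa, hκe, hκC⟩ : ∃ κ : ℕ, 1 ≤ κ ∧ |α| + 1 ≤ (2 : ℝ) ^ κ ∧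
      Real.exp |α| ≤ 2 ^ κ ∧ C ≤ 2 ^ κ := by
    obtain ⟨k, hk⟩ := pow_unbounded_of_one_lt (|α| + 1 + Real.exp |α| + C) (one_lt_two)
    have h1 := abs_nonneg α
    have h2 := Real.exp_pos |α|
    have h3 : (2 : ℝ) ^ k ≤ 2 ^ (k + 1) := pow_le_pow_right₀ (by norm_num) (by omega)
    exact ⟨k + 1, by omega, by linarith, by linarith, by linarith⟩
  set σ := 23 * κ + 26 * κ * d + 1 with hσ
  obtain ⟨s, hs⟩ : ∃ s : ℕ, s = 2 ^ σ := ⟨_, rfl⟩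
  have hs1 : 1 ≤ s := hs ▸ Nat.one_le_two_pow
  set F : ℝ := ((s + 1).factorial : ℝ) with hF
  have hF1 : 1 ≤ F := by
    rw [hF]; exact_mod_cast Nat.succ_le_of_lt (Nat.factorial_pos _)
  have hsF : (s.factorial : ℝ) ≤ F := by
    rw [hF]; exact_mod_cast Nat.factorial_le (by omega)
  set E := 26 * κ * (d + 1) * s * (d + 2) with hE
  set N0 := s * (d + 1) + E with hN0
  set K : ℝ := F ^ d * ((s + 1) * s * s.factorial) * 2 ^ E with hK
  have hα0 : 0 < |α| := abs_pos.2 (by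
    rintro rfl
    exact h.irrational ⟨0, by simp⟩)
  have hev : ∀ᶠ q : ℕ in Filter.atTop, 2 * F ^ (d + 1) < (q : ℝ) ∧ 2 * K < (q : ℝ) ∧
      1 / |α| < (q : ℝ) ∧ 2 ≤ q := by
    have ht := tendsto_natCast_atTop_atTop (R := ℝ)
    exact (ht.eventually_gt_atTop _).and ((ht.eventually_gt_atTop _).and
      ((ht.eventually_gt_atTop _).and (Filter.eventually_ge_atTop 2)))
  obtain ⟨q, ⟨hq1, hq2, hq3, hq4⟩, p, -, hpδ⟩ :=
    (hev.and_frequently (h.frequently_exists_num (N0 + 1))).exists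
  have hQ2 : (2 : ℝ) ≤ q := by exact_mod_cast hq4
  set Q : ℝ := (q : ℝ) with hQ
  have hQ0 : 0 < Q := by linarith
  have hδ1 : 1 / Q ^ (N0 + 1) ≤ 1 / Q :=
    one_div_le_one_div_of_le hQ0 (le_self_pow₀ (by linarith) (by omega))
  have hp0 : p ≠ 0 := by
    rintro rfl
    have h1 : |α| < 1 / Q := by
      have := hpδ.trans_le hδ1
      simpa using this
    rw [div_lt_iff₀ hα0] at hq3
    rw [lt_div_iff₀ hQ0] at h1
    linarith
  have hx : |(p : ℝ) / q| ≤ 2 ^ κ := by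
    have h1 : |(p : ℝ) / q| ≤ |α| + |α - p / q| := by
      have := abs_sub α (α - p / q)
      simpa using this
    have h2 : 1 / Q ≤ 1 := by rw [div_le_one hQ0]; linarith
    linarith
  obtain ⟨l, hl1, hl2, hl3⟩ : ∃ l : ℕ, 1 ≤ l ∧ Q ≤ 2 ^ l ∧ (2 : ℝ) ^ l ≤ 2 * Q := by
    refine ⟨Nat.log 2 q + 1, by omega, ?_, ?_⟩
    · have := (Nat.lt_pow_succ_log_self (b := 2) (by norm_num) q).le
      rw [hQ]; exact_mod_cast this
    · have := Nat.pow_log_le_self 2 (x := q) (by omega)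
      have h2 : ((2 : ℝ) ^ Nat.log 2 q) ≤ q := by exact_mod_cast this
      rw [pow_succ]; linarith
  obtain ⟨m, hm⟩ : ∃ m : ℕ, m = (d + 2) * l := ⟨_, rfl⟩
  have hm1 : 1 ≤ m := hm ▸ Nat.mul_pos (by omega) hl1
  obtain ⟨c, hne, hcb, hS⟩ := pade α κ m s q p hκ1 hm1 hs1 (by omega) hp0
    (by linarith) hx hκe
  set S := |∑ k, (c k : ℝ) * Real.exp α ^ (k : ℕ)| with hSdef
  set H : ℝ := F * 2 ^ (23 * m * s) * 2 ^ (κ * s) * Q ^ s with hH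
  have hH1 : 1 ≤ H := by
    have a1 : (1 : ℝ) ≤ 2 ^ (23 * m * s) := one_le_pow₀ (by norm_num)
    have a2 : (1 : ℝ) ≤ 2 ^ (κ * s) := one_le_pow₀ (by norm_num)
    have a3 : (1 : ℝ) ≤ Q ^ s := one_le_pow₀ (by linarith)
    exact one_le_mul_of_one_le_of_one_le (one_le_mul_of_one_le_of_one_le
      (one_le_mul_of_one_le_of_one_le hF1 a1) a2) a3
  have hlow := hnorm m c H hH1 hcb hne
  have hY : (C ^ (m + 1) * H) ^ d ≤ F ^ d * 2 ^ (26 * κ * d * (m * s)) * Q ^ (s * d) := by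
    have h1 : C ^ (m + 1) * H ≤ F * 2 ^ (26 * κ * (m * s)) * Q ^ s := by
      have hms : 1 ≤ m * s := Nat.mul_pos hm1 hs1
      have hmms : m ≤ m * s := Nat.le_mul_of_pos_right m hs1
      have hsms : s ≤ m * s := Nat.le_mul_of_pos_left s hm1
      calc C ^ (m + 1) * H ≤ (2 ^ κ) ^ (m + 1) * H := by gcongr
        _ = F * 2 ^ (κ * (m + 1) + 23 * m * s + κ * s) * Q ^ s := by
          rw [hH, ← pow_mul, pow_add, pow_add]; ring
        _ ≤ _ := by
          gcongr
          · norm_num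
          · nlinarith [Nat.mul_le_mul_left κ hmms, Nat.mul_le_mul_left κ hsms,
              Nat.mul_le_mul_left κ hms, Nat.mul_le_mul_right (m * s) hκ1]
    calc (C ^ (m + 1) * H) ^ d ≤ (F * 2 ^ (26 * κ * (m * s)) * Q ^ s) ^ d := by
          gcongr
      _ = _ := by
          rw [mul_pow, mul_pow, ← pow_mul, ← pow_mul,
            show 26 * κ * (m * s) * d = 26 * κ * d * (m * s) by ring]
  set T : ℝ := 2 ^ (m * s) with hT
  have hT0 : 0 < T := by positivity
  have hTlow : Q ^ (s * (d + 2)) ≤ T := by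
    calc Q ^ (s * (d + 2)) ≤ (2 ^ l) ^ (s * (d + 2)) := by gcongr
      _ = T := by rw [hT, ← pow_mul, hm]; congr 1; ring
  have hTup : T ≤ (2 * Q) ^ (s * (d + 2)) := by
    calc T = (2 ^ l) ^ (s * (d + 2)) := by rw [hT, ← pow_mul, hm]; congr 1; ring
      _ ≤ _ := by gcongr
  have e1 : ∀ a : ℕ, (2 : ℝ) ^ (a * (m * s)) = T ^ a := fun a => by
    rw [hT, ← pow_mul, mul_comm]
  rw [e1] at hY
  have e2 : (2 : ℝ) ^ (23 * κ * m * s) = T ^ (23 * κ) := by rw [← e1]; congr 1; ring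
  have e3 : (2 : ℝ) ^ (26 * κ * m * s) = T ^ (26 * κ) := by rw [← e1]; congr 1; ring
  have e4 : (s : ℝ) ^ (m * s) = T ^ σ := by
    rw [← e1, hs]; push_cast; rw [← pow_mul]
  rw [e2, e3, e4] at hS
  set δ := |α - (p : ℝ) / q| with hδ
  have hδ0 : 0 ≤ δ := abs_nonneg _
  set Y := (C ^ (m + 1) * H) ^ d
  set Y' : ℝ := F ^ d * T ^ (26 * κ * d) * Q ^ (s * d) with hY'
  have hY'0 : 0 < Y' := by positivity
  have hmain : Y' * (Q ^ s * s.factorial * T ^ (23 * κ) / T ^ σ) < 1 / 2 := by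
    calc Y' * (Q ^ s * s.factorial * T ^ (23 * κ) / T ^ σ)
        ≤ Y' * (Q ^ s * F * T ^ (23 * κ) / T ^ σ) := by gcongr
      _ = F ^ (d + 1) * Q ^ (s * (d + 1)) / T := by
        rw [hY', hσ, pow_succ T, pow_add T, mul_add s, pow_add Q]
        field_simp
        ring
      _ ≤ F ^ (d + 1) * Q ^ (s * (d + 1)) / Q ^ (s * (d + 2)) := by gcongr
      _ = F ^ (d + 1) / Q ^ s := by
        rw [show s * (d + 2) = s * (d + 1) + s by ring, pow_add]
        field_simp
        ring
      _ ≤ F ^ (d + 1) / Q := by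
        gcongr
        exact le_self_pow₀ (by linarith) (by omega)
      _ < 1 / 2 := by
        rw [div_lt_div_iff₀ hQ0 (by norm_num)]; linarith
  have herr : Y' * ((s + 1) * s * s.factorial * Q ^ s * T ^ (26 * κ) * δ) < 1 / 2 := by
    have hTE : T ^ (26 * κ * (d + 1)) ≤ 2 ^ E * Q ^ E := by
      calc T ^ (26 * κ * (d + 1)) ≤ ((2 * Q) ^ (s * (d + 2))) ^ (26 * κ * (d + 1)) := by
            gcongr
        _ = (2 * Q) ^ E := by rw [← pow_mul, hE]; congr 1; ring
        _ = _ := mul_pow _ _ _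
    calc Y' * ((s + 1) * s * s.factorial * Q ^ s * T ^ (26 * κ) * δ)
        = F ^ d * ((s + 1) * s * s.factorial) * T ^ (26 * κ * (d + 1)) * Q ^ (s * (d + 1)) * δ := by
          rw [hY', mul_add (26 * κ), mul_add s, pow_add, pow_add, mul_one, mul_one]; ring
      _ ≤ F ^ d * ((s + 1) * s * s.factorial) * (2 ^ E * Q ^ E) * Q ^ (s * (d + 1)) *
            (1 / Q ^ (N0 + 1)) := by
          gcongr
      _ = K / Q := by
          rw [hK, hN0, pow_succ, pow_add]
          field_simp
      _ < 1 / 2 := by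
        rw [div_lt_div_iff₀ hQ0 (by norm_num)]; linarith
  have hfin : Y * S ≤ Y' * (Q ^ s * s.factorial * T ^ (23 * κ) / T ^ σ +
      (s + 1) * s * s.factorial * Q ^ s * T ^ (26 * κ) * δ) :=
    mul_le_mul hY hS (abs_nonneg _) hY'0.le
  rw [mul_add] at hfin
  linarith

end LT

theorem liouville_tanh_transcendental (α : ℝ) (h : Liouville α) :
    Transcendental ℚ (Real.tanh α) := by
  intro ht
  apply LT.exp_not_alg α h
  have h1 : IsAlgebraic ℚ ((1 + Real.tanh α) / (1 - Real.tanh α)) := by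
    rw [div_eq_mul_inv]
    exact (isAlgebraic_one.add ht).mul (isAlgebraic_one.sub ht).inv
  have h2 : (1 + Real.tanh α) / (1 - Real.tanh α) = Real.exp α ^ 2 := by
    have hc := (Real.cosh_pos α).ne'
    have a1 : 1 + Real.tanh α = Real.exp α / Real.cosh α := by
      rw [Real.tanh_eq_sinh_div_cosh, ← Real.cosh_add_sinh]; field_simp
    have a2 : 1 - Real.tanh α = Real.exp (-α) / Real.cosh α := by
      rw [Real.tanh_eq_sinh_div_cosh, ← Real.cosh_sub_sinh]; field_simp
    rw [a1, a2, Real.exp_neg]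
    field_simp
  rw [h2] at h1
  exact IsAlgebraic.of_pow (by norm_num) h1
end
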